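/- Let V be a uniformly local OPE-algebra with translation generator 𝐓. Then V, with Y_M := Y, is a module over itself: V is a bounded 𝕂̄-fold V-module, 𝐓 is a translation endomorphism of this module, V is dual, and Y is a morphism of K²-fold algebras, i.e. Y(a_(𝐧)b) = a(𝐳)_(𝐧)b(𝐳) for all a,b∈V and 𝐧∈K². -/

import Mathlib

open scoped BigOperators Classical

noncomputable section

namespace OPEA

variable (K : Type*) [Field K] [CharZero K]

/-- index pairs 𝐧 = (n, n̄) ∈ K² -/
abbrev Idx := K × K

def IsInt (x : K) : Prop := ∃ k : ℤ, (k : K) = x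

def IsNegInt (x : K) : Prop := ∃ k : ℤ, k < 0 ∧ (k : K) = x

/-- 𝕂̄ = {𝐧 ∈ K² | n − n̄ ∈ ℤ} -/
def Kbar (n : Idx K) : Prop := IsInt K (n.1 - n.2)

def IsIntPair (n : Idx K) : Prop := IsInt K n.1 ∧ IsInt K n.2

/-- generalized binomial coefficient C(x,k) -/
def gchoose (x : K) (k : ℕ) : K :=
  (∏ i ∈ Finset.range k, (x - (i : K))) / (k.factorial : K)

/-- (−1)^x for x an integer image in K (and 1 otherwise) -/
def negOnePow (x : K) : K :=
  if h : ∃ k : ℤ, (k : K) = x then (-1 : K) ^ h.choose else 1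

variable (M : Type*) [AddCommGroup M] [Module K M]

/-- M-valued distribution in one variable pair -/
abbrev Dist1 := Idx K → M

/-- M-valued distribution in two variable pairs -/
abbrev Dist2 := Idx K → Idx K → M

/-- M-valued distribution in r variable pairs -/
abbrev DistN (r : ℕ) := (Fin r → Idx K) → M

/-- membership in M[[𝐳]] -/
def IsPow1 (a : Dist1 K M) : Prop := ∀ n, a n ≠ 0 → IsNegInt K n.1 ∧ IsNegInt K n.2

/-- membership in M⌊𝐳⌋ -/
def InLat1 (a : Dist1 K M) : Prop :=
  ∃ S : Finset (Idx K), ∀ n, a n ≠ 0 →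
    ∃ m ∈ S, IsNegInt K (n.1 - m.1) ∧ IsNegInt K (n.2 - m.2)

/-- membership in M[[𝐳,𝐰]] -/
def IsPow2 (a : Dist2 K M) : Prop :=
  ∀ n k, a n k ≠ 0 →
    (IsNegInt K n.1 ∧ IsNegInt K n.2) ∧ (IsNegInt K k.1 ∧ IsNegInt K k.2)

/-- membership in M⌊𝐳,𝐰⌋ -/
def InLat2 (a : Dist2 K M) : Prop :=
  ∃ S : Finset (Idx K × Idx K), ∀ n k, a n k ≠ 0 →
    ∃ m ∈ S, (IsNegInt K (n.1 - m.1.1) ∧ IsNegInt K (n.2 - m.1.2)) ∧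
      (IsNegInt K (k.1 - m.2.1) ∧ IsNegInt K (k.2 - m.2.2))

/-- membership in M[[𝐳₁,…,𝐳ᵣ]] -/
def IsPowN {r : ℕ} (a : DistN K M r) : Prop :=
  ∀ n, a n ≠ 0 → ∀ i, IsNegInt K (n i).1 ∧ IsNegInt K (n i).2

/-- membership in M⌊𝐳₁,…,𝐳ᵣ⌋ -/
def InLatN {r : ℕ} (a : DistN K M r) : Prop :=
  ∃ S : Finset (Fin r → Idx K), ∀ n, a n ≠ 0 →
    ∃ m ∈ S, ∀ i, IsNegInt K ((n i).1 - (m i).1) ∧ IsNegInt K ((n i).2 - (m i).2)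

/-- ∂_z -/
def dz (a : Dist1 K M) : Dist1 K M := fun n => (-n.1) • a (n.1 - 1, n.2)

/-- ∂_z̄ -/
def dzb (a : Dist1 K M) : Dist1 K M := fun n => (-n.2) • a (n.1, n.2 - 1)

/-- ∂ in the first variable pair of a two-variable distribution (z-component) -/
def d1z (c : Dist2 K M) : Dist2 K M := fun n k => (-n.1) • c (n.1 - 1, n.2) k

/-- ∂ in the first variable pair of a two-variable distribution (z̄-component) -/
def d1zb (c : Dist2 K M) : Dist2 K M := fun n k => (-n.2) • c (n.1, n.2 - 1) k

/-- divided power d^{(x)} of an operator d, for a K-valued exponent x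
(zero unless x ∈ ℕ) -/
def dPow {A : Type*} [AddCommGroup A] [Module K A] (d : A → A) (x : K) (a : A) : A :=
  if h : ∃ j : ℕ, (j : K) = x then ((h.choose.factorial : K))⁻¹ • d^[h.choose] a else 0

/-- ∂_z^{(e_1)} ∂_z̄^{(e_2)} in the first variable pair -/
def ddPow2 (e : Idx K) (c : Dist2 K M) : Dist2 K M :=
  dPow K (d1z K M) e.1 (dPow K (d1zb K M) e.2 c)

/-- the diagonal map c(𝐳,𝐰) ↦ c(𝐰,𝐰) -/
def diag (c : Dist2 K M) : Dist1 K M :=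
  fun n => ∑ᶠ m : Idx K, c m (n.1 - m.1 - 1, n.2 - m.2 - 1)

/-- multiplication by (𝐳−𝐰)^h (expansion in z>w), on coefficients;
first index is 𝐳, second is 𝐰 -/
def zwPow (h : Idx K) (c : Dist2 K M) : Dist2 K M :=
  fun m k => ∑ᶠ i : ℕ × ℕ,
    ((-1 : K) ^ (i.1 + i.2) * gchoose K h.1 i.1 * gchoose K h.2 i.2) •
      c (m.1 + h.1 - i.1, m.2 + h.2 - i.2) (k.1 + i.1, k.2 + i.2)

/-- multiplication by ((𝐳−𝐰)_{w>z})^h = (−1)^h (𝐰−𝐳)^h (expansion in w>z) -/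
def zwPowW (h : Idx K) (c : Dist2 K M) : Dist2 K M :=
  fun m k => ∑ᶠ i : ℕ × ℕ,
    (negOnePow K (h.1 - h.2) * (-1 : K) ^ (i.1 + i.2) *
        gchoose K h.1 i.1 * gchoose K h.2 i.2) •
      c (m.1 + i.1, m.2 + i.2) (k.1 + h.1 - i.1, k.2 + h.2 - i.2)

/-- multiplication by (𝐱+𝐰)^N of a distribution d(𝐰,𝐱) (first index 𝐰, second 𝐱);
the result is indexed by (x-index, w-index) -/
def xwPow (N : Idx K) (d : Dist2 K M) : Dist2 K M :=
  fun m k => ∑ᶠ i : ℕ × ℕ, (gchoose K N.1 i.1 * gchoose K N.2 i.2) •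
    d (k.1 + i.1, k.2 + i.2) (m.1 + N.1 - i.1, m.2 + N.2 - i.2)

/-- multiplication by (𝐰+𝐱)^N of a distribution d(𝐰,𝐱) (first index 𝐰, second 𝐱);
the result is indexed by (x-index, w-index) -/
def wxPow (N : Idx K) (d : Dist2 K M) : Dist2 K M :=
  fun m k => ∑ᶠ i : ℕ × ℕ, (gchoose K N.1 i.1 * gchoose K N.2 i.2) •
    d (k.1 + N.1 - i.1, k.2 + N.2 - i.2) (m.1 + i.1, m.2 + i.2)

/-- multiplication by 𝐱^A 𝐰^B (𝐱+𝐰)^N of p(𝐰,𝐱); result indexed (x-index, w-index) -/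
def tripleXW (A B N : Idx K) (p : Dist2 K M) : Dist2 K M :=
  fun m k => ∑ᶠ l : ℕ × ℕ, (gchoose K N.1 l.1 * gchoose K N.2 l.2) •
    p (k.1 + B.1 + l.1, k.2 + B.2 + l.2) (m.1 + A.1 + N.1 - l.1, m.2 + A.2 + N.2 - l.2)

/-- multiplication by 𝐱^A 𝐰^B (𝐰+𝐱)^N of p(𝐰,𝐱); result indexed (x-index, w-index) -/
def tripleWX (A B N : Idx K) (p : Dist2 K M) : Dist2 K M :=
  fun m k => ∑ᶠ l : ℕ × ℕ, (gchoose K N.1 l.1 * gchoose K N.2 l.2) •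
    p (k.1 + B.1 + N.1 - l.1, k.2 + B.2 + N.2 - l.2) (m.1 + A.1 + l.1, m.2 + A.2 + l.2)

variable (E : Type*) [AddCommGroup E] [Module K E]

/-- End(E)-valued distributions in one variable pair -/
abbrev EDist1 := Dist1 K (Module.End K E)

/-- End(E)-valued distributions in two variable pairs -/
abbrev EDist2 := Dist2 K (Module.End K E)

/-- End(E)-valued distributions in r variable pairs -/
abbrev EDistN (r : ℕ) := DistN K (Module.End K E) r

def ev1 (a : EDist1 K E) (v : E) : Dist1 K E := fun n => a n v

def ev2 (c : EDist2 K E) (v : E) : Dist2 K E := fun n k => c n k v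

def evN {r : ℕ} (c : EDistN K E r) (v : E) : DistN K E r := fun n => c n v

/-- a(𝐳) is a field -/
def IsFieldD (a : EDist1 K E) : Prop := ∀ v, InLat1 K E (ev1 K E a v)

/-- a field in two variable pairs -/
def IsField2D (c : EDist2 K E) : Prop := ∀ v, InLat2 K E (ev2 K E c v)

/-- the Koszul sign (−1)^{pq} -/
def koszul (p q : ZMod 2) : K := if p = 1 ∧ q = 1 then (-1 : K) else 1

/-- the data (c^i, 𝐡_i) is an OPE of the homogeneous distributions a(𝐳), b(𝐳)
of parities pa, pb (all identities to be read applied to each vector of E) -/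
def IsOPE (pa pb : ZMod 2) (a b : EDist1 K E) {r : ℕ}
    (c : Fin r → EDist2 K E) (h : Fin r → Idx K) : Prop :=
  (∀ i, Kbar K (h i)) ∧ (∀ i, IsField2D K E (c i)) ∧
  (∀ v m k, a m (b k v) = ∑ i, zwPow K E (-(h i)) (ev2 K E (c i) v) m k) ∧
  (∀ v m k, koszul K pa pb • (b k (a m v)) =
      ∑ i, zwPowW K E (-(h i)) (ev2 K E (c i) v) m k)

/-- a(𝐳), b(𝐳) (homogeneous of parities pa, pb) are local -/
def IsLocal (pa pb : ZMod 2) (a b : EDist1 K E) : Prop :=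
  ∃ (r : ℕ) (c : Fin r → EDist2 K E) (h : Fin r → Idx K), IsOPE K E pa pb a b c h

/-- the exponents of an OPE are reduced: 𝐡_i ∉ 𝐡_j + ℤ² for i ≠ j -/
def ReducedExp {r : ℕ} (h : Fin r → Idx K) : Prop :=
  ∀ i j, i ≠ j → ¬ IsIntPair K (h i - h j)

/-- the product field a(𝐰)_{(𝐧)}b(𝐰) built from an OPE (c,h), applied to a vector v -/
def prodAt {r : ℕ} (c : Fin r → EDist2 K E) (h : Fin r → Idx K) (n : Idx K)
    (v : E) : Dist1 K E :=
  fun m => ∑ i, diag K E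
    (ddPow2 K E ((h i).1 - 1 - n.1, (h i).2 - 1 - n.2) (ev2 K E (c i) v)) m

/-- s₁ : a(𝐳) ↦ a_{(−1,−1)}1 -/
def s1 (one : E) (a : EDist1 K E) : E := a ((-1 : K), (-1 : K)) one

/-- the distribution d (to be thought of as a(𝐳)1) equals
Σ_{𝐢∈ℕ²} T^{(i)} T̄^{(ī)} (d_{(−1,−1)}) 𝐳^𝐢, i.e. a(𝐳) is creative -/
def CreativeD (T Tb : Module.End K E) (d : Dist1 K E) : Prop :=
  (∀ i : ℕ × ℕ, d (-(i.1 : K) - 1, -(i.2 : K) - 1) =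
      ((i.1.factorial : K)⁻¹ * (i.2.factorial : K)⁻¹) •
        ((T ^ i.1) * (Tb ^ i.2)) (d ((-1 : K), (-1 : K)))) ∧
  (∀ n : Idx K, (¬ ∃ i : ℕ × ℕ, n = (-(i.1 : K) - 1, -(i.2 : K) - 1)) → d n = 0)

/-- a(𝐳) is translation covariant for (T, T̄) -/
def TransCov (T Tb : Module.End K E) (a : EDist1 K E) : Prop :=
  (∀ n : Idx K, T * a n - a n * T = (-n.1) • a (n.1 - 1, n.2)) ∧
  (∀ n : Idx K, Tb * a n - a n * Tb = (-n.2) • a (n.1, n.2 - 1))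

/-- translation covariance of a product field, per vector -/
def TransCovAt (T Tb : Module.End K E) (P : E → Dist1 K E) : Prop :=
  (∀ v (m : Idx K), T (P v m) - P (T v) m = (-m.1) • P v (m.1 - 1, m.2)) ∧
  (∀ v (m : Idx K), Tb (P v m) - P (Tb v) m = (-m.2) • P v (m.1, m.2 - 1))

/-- the identity field 1(z) = id_E -/
def idField : EDist1 K E :=
  fun n => if n = ((-1 : K), (-1 : K)) then (1 : Module.End K E) else 0

/-- pairs i < j in [r] -/
abbrev Pairs (r : ℕ) := {p : Fin r × Fin r // p.1 < p.2}

/-- the index shift of the i-th variable produced by the monomial of a binomial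
expansion of ((𝐳_{p₁} − 𝐳_{p₂})_σ)^h belonging to 𝐤 ∈ ℕ² -/
def pairShift {r : ℕ} (p : Pairs r) (h : Idx K) (flip : Bool) (kk : ℕ × ℕ)
    (i : Fin r) : Idx K :=
  if i = p.1.1 then
    (if flip then ((kk.1 : K), (kk.2 : K)) else (h.1 - kk.1, h.2 - kk.2))
  else if i = p.1.2 then
    (if flip then (h.1 - kk.1, h.2 - kk.2) else ((kk.1 : K), (kk.2 : K)))
  else 0

/-- the coefficient of a binomial expansion of ((𝐳_{p₁} − 𝐳_{p₂})_σ)^h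
belonging to 𝐤 ∈ ℕ² -/
def pairCoef (h : Idx K) (flip : Bool) (kk : ℕ × ℕ) : K :=
  (if flip then negOnePow K (h.1 - h.2) else 1) * (-1 : K) ^ (kk.1 + kk.2) *
    gchoose K h.1 kk.1 * gchoose K h.2 kk.2

def flipOf {r : ℕ} (σ : Equiv.Perm (Fin r)) (p : Pairs r) : Bool :=
  decide (σ.symm p.1.2 < σ.symm p.1.1)

/-- multiplication by Π_{i<j} ((𝐳_i − 𝐳_j)_σ)^{h_{ij}} on an r-variable distribution -/
def permMul {r : ℕ} (σ : Equiv.Perm (Fin r)) (hs : Pairs r → Idx K)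
    (c : DistN K M r) : DistN K M r :=
  fun m => ∑ᶠ κ : Pairs r → ℕ × ℕ,
    (∏ p : Pairs r, pairCoef K (hs p) (flipOf σ p) (κ p)) •
      c (fun i => m i + ∑ p : Pairs r, pairShift K p (hs p) (flipOf σ p) (κ p) i)

/-- the Koszul sign ζ' produced by reordering a¹,…,aʳ into a^{σ1},…,a^{σr} -/
def koszulPerm {r : ℕ} (ps : Fin r → ZMod 2) (σ : Equiv.Perm (Fin r)) : K :=
  ∏ p : Pairs r,
    if σ.symm p.1.2 < σ.symm p.1.1 ∧ ps p.1.1 = 1 ∧ ps p.1.2 = 1 then (-1 : K) else 1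

/-- the composition a^{σ1}(𝐳_{σ1})_{m_{σ1}} ∘ ⋯ ∘ a^{σr}(𝐳_{σr})_{m_{σr}} applied to v -/
def compSeq {r : ℕ} (a : Fin r → EDist1 K E) (σ : Equiv.Perm (Fin r))
    (m : Fin r → Idx K) (v : E) : E :=
  (List.ofFn fun j : Fin r => σ j).foldr (fun i acc => a i (m i) acc) v

/-- the data (c^α, 𝐡_{ij}^k) is a (multiple) OPE of the homogeneous distributions
a¹(𝐳),…,aʳ(𝐳) of parities ps -/
def IsMultOPE {r : ℕ} (a : Fin r → EDist1 K E) (ps : Fin r → ZMod 2)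
    (rij : Fin r → Fin r → ℕ) (hs : ∀ i j : Fin r, Fin (rij i j) → Idx K)
    (c : ((p : Pairs r) → Fin (rij p.1.1 p.1.2)) → EDistN K E r) : Prop :=
  (∀ i j k, Kbar K (hs i j k)) ∧
  (∀ α v, InLatN K E (evN K E (c α) v)) ∧
  (∀ σ : Equiv.Perm (Fin r), ∀ v m,
    koszulPerm K ps σ • compSeq K E a σ m v =
      ∑ α : (p : Pairs r) → Fin (rij p.1.1 p.1.2),
        permMul K E σ (fun p => -(hs p.1.1 p.1.2 (α p))) (evN K E (c α) v) m)

/-- a¹(𝐳),…,aʳ(𝐳) are multiply local -/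
def MultiplyLocal {r : ℕ} (a : Fin r → EDist1 K E) (ps : Fin r → ZMod 2) : Prop :=
  ∃ (rij : Fin r → Fin r → ℕ) (hs : ∀ i j : Fin r, Fin (rij i j) → Idx K)
    (c : ((p : Pairs r) → Fin (rij p.1.1 p.1.2)) → EDistN K E r),
      IsMultOPE K E a ps rij hs c

/-- a set of homogeneous fields (with parities pF) is multiply local -/
def MultLocalSet (F : Set (EDist1 K E)) (pF : EDist1 K E → ZMod 2) : Prop :=
  ∀ (r : ℕ) (f : Fin r → EDist1 K E), (∀ i, f i ∈ F) →
    MultiplyLocal K E f (fun i => pF (f i))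

/-- a set of homogeneous fields (with parities pF) is uniformly local -/
def UnifLocalSet (F : Set (EDist1 K E)) (pF : EDist1 K E → ZMod 2) (one : E) : Prop :=
  ∃ (rr : EDist1 K E → EDist1 K E → ℕ)
    (hh : ∀ d e : EDist1 K E, Fin (rr d e) → Idx K),
    ∀ (r : ℕ) (f : Fin r → EDist1 K E), (∀ i, f i ∈ F) →
      ∃ c, IsMultOPE K E f (fun i => pF (f i)) (fun i j => rr (f i) (f j))
          (fun i j => hh (f i) (f j)) c ∧
        ∀ α, IsPowN K E (evN K E (c α) one)

/-- a ∈ V is homogeneous of parity p w.r.t. the grading (ev, od) -/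
def memPar {V : Type*} [AddCommGroup V] [Module K V] (ev od : Submodule K V)
    (a : V) (p : ZMod 2) : Prop :=
  (p = 0 ∧ a ∈ ev) ∨ (p = 1 ∧ a ∈ od)

/-- an endomorphism is homogeneous of parity p w.r.t. the grading (ev, od) -/
def EndPar {V : Type*} [AddCommGroup V] [Module K V] (ev od : Submodule K V)
    (f : Module.End K V) (p : ZMod 2) : Prop :=
  if p = 0 then (∀ v ∈ ev, f v ∈ ev) ∧ (∀ v ∈ od, f v ∈ od)
  else (∀ v ∈ ev, f v ∈ od) ∧ (∀ v ∈ od, f v ∈ ev)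

/-- a distribution is homogeneous of parity p -/
def EDistPar {V : Type*} [AddCommGroup V] [Module K V] (ev od : Submodule K V)
    (a : EDist1 K V) (p : ZMod 2) : Prop :=
  ∀ n, EndPar K ev od (a n) p

end OPEA

namespace OPEA

/-- an OPE-algebra -/
structure OPEAlg (K : Type*) [Field K] [CharZero K]
    (V : Type*) [AddCommGroup V] [Module K V] where
  ev : Submodule K V
  od : Submodule K V
  compl : IsCompl ev od
  Y : V →ₗ[K] EDist1 K V
  Y_par : ∀ a p, memPar K ev od a p → ∀ (n : Idx K) b q, memPar K ev od b q →
    memPar K ev od (Y a n b) (p + q)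
  one : V
  one_ev : one ∈ ev
  T : Module.End K V
  Tb : Module.End K V
  T_ev : EndPar K ev od T 0
  Tb_ev : EndPar K ev od Tb 0
  commTTb : T * Tb = Tb * T
  T_one : T one = 0
  Tb_one : Tb one = 0
  wcre : ∀ a, IsPow1 K V (ev1 K V (Y a) one)
  rid : ∀ a, Y a ((-1 : K), (-1 : K)) one = a
  tcov : ∀ a, TransCov K V T Tb (Y a)
  loc : ∀ a b pa pb, memPar K ev od a pa → memPar K ev od b pb →
    IsLocal K V pa pb (Y a) (Y b)

/-- a bounded 𝕂̄-fold algebra -/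
structure BFold (K : Type*) [Field K] [CharZero K]
    (V : Type*) [AddCommGroup V] [Module K V] where
  ev : Submodule K V
  od : Submodule K V
  compl : IsCompl ev od
  Y : V →ₗ[K] EDist1 K V
  Y_par : ∀ a p, memPar K ev od a p → ∀ (n : Idx K) b q, memPar K ev od b q →
    memPar K ev od (Y a n b) (p + q)
  fields : ∀ a, IsFieldD K V (Y a)
  bounded : ∀ a (n : Idx K), ¬ Kbar K n → ∀ b, Y a n b = 0

/-- a bounded 𝕂̄-fold module over a bounded 𝕂̄-fold algebra -/
structure BMod (K : Type*) [Field K] [CharZero K]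
    (V : Type*) [AddCommGroup V] [Module K V] (A : BFold K V)
    (Mo : Type*) [AddCommGroup Mo] [Module K Mo] where
  evM : Submodule K Mo
  odM : Submodule K Mo
  complM : IsCompl evM odM
  YM : V →ₗ[K] EDist1 K Mo
  YM_par : ∀ a p, memPar K A.ev A.od a p → ∀ n : Idx K, EndPar K evM odM (YM a n) p
  fieldsM : ∀ a, IsFieldD K Mo (YM a)
  boundedM : ∀ a (n : Idx K), ¬ Kbar K n → ∀ c, YM a n c = 0

variable (K : Type*) [Field K] [CharZero K]
variable (V : Type*) [AddCommGroup V] [Module K V]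
variable (Mo : Type*) [AddCommGroup Mo] [Module K Mo]

/-- the operator T₁ : a ↦ a_{(−2,−1)}1 of an OPE-algebra -/
def T1 (A : OPEAlg K V) : Module.End K V where
  toFun := fun a => A.Y a ((-2 : K), (-1 : K)) A.one
  map_add' := by
    intro x y
    simp [map_add, Pi.add_apply, LinearMap.add_apply]
  map_smul' := by
    intro c x
    simp [map_smul, Pi.smul_apply, LinearMap.smul_apply]

/-- the operator T̄₁ : a ↦ a_{(−1,−2)}1 of an OPE-algebra -/
def T1b (A : OPEAlg K V) : Module.End K V where
  toFun := fun a => A.Y a ((-1 : K), (-2 : K)) A.one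
  map_add' := by
    intro x y
    simp [map_add, Pi.add_apply, LinearMap.add_apply]
  map_smul' := by
    intro c x
    simp [map_smul, Pi.smul_apply, LinearMap.smul_apply]

/-- skew-symmetry for the pair (T, T̄) -/
def SkewSym (ev od : Submodule K V) (Yf : V → EDist1 K V)
    (T Tb : Module.End K V) : Prop :=
  ∀ a b pa pb, memPar K ev od a pa → memPar K ev od b pb →
    ∀ n : Idx K, Kbar K n →
      (Function.support (fun i : ℕ × ℕ =>
        ((i.1.factorial : K)⁻¹ * (i.2.factorial : K)⁻¹ *
            negOnePow K (n.1 + i.1 - (n.2 + i.2))) •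
          ((T ^ i.1) * (Tb ^ i.2)) (Yf a (n.1 + i.1, n.2 + i.2) b))).Finite ∧
      koszul K pa pb • Yf b n a =
        ∑ᶠ i : ℕ × ℕ, ((i.1.factorial : K)⁻¹ * (i.2.factorial : K)⁻¹ *
            negOnePow K (n.1 + i.1 - (n.2 + i.2))) •
          ((T ^ i.1) * (Tb ^ i.2)) (Yf a (n.1 + i.1, n.2 + i.2) b)

/-- (T, T̄) is a translation endomorphism of the module with state-field map YM -/
def TransEnd (YM : V → EDist1 K Mo) (T Tb : Module.End K V) : Prop :=
  (∀ a (n : Idx K), YM (T a) n = (-n.1) • YM a (n.1 - 1, n.2)) ∧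
  (∀ a (n : Idx K), YM (Tb a) n = (-n.2) • YM a (n.1, n.2 - 1))

/-- the coefficient at (x-index m, w-index k) of a(𝐱+𝐰) applied to the w-distribution bw -/
def lhsXW (YM : V → EDist1 K Mo) (a : V) (bw : Dist1 K Mo) (m k : Idx K) : Mo :=
  ∑ᶠ i : ℕ × ℕ, ((i.1.factorial : K)⁻¹ * (i.2.factorial : K)⁻¹) •
    (((dz K (Module.End K Mo))^[i.1] ((dzb K (Module.End K Mo))^[i.2] (YM a))) m)
      (bw (k.1 + i.1, k.2 + i.2))

/-- a and cM are dual in the direct channel -/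
def DualDirect (Y : V → EDist1 K V) (YM : V → EDist1 K Mo) (a : V) (cM : Mo) : Prop :=
  ∃ (s : ℕ) (d : Fin s → Idx K → Idx K → (V →ₗ[K] Mo)) (hj : Fin s → Idx K),
    (∀ j, Kbar K (hj j)) ∧
    (∀ j b, InLat2 K Mo (fun kw mx => d j kw mx b)) ∧
    (∀ b (m k : Idx K),
      lhsXW K V Mo YM a (fun k' => YM b k' cM) m k =
        ∑ j, xwPow K Mo (-(hj j)) (fun kw mx => d j kw mx b) m k) ∧
    (∀ b (m k : Idx K),
      YM (Y a m b) k cM =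
        ∑ j, wxPow K Mo (-(hj j)) (fun kw mx => d j kw mx b) m k)

/-- a and b are dual in the exchange channel on the module -/
def DualExch (Y : V → EDist1 K V) (YM : V → EDist1 K Mo) (a b : V) : Prop :=
  ∃ (r : ℕ) (hab : Fin r → Idx K), (∀ i, Kbar K (hab i)) ∧
    ∀ cM : Mo, ∃ (s : ℕ) (hac : Fin s → Idx K)
      (q : Fin r → Fin s → Idx K → Idx K → Mo),
      (∀ j, Kbar K (hac j)) ∧
      (∀ i j kw mx, q i j kw mx ≠ 0 → IsNegInt K mx.1 ∧ IsNegInt K mx.2) ∧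
      (∀ i j mx, InLat1 K Mo (fun kw => q i j kw mx)) ∧
      (∀ m k : Idx K,
        lhsXW K V Mo YM a (fun k' => YM b k' cM) m k =
          ∑ j, xwPow K Mo (-(hac j))
            (fun kw mx => ∑ i, q i j kw (mx.1 - (hab i).1, mx.2 - (hab i).2)) m k) ∧
      (∀ m k : Idx K,
        YM (Y a m b) k cM =
          ∑ j, wxPow K Mo (-(hac j))
            (fun kw mx => ∑ i, q i j kw (mx.1 - (hab i).1, mx.2 - (hab i).2)) m k)

/-- the module with state-field map YM is dual -/
def IsDualMod (ev od : Submodule K V) (Y : V → EDist1 K V) (YM : V → EDist1 K Mo) : Prop :=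
  ∃ (rVV : V → V → ℕ) (hVV : ∀ a b : V, Fin (rVV a b) → Idx K)
    (rVM : V → Mo → ℕ) (hVM : ∀ (a : V) (c : Mo), Fin (rVM a c) → Idx K),
    (∀ a b i, Kbar K (hVV a b i)) ∧ (∀ a c j, Kbar K (hVM a c j)) ∧
    ∀ a b pa pb, memPar K ev od a pa → memPar K ev od b pb → ∀ c : Mo,
      ∃ p : Fin (rVV a b) → Fin (rVM a c) → Fin (rVM b c) → Dist2 K Mo,
        (∀ i j k, IsPow2 K Mo (p i j k)) ∧
        (∀ m k : Idx K,
          lhsXW K V Mo YM a (fun k' => YM b k' c) m k =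
            ∑ i, ∑ j, ∑ kk, tripleXW K Mo (-(hVV a b i)) (-(hVM b c kk))
              (-(hVM a c j)) (p i j kk) m k) ∧
        (∀ m k : Idx K,
          YM (Y a m b) k c =
            ∑ i, ∑ j, ∑ kk, tripleWX K Mo (-(hVV a b i)) (-(hVM b c kk))
              (-(hVM a c j)) (p i j kk) m k)

/-- F_Y is multiply local -/
def MultLocalAlg (A : OPEAlg K V) : Prop :=
  ∀ (r : ℕ) (f : Fin r → V) (pf : Fin r → ZMod 2),
    (∀ i, memPar K A.ev A.od (f i) (pf i)) →
      MultiplyLocal K V (fun i => A.Y (f i)) pf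

/-- F_Y is uniformly local -/
def UnifLocalAlg (A : OPEAlg K V) : Prop :=
  ∃ (rr : V → V → ℕ) (hh : ∀ a b : V, Fin (rr a b) → Idx K),
    ∀ (r : ℕ) (f : Fin r → V) (pf : Fin r → ZMod 2),
      (∀ i, memPar K A.ev A.od (f i) (pf i)) →
        ∃ c, IsMultOPE K V (fun i => A.Y (f i)) pf (fun i j => rr (f i) (f j))
            (fun i j => hh (f i) (f j)) c ∧
          ∀ α, IsPowN K V (evN K V (c α) A.one)

end OPEA
namespace OPEA

set_option linter.unusedSectionVars false

section Binomials

variable {K : Type*} [Field K] [CharZero K]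

theorem gchoose_eq (x : K) (k : ℕ) : gchoose K x k = Ring.choose x k := by
  have h : ∀ n : ℕ, (descPochhammer ℤ n).smeval x = ∏ i ∈ Finset.range n, (x - (i : K)) := by
    intro n
    induction n with
    | zero => simp
    | succ n ih =>
      rw [descPochhammer_succ_right, Polynomial.smeval_mul, ih, Finset.prod_range_succ,
        Polynomial.smeval_sub, Polynomial.smeval_X, Polynomial.smeval_natCast]
      simp
  rw [Ring.choose_eq_smul, h, gchoose, smul_eq_mul, div_eq_inv_mul]

theorem gchoose_zero (x : K) : gchoose K x 0 = 1 := by simp [gchoose]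

theorem gchoose_nat (n k : ℕ) : gchoose K (n : K) k = (n.choose k : K) := by
  rw [gchoose_eq, Ring.choose_natCast]

theorem gchoose_add (x y : K) (k : ℕ) :
    gchoose K (x + y) k =
      ∑ p ∈ Finset.HasAntidiagonal.antidiagonal k, gchoose K x p.1 * gchoose K y p.2 := by
  simp only [gchoose_eq]
  exact Ring.add_choose_eq k (Commute.all x y)

theorem gchoose_neg (x : K) (k : ℕ) :
    gchoose K (-x) k = (-1) ^ k * gchoose K (x + k - 1) k := by
  simp only [gchoose_eq]
  rw [Ring.choose_neg, Units.smul_def, zsmul_eq_mul, Int.cast_negOnePow_natCast]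

theorem gchoose_upper_neg (x : K) (k : ℕ) :
    (-1) ^ k * gchoose K x k = gchoose K (k - 1 - x) k := by
  rw [show (k : K) - 1 - x = -(x + 1 - k) by ring, gchoose_neg]
  congr 2
  ring

theorem gchoose_succ_succ (x : K) (k : ℕ) :
    gchoose K (x + 1) (k + 1) = gchoose K x k + gchoose K x (k + 1) := by
  simp only [gchoose_eq]
  exact Ring.choose_succ_succ x k

theorem gchoose_mul_succ (x : K) (k : ℕ) :
    gchoose K x (k + 1) * (k + 1) = (x - k) * gchoose K x k := by
  have h1 : ((k : K) + 1) ≠ 0 := by exact_mod_cast Nat.succ_ne_zero k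
  have h2 : (k.factorial : K) ≠ 0 := by exact_mod_cast k.factorial_ne_zero
  rw [gchoose, gchoose, Finset.prod_range_succ, Nat.factorial_succ]
  push_cast
  field_simp

/-- The trinomial revision identity. -/
theorem gchoose_mul_choose (x : K) (s t : ℕ) :
    gchoose K x (s + t) * ((s + t).choose t : K) = gchoose K x s * gchoose K (x - s) t := by
  have h := Ring.choose_smul_choose x (Nat.le_add_right s t)
  rw [Nat.add_sub_cancel_left, nsmul_eq_mul, Nat.choose_symm_add] at h
  simp only [gchoose_eq]
  rw [← h, mul_comm]

theorem gchoose_nat_of_lt {n k : ℕ} (h : n < k) : gchoose K (n : K) k = 0 := by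
  rw [gchoose_nat, Nat.choose_eq_zero_of_lt h, Nat.cast_zero]

/-- The binomial coefficient `C(x,y)` for arbitrary lower entry, zero unless `y ∈ ℕ`. -/
def gchooseExt (x y : K) : K :=
  if h : ∃ j : ℕ, (j : K) = y then gchoose K x h.choose else 0

theorem gchooseExt_nat (x : K) (k : ℕ) : gchooseExt x (k : K) = gchoose K x k := by
  have h : ∃ j : ℕ, (j : K) = k := ⟨k, rfl⟩
  have h2 : h.choose = k := by exact_mod_cast h.choose_spec
  rw [gchooseExt, dif_pos h, h2]

theorem gchooseExt_of_not (x : K) {y : K} (h : ¬ ∃ j : ℕ, (j : K) = y) :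
    gchooseExt x y = 0 := dif_neg h

theorem gchooseExt_pascal (x y : K) :
    gchooseExt (x + 1) (y + 1) = gchooseExt x y + gchooseExt x (y + 1) := by
  by_cases h : ∃ j : ℕ, (j : K) = y
  · obtain ⟨j, rfl⟩ := h
    have : (j : K) + 1 = ((j + 1 : ℕ) : K) := by push_cast; ring
    rw [this, gchooseExt_nat, gchooseExt_nat, gchooseExt_nat, gchoose_succ_succ]
  · rw [gchooseExt_of_not x h, zero_add]
    by_cases h2 : ∃ j : ℕ, (j : K) = y + 1
    · obtain ⟨j, hj⟩ := h2
      rcases j with _ | j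
      · rw [← hj, gchooseExt_nat, gchooseExt_nat, gchoose_zero, gchoose_zero]
      · exact absurd ⟨j, by push_cast at hj; linear_combination hj⟩ h
    · rw [gchooseExt_of_not _ h2, gchooseExt_of_not _ h2]

end Binomials

section Independence

variable {K : Type*} [Field K] [CharZero K]

open Polynomial in
theorem wronskian_ne (f g : K[X]) (δ : K) (hδ : ¬ IsInt K δ) (hf : f ≠ 0)
    (h : (1 + X) * (f * derivative g - derivative f * g) + C δ * f * g = 0) : g = 0 := by
  by_contra hg
  obtain ⟨f₁, hf₁, hfd⟩ := exists_eq_pow_rootMultiplicity_mul_and_not_dvd f hf (-1)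
  obtain ⟨g₁, hg₁, hgd⟩ := exists_eq_pow_rootMultiplicity_mul_and_not_dvd g hg (-1)
  generalize rootMultiplicity (-1) f = a at hf₁
  generalize rootMultiplicity (-1) g = b at hg₁
  have e : X - C (-1 : K) = 1 + X := by simp [add_comm]
  rw [e] at hf₁ hg₁ hfd hgd
  have key : ∀ (n : ℕ) (q : K[X]),
      (1 + X) * derivative ((1 + X) ^ n * q) =
        (1 + X) ^ n * (C (n : K) * q + (1 + X) * derivative q) := by
    intro n q
    rw [derivative_mul, derivative_pow]
    rcases n with _ | n
    · simp
    · simp [pow_succ]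
      ring
  have h2 : (1 + X) ^ (a + b) * (f₁ * (C (b : K) * g₁ + (1 + X) * derivative g₁)
      - (C (a : K) * f₁ + (1 + X) * derivative f₁) * g₁ + C δ * f₁ * g₁) = 0 := by
    rw [← h]
    have hf2 := key a f₁
    have hg2 := key b g₁
    rw [← hf₁] at hf2
    rw [← hg₁] at hg2
    linear_combination (-f) * hg2 + g * hf2
      - ((1 + X) ^ b * (C (b : K) * g₁ + (1 + X) * derivative g₁)) * hf₁
      + ((1 + X) ^ a * (C (a : K) * f₁ + (1 + X) * derivative f₁)) * hg₁
      - C δ * f * hg₁ - C δ * (1 + X) ^ b * g₁ * hf₁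
  have hx : (1 + X : K[X]) ≠ 0 := by rw [← e]; exact X_sub_C_ne_zero _
  have h3 := (mul_eq_zero.mp h2).resolve_left (pow_ne_zero _ hx)
  have h4 := congrArg (eval (-1)) h3
  have hfe : eval (-1) f₁ ≠ 0 := fun h0 => hfd (by rw [← e]; exact dvd_iff_isRoot.mpr h0)
  have hge : eval (-1) g₁ ≠ 0 := fun h0 => hgd (by rw [← e]; exact dvd_iff_isRoot.mpr h0)
  simp at h4
  have h5 : (eval (-1) f₁ * eval (-1) g₁) * (δ - (a - b)) = 0 := by linear_combination h4
  have h6 := (mul_eq_zero.mp h5).resolve_left (mul_ne_zero hfe hge)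
  exact hδ ⟨(a : ℤ) - b, by push_cast; linear_combination -h6⟩

open PowerSeries in
theorem binomialSeries_derivative (h : K) :
    (1 + X : K⟦X⟧) * d⁄dX K (binomialSeries K h) = h • binomialSeries K h := by
  ext n
  rw [add_mul, one_mul, map_add, coeff_derivative, binomialSeries_coeff, coeff_smul,
    binomialSeries_coeff]
  simp only [smul_eq_mul, mul_one, ← gchoose_eq]
  rcases n with _ | n
  · rw [coeff_zero_X_mul]
    have := gchoose_mul_succ h 0
    push_cast at this ⊢
    linear_combination this
  · rw [coeff_succ_X_mul, coeff_derivative, binomialSeries_coeff]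
    simp only [smul_eq_mul, mul_one, ← gchoose_eq]
    have := gchoose_mul_succ h (n + 1)
    push_cast at this ⊢
    linear_combination this

/-- Binomial series with exponents in distinct classes modulo `ℤ` are linearly independent over
the polynomial ring. -/
theorem binomialSeries_independent (s : Finset K) :
    ∀ (_ : ∀ a ∈ s, ∀ b ∈ s, IsInt K (a - b) → a = b) (P : K → Polynomial K)
      (_ : ∑ a ∈ s, PowerSeries.binomialSeries K (-a) * (P a : PowerSeries K) = 0),
      ∀ a ∈ s, P a = 0 := by
  induction s using Finset.induction_on with
  | empty => simp
  | insert a₀ s ha₀ ih =>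
    intro hs P hP
    have hs' : ∀ a ∈ s, ∀ b ∈ s, IsInt K (a - b) → a = b := fun a ha b hb =>
      hs a (Finset.mem_insert_of_mem ha) b (Finset.mem_insert_of_mem hb)
    have hz : P a₀ = 0 := by
      by_contra h0
      have hd := congrArg (PowerSeries.derivative K) hP
      rw [map_sum, map_zero] at hd
      simp only [Derivation.leibniz, smul_eq_mul, PowerSeries.derivative_coe] at hd
      have h2 : ∑ a ∈ insert a₀ s, PowerSeries.binomialSeries K (-a) *
          (((1 + Polynomial.X) * (P a₀ * Polynomial.derivative (P a)
            - Polynomial.derivative (P a₀) * P a)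
            + Polynomial.C (a₀ - a) * P a₀ * P a : Polynomial K) : PowerSeries K) = 0 := by
        have e : ∀ a : K, PowerSeries.binomialSeries K (-a) *
          (((1 + Polynomial.X) * (P a₀ * Polynomial.derivative (P a)
            - Polynomial.derivative (P a₀) * P a)
            + Polynomial.C (a₀ - a) * P a₀ * P a : Polynomial K) : PowerSeries K) =
          (1 + PowerSeries.X) * (P a₀ : PowerSeries K) *
            (PowerSeries.binomialSeries K (-a) * (Polynomial.derivative (P a) : PowerSeries K)
              + (P a : PowerSeries K) *
                PowerSeries.derivative K (PowerSeries.binomialSeries K (-a)))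
          + (PowerSeries.C a₀ * (P a₀ : PowerSeries K)
              - (1 + PowerSeries.X) * (Polynomial.derivative (P a₀) : PowerSeries K)) *
            (PowerSeries.binomialSeries K (-a) * (P a : PowerSeries K)) := by
          intro a
          have hb := binomialSeries_derivative (-a)
          rw [PowerSeries.smul_eq_C_mul] at hb
          push_cast
          simp only [map_neg, map_sub] at hb ⊢
          linear_combination (-(P a₀ : PowerSeries K) * (P a : PowerSeries K)) * hb
        rw [Finset.sum_congr rfl fun a _ => e a, Finset.sum_add_distrib, ← Finset.mul_sum,
          ← Finset.mul_sum, hP, hd, mul_zero, mul_zero, add_zero]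
      rw [Finset.sum_insert ha₀] at h2
      have h3 : (((1 + Polynomial.X) * (P a₀ * Polynomial.derivative (P a₀)
            - Polynomial.derivative (P a₀) * P a₀)
            + Polynomial.C (a₀ - a₀) * P a₀ * P a₀ : Polynomial K)) = 0 := by
        rw [sub_self, map_zero]
        ring
      rw [h3, Polynomial.coe_zero, mul_zero, zero_add] at h2
      have h4 := ih hs' _ h2
      have h5 : ∀ a ∈ s, P a = 0 := fun a ha =>
        wronskian_ne (P a₀) (P a) (a₀ - a) (fun hi => ha₀ (by
          rw [hs a₀ (Finset.mem_insert_self _ _) a (Finset.mem_insert_of_mem ha) hi]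
          exact ha)) h0 (h4 a ha)
      rw [Finset.sum_insert ha₀, Finset.sum_eq_zero (fun a ha => by
        rw [h5 a ha, Polynomial.coe_zero, mul_zero]), add_zero] at hP
      rcases mul_eq_zero.mp hP with h | h
      · have := congrArg PowerSeries.constantCoeff h
        simp at this
      · exact h0 (by exact_mod_cast h)
    rw [Finset.sum_insert ha₀, hz, Polynomial.coe_zero, mul_zero, zero_add] at hP
    intro a ha
    rcases Finset.mem_insert.mp ha with rfl | ha
    · exact hz
    · exact ih hs' P hP a ha

end Independence

section InductionOneVariable

variable {K : Type*} [Field K] [CharZero K]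

/-- The functional `X ^ r ↦ (-1) ^ r C(-1-d+H-r, H-1-n)`. -/
def binomialFunctional (d n H : K) : Polynomial K →ₗ[K] K :=
  Polynomial.lsum fun r =>
    ((-1) ^ r * gchooseExt (-1 - d + H - r) (H - 1 - n)) • (LinearMap.id : K →ₗ[K] K)

theorem binomialFunctional_monomial (d n H : K) (r : ℕ) (x : K) :
    binomialFunctional d n H (Polynomial.monomial r x) =
      (-1) ^ r * gchooseExt (-1 - d + H - r) (H - 1 - n) * x := by
  rw [binomialFunctional, Polynomial.lsum_apply, Polynomial.sum_monomial_index _ _ (by simp)]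
  simp

theorem binomialFunctional_mul_one_add_X (d n H : K) (q : Polynomial K) :
    binomialFunctional d n (H + 1) ((1 + Polynomial.X) * q) = binomialFunctional d n H q := by
  induction q using Polynomial.induction_on' with
  | add p q hp hq => rw [mul_add, map_add, map_add, hp, hq]
  | monomial r x =>
    have h := gchooseExt_pascal (-1 - d + H - r) (H - 1 - n)
    rw [add_mul, one_mul, Polynomial.X_mul_monomial, map_add, binomialFunctional_monomial,
      binomialFunctional_monomial, binomialFunctional_monomial]
    have e1 : -1 - d + (H + 1) - (r : K) = -1 - d + H - r + 1 := by ring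
    have e2 : H + 1 - 1 - n = H - 1 - n + 1 := by ring
    have e3 : -1 - d + (H + 1) - ((r + 1 : ℕ) : K) = -1 - d + H - r := by push_cast; ring
    rw [e1, e2, e3, pow_succ]
    linear_combination ((-1) ^ r * x) * h

theorem binomialFunctional_mul_pow (d n H : K) (D : ℕ) (q : Polynomial K) :
    binomialFunctional d n (H + D) ((1 + Polynomial.X) ^ D * q) = binomialFunctional d n H q := by
  induction D with
  | zero => simp
  | succ D ih =>
    rw [← ih, ← binomialFunctional_mul_one_add_X d n (H + D), pow_succ']
    push_cast
    rw [mul_assoc, add_assoc]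

theorem exists_common_shift {ι : Type*} [Fintype ι] (h : ι → K) :
    ∃ D : ι → ℕ, ∀ i j, IsInt K ((h i + D i) - (h j + D j)) → h i + D i = h j + D j := by
  let S := AddSubgroup.zmultiples (1 : K)
  let rep : ι → K := fun i => Quotient.out (QuotientAddGroup.mk (s := S) (h i))
  have hmem : ∀ x y : K, (QuotientAddGroup.mk (s := S) x = QuotientAddGroup.mk (s := S) y)
      ↔ ∃ z : ℤ, (z : K) = -x + y := by
    intro x y
    rw [QuotientAddGroup.eq, AddSubgroup.mem_zmultiples_iff]
    simp
  have hr : ∀ i, ∃ z : ℤ, (z : K) = h i - rep i := by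
    intro i
    have h1 : QuotientAddGroup.mk (s := S) (rep i) = QuotientAddGroup.mk (s := S) (h i) :=
      Quotient.out_eq _
    obtain ⟨z, hz⟩ := (hmem _ _).mp h1
    exact ⟨z, by rw [hz]; ring⟩
  choose z hz using hr
  refine ⟨fun i => (∑ j, |z j| - z i).toNat, ?_⟩
  have hD : ∀ i, h i + ((∑ j, |z j| - z i).toNat : K) = rep i + (∑ j, |z j| : ℤ) := by
    intro i
    have h1 : 0 ≤ ∑ j, |z j| - z i := by
      have := Finset.single_le_sum (f := fun j => |z j|) (fun j _ => abs_nonneg _)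
        (Finset.mem_univ i)
      have := le_abs_self (z i)
      linarith
    have h2 : ((∑ j, |z j| - z i).toNat : K) = (((∑ j, |z j| - z i).toNat : ℤ) : K) := by
      push_cast; rfl
    rw [h2, Int.toNat_of_nonneg h1, Int.cast_sub, hz]
    ring
  intro i j hij
  rw [hD, hD] at *
  have : rep i = rep j := by
    obtain ⟨w, hw⟩ := hij
    have h3 : QuotientAddGroup.mk (s := S) (h i) = QuotientAddGroup.mk (s := S) (h j) := by
      rw [hmem]
      refine ⟨z j - z i - w, ?_⟩
      push_cast
      rw [hz, hz, hw]
      ring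
    simp only [rep, h3]
  rw [this]

theorem sum_binomialFunctional_eq_zero {ι : Type*} [Fintype ι] (h : ι → K)
    (q : ι → Polynomial K)
    (hq : ∑ i, PowerSeries.binomialSeries K (-(h i)) * (q i : PowerSeries K) = 0) (d n : K) :
    ∑ i, binomialFunctional d n (h i) (q i) = 0 := by
  obtain ⟨D, hD⟩ := exists_common_shift h
  let P : K → Polynomial K := fun a =>
    ∑ i ∈ Finset.univ.filter fun i => h i + D i = a, (1 + Polynomial.X) ^ D i * q i
  have h1 : ∑ a ∈ Finset.univ.image (fun i => h i + D i),
      PowerSeries.binomialSeries K (-a) * (P a : PowerSeries K) = 0 := by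
    rw [← hq, ← Finset.sum_fiberwise_of_maps_to (s := Finset.univ)
      (t := Finset.univ.image (fun i => h i + D i)) (g := fun i => h i + D i)
      (fun i _ => Finset.mem_image_of_mem _ (Finset.mem_univ i))]
    refine Finset.sum_congr rfl fun a _ => ?_
    rw [← Polynomial.coeToPowerSeries.ringHom_apply, map_sum, Finset.mul_sum]
    refine Finset.sum_congr rfl fun i hi => ?_
    have hi' := (Finset.mem_filter.mp hi).2
    have e : -(h i) = -a + D i := by rw [← hi']; ring
    rw [e, PowerSeries.binomialSeries_add, PowerSeries.binomialSeries_nat,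
      Polynomial.coeToPowerSeries.ringHom_apply]
    push_cast
    ring
  have h2 := binomialSeries_independent _ (by
    intro a ha b hb hab
    obtain ⟨i, -, rfl⟩ := Finset.mem_image.mp ha
    obtain ⟨j, -, rfl⟩ := Finset.mem_image.mp hb
    exact hD i j hab) P h1
  rw [← Finset.sum_fiberwise_of_maps_to (s := Finset.univ)
      (t := Finset.univ.image (fun i => h i + D i)) (g := fun i => h i + D i)
      (fun i _ => Finset.mem_image_of_mem _ (Finset.mem_univ i))]
  refine Finset.sum_eq_zero fun a ha => ?_
  have h3 := congrArg (binomialFunctional d n a) (h2 a ha)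
  rw [map_zero, map_sum] at h3
  rw [← h3]
  refine Finset.sum_congr rfl fun i hi => ?_
  rw [← (Finset.mem_filter.mp hi).2, binomialFunctional_mul_pow]

theorem residue_sum_eq_zero_of_class {ι : Type*} [Fintype ι] (h : ι → K) (f : ι → K → K)
    (N : ℕ) (d : K) (hf : ∀ i u, f i u ≠ 0 → ∃ r : ℕ, r < N ∧ u = d - h i + r)
    (H : ∀ M : K, ∑ i, ∑ᶠ j : ℕ, ((-1) ^ j * gchoose K (-(h i)) j) * f i (M - h i - j) = 0)
    (n : K) : ∑ i, ∑ᶠ u, gchooseExt (-1 - u) (h i - 1 - n) * f i u = 0 := by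
  let q : ι → Polynomial K := fun i =>
    ∑ r ∈ Finset.range N, Polynomial.monomial r ((-1) ^ r * f i (d - h i + r))
  have hcoeff : ∀ i r, (q i).coeff r = (-1) ^ r * f i (d - h i + r) := by
    intro i r
    simp only [q, Polynomial.finsetSum_coeff, Polynomial.coeff_monomial]
    rw [Finset.sum_ite_eq']
    split_ifs with hr
    · rfl
    · by_contra hne
      have h0 : f i (d - h i + r) ≠ 0 := fun h0 => hne (by rw [h0, mul_zero])
      obtain ⟨r', hr', e⟩ := hf _ _ h0
      have : r = r' := by exact_mod_cast add_left_cancel e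
      rw [this] at hr
      exact hr (Finset.mem_range.mpr hr')
  have hz : ∑ i, PowerSeries.binomialSeries K (-(h i)) * (q i : PowerSeries K) = 0 := by
    ext M
    rw [map_sum, map_zero]
    have hM := H (d + M)
    have : (-1 : K) ^ M * (-1) ^ M = 1 := by rw [← mul_pow]; simp
    rw [← mul_zero ((-1 : K) ^ M), ← hM, Finset.mul_sum]
    refine Finset.sum_congr rfl fun i _ => ?_
    rw [PowerSeries.coeff_mul, Finset.Nat.sum_antidiagonal_eq_sum_range_succ_mk]
    rw [finsum_eq_sum_of_support_subset (s := Finset.range (M + 1)), Finset.mul_sum]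
    · refine Finset.sum_congr rfl fun j hj => ?_
      have hj' : j ≤ M := Nat.lt_succ_iff.mp (Finset.mem_range.mp hj)
      rw [Polynomial.coeff_coe, hcoeff, PowerSeries.binomialSeries_coeff, ← gchoose_eq]
      have e : d - h i + ((M - j : ℕ) : K) = d + M - h i - j := by
        push_cast [hj']; ring
      have e2 : (-1 : K) ^ M = (-1) ^ (M - j) * (-1) ^ j := by
        rw [← pow_add, Nat.sub_add_cancel hj']
      have e3 : (-1 : K) ^ j * (-1) ^ j = 1 := by rw [← mul_pow]; simp
      rw [e, e2]
      simp only [smul_eq_mul, mul_one]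
      linear_combination (-gchoose K (-(h i)) j * (-1) ^ (M - j) * f i (d + M - h i - j)) * e3
    · intro j hj
      have h0 : f i (d + M - h i - j) ≠ 0 := fun h0 => hj (by simp only [h0, mul_zero])
      obtain ⟨r, -, e⟩ := hf _ _ h0
      have : (M : K) = ((r + j : ℕ) : K) := by push_cast; linear_combination e
      have : M = r + j := by exact_mod_cast this
      simp; omega
  rw [← sum_binomialFunctional_eq_zero h q hz d n]
  refine Finset.sum_congr rfl fun i _ => ?_
  rw [map_sum]
  simp only [binomialFunctional_monomial]
  have hinj : Set.InjOn (fun r : ℕ => d - h i + (r : K)) (Finset.range N) := by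
    intro r _ r' _ e
    exact_mod_cast add_left_cancel e
  rw [finsum_eq_sum_of_support_subset (s := (Finset.range N).image fun r : ℕ => d - h i + (r : K)),
    Finset.sum_image hinj]
  · refine Finset.sum_congr rfl fun r _ => ?_
    have e : -1 - (d - h i + (r : K)) = -1 - d + h i - r := by ring
    have e3 : (-1 : K) ^ r * (-1) ^ r = 1 := by rw [← mul_pow]; simp
    rw [e]
    linear_combination (-gchooseExt (-1 - d + h i - r) (h i - 1 - n) * f i (d - h i + r)) * e3
  · intro u hu
    have h0 : f i u ≠ 0 := fun h0 => hu (by simp only [h0, mul_zero])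
    obtain ⟨r, hr, e⟩ := hf _ _ h0
    simp only [Finset.coe_image, Finset.coe_range]
    exact ⟨r, hr, e.symm⟩

theorem exists_nat_shift (s : Finset K) (d : K) (hs : ∀ u ∈ s, IsInt K (u - d)) :
    ∃ (e : K) (N : ℕ), IsInt K (e - d) ∧ ∀ u ∈ s, ∃ r : ℕ, r < N ∧ u = e + r := by
  have : ∀ u : K, ∃ z : ℤ, u ∈ s → (z : K) = u - d := by
    intro u
    by_cases hu : u ∈ s
    · obtain ⟨z, hz⟩ := hs u hu
      exact ⟨z, fun _ => hz⟩
    · exact ⟨0, fun h => absurd h hu⟩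
  choose z hz using this
  let L : ℤ := ∑ u ∈ s, |z u|
  have hL : ∀ u ∈ s, |z u| ≤ L := fun u hu =>
    Finset.single_le_sum (f := fun j => |z j|) (fun j _ => abs_nonneg _) hu
  refine ⟨d - L, (2 * L + 1).toNat, ⟨-L, by push_cast; ring⟩, fun u hu => ?_⟩
  have h1 := abs_le.mp (hL u hu)
  refine ⟨(z u + L).toNat, by omega, ?_⟩
  have h2 : ((z u + L).toNat : K) = (((z u + L).toNat : ℤ) : K) := by push_cast; rfl
  rw [h2, Int.toNat_of_nonneg (by omega), Int.cast_add, hz u hu]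
  ring

theorem residue_sum_eq_zero_field {ι : Type*} [Fintype ι] (h : ι → K) (f : ι → K → K)
    (hf : ∀ i, (Function.support (f i)).Finite)
    (H : ∀ M : K, ∑ i, ∑ᶠ j : ℕ, ((-1) ^ j * gchoose K (-(h i)) j) * f i (M - h i - j) = 0)
    (n : K) : ∑ i, ∑ᶠ u, gchooseExt (-1 - u) (h i - 1 - n) * f i u = 0 := by
  let S := AddSubgroup.zmultiples (1 : K)
  let cl : K → K ⧸ S := QuotientAddGroup.mk (s := S)
  have hmem : ∀ x y : K, cl x = cl y ↔ IsInt K (y - x) := by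
    intro x y
    rw [QuotientAddGroup.eq, AddSubgroup.mem_zmultiples_iff]
    simp [IsInt, neg_add_eq_sub]
  let f' : K ⧸ S → ι → K → K := fun κ i u => if cl (u + h i) = κ then f i u else 0
  let C : Finset (K ⧸ S) := Finset.univ.biUnion fun i => (hf i).toFinset.image fun u => cl (u + h i)
  have hf' : ∀ κ i u, f' κ i u ≠ 0 → f i u ≠ 0 ∧ cl (u + h i) = κ := by
    intro κ i u hne
    simp only [f'] at hne
    split_ifs at hne with hc
    · exact ⟨hne, hc⟩
    · exact absurd rfl hne
  have hdec : ∀ i u, f i u = ∑ κ ∈ C, f' κ i u := by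
    intro i u
    simp only [f']
    rw [Finset.sum_ite_eq]
    split_ifs with hc
    · rfl
    · by_contra hne
      refine hc (Finset.mem_biUnion.mpr ⟨i, Finset.mem_univ i, Finset.mem_image.mpr ⟨u, ?_, rfl⟩⟩)
      simpa using hne
  have hcl : ∀ κ, ∑ i, ∑ᶠ u, gchooseExt (-1 - u) (h i - 1 - n) * f' κ i u = 0 := by
    intro κ
    obtain ⟨d, hd⟩ := QuotientAddGroup.mk_surjective (s := S) κ
    let s : Finset K := Finset.univ.biUnion fun i =>
      ((hf i).toFinset.filter fun u => cl (u + h i) = κ).image fun u => u + h i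
    obtain ⟨e, N, hed, hs⟩ := exists_nat_shift s d (by
      intro u hu
      simp only [s, Finset.mem_biUnion, Finset.mem_image, Finset.mem_filter] at hu
      obtain ⟨i, -, u, ⟨-, hu⟩, rfl⟩ := hu
      rw [← hmem, hu]
      exact hd)
    have hce : cl e = κ := by rw [← hd]; exact ((hmem _ _).mpr hed).symm
    refine residue_sum_eq_zero_of_class h (f' κ) N e ?_ ?_ n
    · intro i u hne
      obtain ⟨h1, h2⟩ := hf' _ _ _ hne
      obtain ⟨r, hr, hu⟩ := hs (u + h i) (by
        simp only [s, Finset.mem_biUnion, Finset.mem_image, Finset.mem_filter]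
        exact ⟨i, Finset.mem_univ i, u, ⟨by simpa using h1, h2⟩, rfl⟩)
      exact ⟨r, hr, by linear_combination hu⟩
    · intro M
      have hc : ∀ i (j : ℕ), cl (M - h i - j + h i) = cl M := by
        intro i j
        rw [hmem]
        exact ⟨j, by push_cast; ring⟩
      by_cases hM : cl M = κ
      · rw [← H M]
        refine Finset.sum_congr rfl fun i _ => finsum_congr fun j => ?_
        simp only [f']
        rw [if_pos ((hc i j).trans hM)]
      · refine Finset.sum_eq_zero fun i _ => finsum_eq_zero_of_forall_eq_zero fun j => ?_
        simp only [f']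
        rw [if_neg fun h' => hM ((hc i j).symm.trans h'), mul_zero]
  have : ∀ i, ∑ᶠ u, gchooseExt (-1 - u) (h i - 1 - n) * f i u =
      ∑ κ ∈ C, ∑ᶠ u, gchooseExt (-1 - u) (h i - 1 - n) * f' κ i u := by
    intro i
    rw [← finsum_sum_comm]
    · refine finsum_congr fun u => ?_
      rw [hdec i u, Finset.mul_sum]
    · intro κ _
      refine (hf i).subset fun u hu => (hf' κ i u ?_).1
      exact fun h0 => hu (by simp only [h0, mul_zero])
  simp only [this]
  rw [Finset.sum_comm]
  exact Finset.sum_eq_zero fun κ _ => hcl κ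

theorem residue_sum_eq_zero {V : Type*} [AddCommGroup V] [Module K V]
    {ι : Type*} [Fintype ι] (h : ι → K) (f : ι → K → V)
    (hf : ∀ i, (Function.support (f i)).Finite)
    (H : ∀ M : K, ∑ i, ∑ᶠ j : ℕ, ((-1) ^ j * gchoose K (-(h i)) j) • f i (M - h i - j) = 0)
    (n : K) : ∑ i, ∑ᶠ u, gchooseExt (-1 - u) (h i - 1 - n) • f i u = 0 := by
  rw [← Module.forall_dual_apply_eq_zero_iff K]
  intro φ
  have hfφ : ∀ i, (Function.support fun u => φ (f i u)).Finite := fun i =>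
    (hf i).subset fun u hu h0 => hu (by simp only [h0, map_zero])
  have key := residue_sum_eq_zero_field h (fun i u => φ (f i u)) hfφ (by
    intro M
    have h1 := congrArg φ (H M)
    rw [map_zero, map_sum] at h1
    rw [← h1]
    refine Finset.sum_congr rfl fun i _ => ?_
    have hfin : (Function.support fun j : ℕ =>
        ((-1) ^ j * gchoose K (-(h i)) j) • f i (M - h i - j)).Finite := by
      refine Set.Finite.subset (Set.Finite.preimage (f := fun j : ℕ => M - h i - (j : K)) ?_ (hf i))
        fun j hj h0 => hj (by simp only [h0, smul_zero])
      intro a _ b _ hab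
      exact_mod_cast (sub_right_injective hab : (a : K) = b)
    rw [← LinearMap.toAddMonoidHom_coe, AddMonoidHom.map_finsum _ hfin]
    refine finsum_congr fun j => ?_
    simp) n
  rw [map_sum, ← key]
  refine Finset.sum_congr rfl fun i _ => ?_
  rw [← LinearMap.toAddMonoidHom_coe, AddMonoidHom.map_finsum]
  · refine finsum_congr fun j => ?_
    simp
  · exact (hf i).subset fun u hu h0 => hu (by simp only [h0, smul_zero])

end InductionOneVariable

section Pairs

variable {K : Type*} [Field K] [CharZero K]

/-- The product of the binomial coefficients of the two components. -/
def pchoose (x : Idx K) (j : ℕ × ℕ) : K := gchoose K x.1 j.1 * gchoose K x.2 j.2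

/-- The sign `(-1)^(j + j̄)`. -/
def psign (K : Type*) [Field K] (j : ℕ × ℕ) : K := (-1) ^ (j.1 + j.2)

/-- The embedding `ℕ² → K²`. -/
def pcast (K : Type*) [Field K] (j : ℕ × ℕ) : Idx K := ((j.1 : K), (j.2 : K))

/-- Both components are negative integers. -/
def PNeg (n : Idx K) : Prop := IsNegInt K n.1 ∧ IsNegInt K n.2

/-- The antidiagonal of `s` in `ℕ²`. -/
def panti (s : ℕ × ℕ) : Finset ((ℕ × ℕ) × (ℕ × ℕ)) :=
  (Finset.HasAntidiagonal.antidiagonal s.1 ×ˢ Finset.HasAntidiagonal.antidiagonal s.2).map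
    (Equiv.prodProdProdComm ℕ ℕ ℕ ℕ).toEmbedding

theorem mem_panti {s : ℕ × ℕ} {p : (ℕ × ℕ) × (ℕ × ℕ)} : p ∈ panti s ↔ p.1 + p.2 = s := by
  obtain ⟨⟨a, b⟩, c, d⟩ := p
  obtain ⟨s, t⟩ := s
  simp only [panti, Finset.mem_map, Finset.mem_product]
  constructor
  · rintro ⟨⟨⟨a', c'⟩, b', d'⟩, ⟨h1, h2⟩, h3⟩
    simp at h3 h1 h2
    simp; omega
  · intro h
    simp at h
    exact ⟨((a, c), (b, d)), by simpa using h, rfl⟩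

theorem pchoose_add (x y : Idx K) (s : ℕ × ℕ) :
    pchoose (x + y) s = ∑ p ∈ panti s, pchoose x p.1 * pchoose y p.2 := by
  rw [panti, Finset.sum_map, Finset.sum_product, pchoose, Prod.fst_add, Prod.snd_add,
    gchoose_add, gchoose_add, Finset.sum_mul_sum]
  refine Finset.sum_congr rfl fun p _ => Finset.sum_congr rfl fun q _ => ?_
  simp [pchoose]
  ring

theorem pchoose_zero (x : Idx K) : pchoose x 0 = 1 := by simp [pchoose, gchoose_zero]

theorem pchoose_pcast (a b : ℕ × ℕ) :
    pchoose (pcast K a) b = ((a.1.choose b.1 : K)) * (a.2.choose b.2 : K) := by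
  simp [pchoose, pcast, gchoose_nat]

theorem pchoose_pcast_of_not_le {a b : ℕ × ℕ} (h : ¬ b ≤ a) : pchoose (pcast K a) b = 0 := by
  rw [pchoose_pcast]
  rw [Prod.le_def, not_and_or, not_le, not_le] at h
  rcases h with h | h
  · rw [Nat.choose_eq_zero_of_lt h]; simp
  · rw [Nat.choose_eq_zero_of_lt h]; simp

theorem pchoose_pcast_self (a : ℕ × ℕ) : pchoose (pcast K a) a = 1 := by
  rw [pchoose_pcast]; simp

theorem psign_add (a b : ℕ × ℕ) : psign K (a + b) = psign K a * psign K b := by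
  simp only [psign, Prod.fst_add, Prod.snd_add, ← pow_add]
  congr 1; omega

theorem psign_mul_self (a : ℕ × ℕ) : psign K a * psign K a = 1 := by
  rw [psign, ← mul_pow]; simp

theorem psign_zero : psign K 0 = 1 := by simp [psign]

theorem pcast_add (a b : ℕ × ℕ) : pcast K (a + b) = pcast K a + pcast K b := by
  simp [pcast]

theorem pcast_zero : pcast K 0 = 0 := by simp [pcast]

theorem pcast_injective : Function.Injective (pcast K) := by
  rintro ⟨a, b⟩ ⟨c, d⟩ h
  simp only [pcast, Prod.mk.injEq, Nat.cast_inj] at h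
  exact Prod.ext h.1 h.2

theorem pchoose_upper_neg (x : Idx K) (j : ℕ × ℕ) :
    psign K j * pchoose x j = pchoose (pcast K j - 1 - x) j := by
  have h1 := gchoose_upper_neg x.1 j.1
  have h2 := gchoose_upper_neg x.2 j.2
  simp only [pchoose, psign, pcast, Prod.fst_sub, Prod.snd_sub, Prod.fst_one, Prod.snd_one,
    ← h1, ← h2, pow_add]
  ring

theorem pchoose_mul_pchoose (x : Idx K) (s t : ℕ × ℕ) :
    pchoose x (s + t) * pchoose (pcast K (s + t)) t = pchoose x s * pchoose (x - pcast K s) t := by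
  have h1 := gchoose_mul_choose x.1 s.1 t.1
  have h2 := gchoose_mul_choose x.2 s.2 t.2
  rw [pchoose_pcast]
  simp only [pchoose, pcast, Prod.fst_sub, Prod.snd_sub, Prod.fst_add, Prod.snd_add]
  linear_combination gchoose K x.2 (s.2 + t.2) * ((s.2 + t.2).choose t.2 : K) * h1 +
    gchoose K x.1 s.1 * gchoose K (x.1 - s.1) t.1 * h2

theorem isNegInt_iff {x : K} : IsNegInt K x ↔ ∃ r : ℕ, x = -1 - r := by
  constructor
  · rintro ⟨k, hk, rfl⟩
    refine ⟨(-1 - k).toNat, ?_⟩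
    have h2 : ((-1 - k).toNat : K) = (((-1 - k).toNat : ℤ) : K) := by push_cast; rfl
    rw [h2, Int.toNat_of_nonneg (by omega)]
    push_cast; ring
  · rintro ⟨r, rfl⟩
    exact ⟨-1 - r, by omega, by push_cast; ring⟩

theorem pneg_iff {x : Idx K} : PNeg x ↔ ∃ r : ℕ × ℕ, x = -1 - pcast K r := by
  rw [PNeg, isNegInt_iff, isNegInt_iff]
  constructor
  · rintro ⟨⟨r, hr⟩, s, hs⟩
    exact ⟨(r, s), Prod.ext (by simpa [pcast] using hr) (by simpa [pcast] using hs)⟩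
  · rintro ⟨r, rfl⟩
    exact ⟨⟨r.1, by simp [pcast]⟩, r.2, by simp [pcast]⟩

theorem finite_pneg_add (x : Idx K) : {j : ℕ × ℕ | PNeg (x + pcast K j)}.Finite := by
  rcases Set.eq_empty_or_nonempty {j : ℕ × ℕ | PNeg (x + pcast K j)} with h | ⟨j₀, hj₀⟩
  · rw [h]; exact Set.finite_empty
  · obtain ⟨r₀, hr₀⟩ := pneg_iff.mp hj₀
    refine (Set.finite_Iic (j₀ + r₀)).subset fun j hj => ?_
    obtain ⟨r, hr⟩ := pneg_iff.mp hj
    have : pcast K (j + r) = pcast K (j₀ + r₀) := by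
      rw [pcast_add, pcast_add]
      linear_combination hr - hr₀
    rw [Set.mem_Iic, ← pcast_injective this]
    exact le_self_add

/-- `n` lies in `S + (ℤ_{<0})²` and `w - n` in `S' + (ℤ_{<0})²` for finitely many `n` only. -/
theorem finite_pneg_sub_sub (a b w : Idx K) :
    {n : Idx K | PNeg (n - a) ∧ PNeg (w - n - b)}.Finite := by
  refine ((finite_pneg_add (w - a - b + 1)).image fun j => a - 1 - pcast K j).subset ?_
  rintro n ⟨h1, h2⟩
  obtain ⟨r, hr⟩ := pneg_iff.mp h1
  have hn : n = a - 1 - pcast K r := by linear_combination hr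
  refine ⟨r, ?_, hn.symm⟩
  rw [hn] at h2
  show PNeg _
  convert h2 using 1
  abel

end Pairs

section Finsum

variable {K : Type*} [Field K] {V : Type*} [AddCommGroup V] [Module K V]

theorem finsum_push {X Y : Type*} (π : X → Y) (w : X → K) (G : Y → V) (fib : Y → Finset X)
    (hfib : ∀ x y, x ∈ fib y ↔ π x = y) (hG : (Function.support G).Finite) :
    (Function.support fun x => w x • G (π x)).Finite ∧
      ∑ᶠ x, w x • G (π x) = ∑ᶠ y, (∑ x ∈ fib y, w x) • G y := by
  have hs : (Function.support fun x => w x • G (π x)) ⊆ hG.toFinset.biUnion fib := by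
    intro x hx
    have h0 : G (π x) ≠ 0 := fun h0 => hx (by simp only [h0, smul_zero])
    simp only [Finset.coe_biUnion, Set.mem_iUnion, Finset.mem_coe]
    exact ⟨π x, by simpa using h0, (hfib _ _).mpr rfl⟩
  refine ⟨(Finset.finite_toSet _).subset hs, ?_⟩
  have hs2 : (Function.support fun y => (∑ x ∈ fib y, w x) • G y) ⊆ hG.toFinset := by
    intro y hy
    have h0 : G y ≠ 0 := fun h0 => hy (by simp only [h0, smul_zero])
    simpa using h0
  rw [finsum_eq_sum_of_support_subset _ hs, finsum_eq_sum_of_support_subset _ hs2,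
    Finset.sum_biUnion]
  · refine Finset.sum_congr rfl fun y _ => ?_
    rw [Finset.sum_smul]
    refine Finset.sum_congr rfl fun x hx => ?_
    rw [(hfib x y).mp hx]
  · intro y _ y' _ hyy'
    refine Finset.disjoint_left.mpr fun x hx hx' => hyy' ?_
    rw [← (hfib x y).mp hx, ← (hfib x y').mp hx']

theorem finsum_prod_eq {α β : Type*} (G : α → β → V)
    (hG : (Function.support fun p : α × β => G p.1 p.2).Finite) :
    ∑ᶠ p : α × β, G p.1 p.2 = ∑ᶠ a, ∑ᶠ b, G a b := by
  rw [finsum_curry _ hG]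

theorem finsum_swap {α β : Type*} (G : α → β → V)
    (hG : (Function.support fun p : α × β => G p.1 p.2).Finite) :
    ∑ᶠ a, ∑ᶠ b, G a b = ∑ᶠ b, ∑ᶠ a, G a b := by
  have hG' : (Function.support fun p : β × α => G p.2 p.1).Finite :=
    (hG.preimage (Prod.swap_injective.injOn)).subset fun p hp => hp
  rw [← finsum_prod_eq G hG, ← finsum_prod_eq (fun b a => G a b) hG',
    ← finsum_comp_equiv (Equiv.prodComm α β)]
  rfl

theorem map_finsum_of_finite {W : Type*} [AddCommGroup W] [Module K W] {α : Type*} (φ : V →ₗ[K] W)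
    {f : α → V} (hf : (Function.support f).Finite) : φ (∑ᶠ a, f a) = ∑ᶠ a, φ (f a) := by
  rw [← LinearMap.toAddMonoidHom_coe, AddMonoidHom.map_finsum _ hf]

end Finsum

section InductionTwoVariables

variable {K : Type*} [Field K] [CharZero K] {V : Type*} [AddCommGroup V] [Module K V]

theorem zwPow_apply (h : Idx K) (c : Dist2 K V) (m k : Idx K) :
    zwPow K V h c m k = ∑ᶠ j : ℕ × ℕ, (psign K j * pchoose h j) •
      c (m + h - pcast K j) (k + pcast K j) := by
  refine finsum_congr fun j => ?_
  rw [pchoose, psign, ← mul_assoc]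
  rfl

theorem d1z_iterate (j : ℕ) (c : Dist2 K V) (n k : Idx K) :
    ((d1z K V)^[j] c) n k =
      ((-1) ^ j * gchoose K n.1 j * j.factorial) • c (n.1 - j, n.2) k := by
  induction j generalizing c n with
  | zero => simp [gchoose_zero]
  | succ j ih =>
    rw [Function.iterate_succ_apply, ih, d1z, smul_smul]
    have h := gchoose_mul_succ n.1 j
    have e : ((n.1 - j - 1, n.2) : Idx K) = (n.1 - ((j + 1 : ℕ) : K), n.2) := by
      push_cast; rw [sub_sub]
    simp only [e]
    congr 1
    rw [Nat.factorial_succ, pow_succ]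
    push_cast
    linear_combination ((-1) ^ j * (j.factorial : K)) * h

theorem d1zb_iterate (j : ℕ) (c : Dist2 K V) (n k : Idx K) :
    ((d1zb K V)^[j] c) n k =
      ((-1) ^ j * gchoose K n.2 j * j.factorial) • c (n.1, n.2 - j) k := by
  induction j generalizing c n with
  | zero => simp [gchoose_zero]
  | succ j ih =>
    rw [Function.iterate_succ_apply, ih, d1zb, smul_smul]
    have h := gchoose_mul_succ n.2 j
    have e : ((n.1, n.2 - j - 1) : Idx K) = (n.1, n.2 - ((j + 1 : ℕ) : K)) := by
      push_cast; rw [sub_sub]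
    simp only [e]
    congr 1
    rw [Nat.factorial_succ, pow_succ]
    push_cast
    linear_combination ((-1) ^ j * (j.factorial : K)) * h

theorem dPow_d1z (x : K) (c : Dist2 K V) (n k : Idx K) :
    dPow K (d1z K V) x c n k = gchooseExt (x - 1 - n.1) x • c (n.1 - x, n.2) k := by
  rw [dPow]
  split_ifs with h
  · have hs := h.choose_spec
    generalize h.choose = j at hs
    subst hs
    rw [gchooseExt_nat, ← gchoose_upper_neg, Pi.smul_apply, Pi.smul_apply, d1z_iterate, smul_smul]
    congr 1
    have h2 : (j.factorial : K) ≠ 0 := by exact_mod_cast j.factorial_ne_zero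
    field_simp
  · rw [gchooseExt_of_not _ h, zero_smul]; rfl

theorem dPow_d1zb (x : K) (c : Dist2 K V) (n k : Idx K) :
    dPow K (d1zb K V) x c n k = gchooseExt (x - 1 - n.2) x • c (n.1, n.2 - x) k := by
  rw [dPow]
  split_ifs with h
  · have hs := h.choose_spec
    generalize h.choose = j at hs
    subst hs
    rw [gchooseExt_nat, ← gchoose_upper_neg, Pi.smul_apply, Pi.smul_apply, d1zb_iterate, smul_smul]
    congr 1
    have h2 : (j.factorial : K) ≠ 0 := by exact_mod_cast j.factorial_ne_zero
    field_simp
  · rw [gchooseExt_of_not _ h, zero_smul]; rfl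

theorem diag_ddPow2 (e : Idx K) (c : Dist2 K V) (m : Idx K) :
    diag K V (ddPow2 K V e c) m = ∑ᶠ v : Idx K,
      (gchooseExt (-1 - v.1) e.1 * gchooseExt (-1 - v.2) e.2) • c v (m - e - 1 - v) := by
  rw [diag, ← finsum_comp_equiv (Equiv.addRight e)]
  refine finsum_congr fun v => ?_
  rw [ddPow2, dPow_d1z, dPow_d1zb, smul_smul]
  simp only [Equiv.coe_addRight, Prod.fst_add, Prod.snd_add]
  congr 1
  · congr 2 <;> ring
  · congr 1
    · exact Prod.ext (by simp) (by simp)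
    · exact Prod.ext (by simp; ring) (by simp; ring)

theorem InLat2.finite_support_line {c : Dist2 K V} (hc : InLat2 K V c) (w : Idx K) :
    (Function.support fun v => c v (w - v)).Finite := by
  obtain ⟨S, hS⟩ := hc
  refine (S.finite_toSet.biUnion fun m _ => finite_pneg_sub_sub m.1 m.2 w).subset fun v hv => ?_
  obtain ⟨m, hm, h⟩ := hS _ _ hv
  simp only [Set.mem_iUnion]
  exact ⟨m, hm, h⟩

/-- Multiplicities of the coefficients of the diagonal restriction are determined by the
expansions of the OPE terms in the domain `z > w`. -/
theorem sum_diag_ddPow2_eq_zero {ι : Type*} [Fintype ι] (h : ι → Idx K) (c : ι → Dist2 K V)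
    (hc : ∀ i, InLat2 K V (c i)) (H : ∀ m k, ∑ i, zwPow K V (-(h i)) (c i) m k = 0)
    (n m : Idx K) :
    ∑ i, diag K V (ddPow2 K V ((h i).1 - 1 - n.1, (h i).2 - 1 - n.2) (c i)) m = 0 := by
  let f : ι → K → K → V := fun i u ub => c i (u, ub) (m + n - h i - (u, ub))
  have hf : ∀ i, (Function.support fun p : K × K => f i p.1 p.2).Finite := fun i =>
    (hc i).finite_support_line (m + n - h i)
  have hdiag : ∀ i, diag K V (ddPow2 K V ((h i).1 - 1 - n.1, (h i).2 - 1 - n.2) (c i)) m =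
      ∑ᶠ p : K × K, (gchooseExt (-1 - p.2) ((h i).2 - 1 - n.2) *
        gchooseExt (-1 - p.1) ((h i).1 - 1 - n.1)) • f i p.1 p.2 := by
    intro i
    rw [diag_ddPow2]
    refine finsum_congr fun v => ?_
    rw [mul_comm]
    congr 2
    exact Prod.ext (by simp; ring) (by simp; ring)
  have hrel : ∀ M Mb : K, ∑ i, ∑ᶠ j : ℕ × ℕ, (((-1) ^ j.1 * gchoose K (-(h i).1) j.1) *
      ((-1) ^ j.2 * gchoose K (-(h i).2) j.2)) •
        f i (M - (h i).1 - j.1) (Mb - (h i).2 - j.2) = 0 := by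
    intro M Mb
    rw [← H (M, Mb) (m + n - (M, Mb))]
    refine Finset.sum_congr rfl fun i _ => ?_
    rw [zwPow_apply]
    refine finsum_congr fun j => ?_
    congr 1
    · simp only [psign, pchoose, Prod.fst_neg, Prod.snd_neg, pow_add]; ring
    · simp only [f]
      congr 1
      · exact Prod.ext (by simp [pcast]; ring) (by simp [pcast]; ring)
      · exact Prod.ext (by simp [pcast]; ring) (by simp [pcast]; ring)
  have hinj : ∀ a : K, Function.Injective fun j : ℕ => a - (j : K) := fun a x y hxy => by
    exact_mod_cast (sub_right_injective hxy : (x : K) = y)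
  -- first the unbarred variable
  have hA : ∀ Mb : K, ∑ i, ∑ᶠ u : K, gchooseExt (-1 - u) ((h i).1 - 1 - n.1) •
      ∑ᶠ j : ℕ, ((-1) ^ j * gchoose K (-(h i).2) j) • f i u (Mb - (h i).2 - j) = 0 := by
    intro Mb
    refine residue_sum_eq_zero (fun i => (h i).1) (fun i u =>
      ∑ᶠ j : ℕ, ((-1) ^ j * gchoose K (-(h i).2) j) • f i u (Mb - (h i).2 - j)) ?_ ?_ n.1
    · intro i
      refine ((hf i).image Prod.fst).subset fun u hu => ?_
      by_contra hne
      refine hu (finsum_eq_zero_of_forall_eq_zero fun j => ?_)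
      have : f i u (Mb - (h i).2 - j) = 0 := by
        by_contra h0
        exact hne ⟨(u, Mb - (h i).2 - j), h0, rfl⟩
      rw [this, smul_zero]
    · intro M
      rw [← hrel M Mb]
      refine Finset.sum_congr rfl fun i _ => ?_
      rw [finsum_prod_eq (fun j jb : ℕ => (((-1) ^ j * gchoose K (-(h i).1) j) *
        ((-1) ^ jb * gchoose K (-(h i).2) jb)) • f i (M - (h i).1 - j) (Mb - (h i).2 - jb))]
      · refine finsum_congr fun j => ?_
        rw [smul_finsum]
        simp only [smul_smul]
      · refine ((hf i).preimage (f := fun p : ℕ × ℕ => (M - (h i).1 - (p.1 : K),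
          Mb - (h i).2 - (p.2 : K))) ?_).subset fun p hp h0 => hp ?_
        · rintro ⟨x, y⟩ _ ⟨x', y'⟩ _ hxy
          rw [Prod.mk.injEq] at hxy
          exact Prod.ext (hinj _ hxy.1) (hinj _ hxy.2)
        · simp only at h0 ⊢
          rw [h0, smul_zero]
  have hB := residue_sum_eq_zero (fun i => (h i).2) (fun i ub =>
    ∑ᶠ u : K, gchooseExt (-1 - u) ((h i).1 - 1 - n.1) • f i u ub) (by
      intro i
      refine ((hf i).image Prod.snd).subset fun u hu => ?_
      by_contra hne
      refine hu (finsum_eq_zero_of_forall_eq_zero fun j => ?_)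
      have : f i j u = 0 := by
        by_contra h0
        exact hne ⟨(j, u), h0, rfl⟩
      rw [this, smul_zero]) (by
    intro Mb
    rw [← hA Mb]
    refine Finset.sum_congr rfl fun i _ => ?_
    simp only [smul_finsum, smul_smul]
    rw [finsum_swap]
    · refine finsum_congr fun u => finsum_congr fun j => ?_
      rw [mul_comm]
    · refine ((hf i).preimage (f := fun p : ℕ × K => (p.2,
        Mb - (h i).2 - (p.1 : K))) ?_).subset fun p hp h0 => hp ?_
      · rintro ⟨x, y⟩ _ ⟨x', y'⟩ _ hxy
        rw [Prod.mk.injEq] at hxy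
        exact Prod.ext (hinj _ hxy.2) hxy.1
      · simp only at h0 ⊢
        rw [h0, smul_zero]) n.2
  rw [← hB]
  refine Finset.sum_congr rfl fun i _ => ?_
  rw [hdiag, finsum_prod_eq (fun u ub => (gchooseExt (-1 - ub) ((h i).2 - 1 - n.2) *
        gchooseExt (-1 - u) ((h i).1 - 1 - n.1)) • f i u ub), finsum_swap]
  · simp only [smul_finsum, smul_smul]
  · exact (hf i).subset fun p hp h0 => hp (by simp only at h0 ⊢; rw [h0, smul_zero])
  · exact (hf i).subset fun p hp h0 => hp (by simp only at h0 ⊢; rw [h0, smul_zero])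

end InductionTwoVariables

section Signs

variable {K : Type*} [Field K] [CharZero K]

/-- The sign `(-1)^(n - n̄)`. -/
def ksign (h : Idx K) : K := negOnePow K (h.1 - h.2)

theorem negOnePow_intCast (z : ℤ) : negOnePow K (z : K) = (-1) ^ z := by
  have h : ∃ k : ℤ, (k : K) = z := ⟨z, rfl⟩
  have h2 : h.choose = z := by exact_mod_cast h.choose_spec
  rw [negOnePow, dif_pos h, h2]

theorem ksign_add {x y : Idx K} (hx : Kbar K x) (hy : Kbar K y) :
    ksign (x + y) = ksign x * ksign y := by
  obtain ⟨a, ha⟩ := hx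
  obtain ⟨b, hb⟩ := hy
  have e : (x + y).1 - (x + y).2 = ((a + b : ℤ) : K) := by
    push_cast; rw [ha, hb]; simp; ring
  rw [ksign, ksign, ksign, e, ← ha, ← hb, negOnePow_intCast, negOnePow_intCast, negOnePow_intCast,
    zpow_add₀ (by simp)]

theorem kbar_add {x y : Idx K} (hx : Kbar K x) (hy : Kbar K y) : Kbar K (x + y) := by
  obtain ⟨a, ha⟩ := hx
  obtain ⟨b, hb⟩ := hy
  exact ⟨a + b, by push_cast; rw [ha, hb]; simp; ring⟩

theorem kbar_neg {x : Idx K} (hx : Kbar K x) : Kbar K (-x) := by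
  obtain ⟨a, ha⟩ := hx
  exact ⟨-a, by push_cast; rw [ha]; simp; ring⟩

theorem kbar_zero : Kbar K (0 : Idx K) := ⟨0, by simp⟩

theorem kbar_pcast (j : ℕ × ℕ) : Kbar K (pcast K j) := ⟨j.1 - j.2, by simp [pcast]⟩

theorem ksign_pcast (j : ℕ × ℕ) : ksign (pcast K j) = psign K j := by
  have e : (pcast K j).1 - (pcast K j).2 = ((j.1 - j.2 : ℤ) : K) := by simp [pcast]
  rw [ksign, e, negOnePow_intCast, zpow_sub₀ (by simp), psign, pow_add, zpow_natCast, zpow_natCast]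
  rcases Nat.even_or_odd j.2 with h | h
  · simp [h.neg_one_pow]
  · simp [h.neg_one_pow, div_neg]

theorem ksign_zero : ksign (0 : Idx K) = 1 := by
  rw [← pcast_zero, ksign_pcast, psign_zero]

theorem ksign_neg {x : Idx K} (hx : Kbar K x) : ksign (-x) * ksign x = 1 := by
  rw [← ksign_add (kbar_neg hx) hx, neg_add_cancel, ksign_zero]

theorem ksign_mul_self {x : Idx K} (hx : Kbar K x) : ksign x * ksign x = 1 := by
  obtain ⟨a, ha⟩ := hx
  rw [ksign, ← ha, negOnePow_intCast, ← mul_zpow]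
  simp

variable {V : Type*} [AddCommGroup V] [Module K V]

theorem zwPowW_apply (h : Idx K) (c : Dist2 K V) (m k : Idx K) :
    zwPowW K V h c m k = ∑ᶠ j : ℕ × ℕ, (ksign h * psign K j * pchoose h j) •
      c (m + pcast K j) (k + h - pcast K j) := by
  refine finsum_congr fun j => ?_
  rw [pchoose, psign, ← mul_assoc, ksign]
  rfl

end Signs

section SmallFamilies

variable {K : Type*} [Field K] [CharZero K] {V : Type*} [AddCommGroup V] [Module K V]

instance : Unique (Pairs 2) where
  default := ⟨(0, 1), by decide⟩
  uniq := by decide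

/-- Dependent case analysis on the pairs in `[3]`. -/
def pairs3Rec {X : Pairs 3 → Sort*} (x01 : X ⟨(0, 1), by decide⟩) (x02 : X ⟨(0, 2), by decide⟩)
    (x12 : X ⟨(1, 2), by decide⟩) : ∀ p, X p
  | ⟨(0, 1), _⟩ => x01
  | ⟨(0, 2), _⟩ => x02
  | ⟨(1, 2), _⟩ => x12
  | ⟨(0, 0), h⟩ => absurd h (by decide)
  | ⟨(1, 0), h⟩ => absurd h (by decide)
  | ⟨(1, 1), h⟩ => absurd h (by decide)
  | ⟨(2, 0), h⟩ => absurd h (by decide)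
  | ⟨(2, 1), h⟩ => absurd h (by decide)
  | ⟨(2, 2), h⟩ => absurd h (by decide)

/-- Families over the pairs in `[3]` as triples. -/
def pairs3Equiv (X : Pairs 3 → Type*) :
    (X ⟨(0, 1), by decide⟩ × X ⟨(0, 2), by decide⟩ × X ⟨(1, 2), by decide⟩) ≃ ∀ p, X p where
  toFun x := pairs3Rec x.1 x.2.1 x.2.2
  invFun α := (α _, α _, α _)
  left_inv _ := rfl
  right_inv _ := funext (pairs3Rec rfl rfl rfl)

theorem prod_pairs3 {M : Type*} [CommMonoid M] (F : Pairs 3 → M) :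
    ∏ p, F p = F ⟨(0, 1), by decide⟩ * F ⟨(0, 2), by decide⟩ * F ⟨(1, 2), by decide⟩ := by
  have : (Finset.univ : Finset (Pairs 3)) =
      {⟨(0, 1), by decide⟩, ⟨(0, 2), by decide⟩, ⟨(1, 2), by decide⟩} := by decide
  rw [this, Finset.prod_insert (by decide), Finset.prod_insert (by decide), Finset.prod_singleton,
    mul_assoc]

theorem sum_pairs3 {M : Type*} [AddCommMonoid M] (F : Pairs 3 → M) :
    ∑ p, F p = F ⟨(0, 1), by decide⟩ + F ⟨(0, 2), by decide⟩ + F ⟨(1, 2), by decide⟩ := by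
  have : (Finset.univ : Finset (Pairs 3)) =
      {⟨(0, 1), by decide⟩, ⟨(0, 2), by decide⟩, ⟨(1, 2), by decide⟩} := by decide
  rw [this, Finset.sum_insert (by decide), Finset.sum_insert (by decide), Finset.sum_singleton,
    add_assoc]

theorem permMul_two_one (hs : Pairs 2 → Idx K) (c : DistN K V 2) (m : Fin 2 → Idx K) :
    permMul K V 1 hs c m = zwPow K V (hs default) (fun n k => c ![n, k]) (m 0) (m 1) := by
  rw [permMul, ← finsum_comp_equiv (Equiv.funUnique (Pairs 2) (ℕ × ℕ)).symm]
  refine finsum_congr fun j => ?_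
  have hf : flipOf (1 : Equiv.Perm (Fin 2)) default = false := by decide
  simp only [Fintype.prod_unique, Fintype.sum_unique, hf]
  congr 1
  · simp [pairCoef, Equiv.funUnique]
  · congr 1
    funext i
    fin_cases i <;> refine Prod.ext ?_ ?_ <;> simp [pairShift, default, Equiv.funUnique] <;> ring

theorem permMul_two_swap (hs : Pairs 2 → Idx K) (c : DistN K V 2) (m : Fin 2 → Idx K) :
    permMul K V (Equiv.swap 0 1) hs c m =
      zwPowW K V (hs default) (fun n k => c ![n, k]) (m 0) (m 1) := by
  rw [permMul, ← finsum_comp_equiv (Equiv.funUnique (Pairs 2) (ℕ × ℕ)).symm]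
  refine finsum_congr fun j => ?_
  have hf : flipOf (Equiv.swap 0 1 : Equiv.Perm (Fin 2)) default = true := by decide
  simp only [Fintype.prod_unique, Fintype.sum_unique, hf]
  congr 1
  congr 1
  funext i
  fin_cases i <;> refine Prod.ext ?_ ?_ <;> simp [pairShift, default, Equiv.funUnique] <;> ring

theorem finsum_eq_of_support_subset_range {α β : Type*} {e : α → β} (he : Function.Injective e)
    {f : β → V} (hf : Function.support f ⊆ Set.range e) : ∑ᶠ b, f b = ∑ᶠ a, f (e a) := by
  rw [← finsum_mem_range he, ← finsum_mem_univ,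
    finsum_mem_inter_support_eq f Set.univ (Set.range e)]
  rw [Set.univ_inter, Set.inter_eq_right.mpr hf]

theorem permMul_three_one (hs : Pairs 3 → Idx K) (c : DistN K V 3) (m : Fin 3 → Idx K) :
    permMul K V 1 hs c m = ∑ᶠ κ : (ℕ × ℕ) × (ℕ × ℕ) × (ℕ × ℕ),
      (psign K κ.1 * pchoose (hs ⟨(0, 1), by decide⟩) κ.1 *
        (psign K κ.2.1 * pchoose (hs ⟨(0, 2), by decide⟩) κ.2.1) *
        (psign K κ.2.2 * pchoose (hs ⟨(1, 2), by decide⟩) κ.2.2)) •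
      c ![m 0 + hs ⟨(0, 1), by decide⟩ - pcast K κ.1 + hs ⟨(0, 2), by decide⟩ - pcast K κ.2.1,
        m 1 + pcast K κ.1 + hs ⟨(1, 2), by decide⟩ - pcast K κ.2.2,
        m 2 + pcast K κ.2.1 + pcast K κ.2.2] := by
  rw [permMul, ← finsum_comp_equiv (pairs3Equiv fun _ => ℕ × ℕ)]
  refine finsum_congr fun κ => ?_
  rw [prod_pairs3]
  simp only [sum_pairs3]
  have hf1 : flipOf (1 : Equiv.Perm (Fin 3)) ⟨(0, 1), by decide⟩ = false := by decide
  have hf2 : flipOf (1 : Equiv.Perm (Fin 3)) ⟨(0, 2), by decide⟩ = false := by decide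
  have hf3 : flipOf (1 : Equiv.Perm (Fin 3)) ⟨(1, 2), by decide⟩ = false := by decide
  rw [hf1, hf2, hf3]
  have e1 : (pairs3Equiv fun _ => ℕ × ℕ) κ ⟨(0, 1), by decide⟩ = κ.1 := rfl
  have e2 : (pairs3Equiv fun _ => ℕ × ℕ) κ ⟨(0, 2), by decide⟩ = κ.2.1 := rfl
  have e3 : (pairs3Equiv fun _ => ℕ × ℕ) κ ⟨(1, 2), by decide⟩ = κ.2.2 := rfl
  rw [e1, e2, e3]
  congr 1
  · simp only [pairCoef, psign, pchoose]
    simp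
    ring
  · congr 1
    funext i
    fin_cases i <;> refine Prod.ext ?_ ?_ <;> simp [pairShift, pcast] <;> ring

theorem permMul_three_rotate (hs : Pairs 3 → Idx K) (c : DistN K V 3) (m : Fin 3 → Idx K) :
    permMul K V (finRotate 3).symm hs c m = ∑ᶠ κ : (ℕ × ℕ) × (ℕ × ℕ) × (ℕ × ℕ),
      (psign K κ.1 * pchoose (hs ⟨(0, 1), by decide⟩) κ.1 *
        (ksign (hs ⟨(0, 2), by decide⟩) * psign K κ.2.1 *
          pchoose (hs ⟨(0, 2), by decide⟩) κ.2.1) *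
        (ksign (hs ⟨(1, 2), by decide⟩) * psign K κ.2.2 *
          pchoose (hs ⟨(1, 2), by decide⟩) κ.2.2)) •
      c ![m 0 + hs ⟨(0, 1), by decide⟩ - pcast K κ.1 + pcast K κ.2.1,
        m 1 + pcast K κ.1 + pcast K κ.2.2,
        m 2 + hs ⟨(0, 2), by decide⟩ - pcast K κ.2.1
          + hs ⟨(1, 2), by decide⟩ - pcast K κ.2.2] := by
  rw [permMul, ← finsum_comp_equiv (pairs3Equiv fun _ => ℕ × ℕ)]
  refine finsum_congr fun κ => ?_
  rw [prod_pairs3]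
  simp only [sum_pairs3]
  have hf1 : flipOf (finRotate 3).symm ⟨(0, 1), by decide⟩ = false := by decide
  have hf2 : flipOf (finRotate 3).symm ⟨(0, 2), by decide⟩ = true := by decide
  have hf3 : flipOf (finRotate 3).symm ⟨(1, 2), by decide⟩ = true := by decide
  rw [hf1, hf2, hf3]
  have e1 : (pairs3Equiv fun _ => ℕ × ℕ) κ ⟨(0, 1), by decide⟩ = κ.1 := rfl
  have e2 : (pairs3Equiv fun _ => ℕ × ℕ) κ ⟨(0, 2), by decide⟩ = κ.2.1 := rfl
  have e3 : (pairs3Equiv fun _ => ℕ × ℕ) κ ⟨(1, 2), by decide⟩ = κ.2.2 := rfl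
  rw [e1, e2, e3]
  congr 1
  · simp only [pairCoef, psign, pchoose, ksign]
    simp
    ring
  · congr 1
    funext i
    fin_cases i <;> refine Prod.ext ?_ ?_ <;> simp [pairShift, pcast] <;> ring

end SmallFamilies

section Extraction

variable {K : Type*} [Field K] [CharZero K] {V : Type*} [AddCommGroup V] [Module K V]

/-- The exponents `hh` exhibit the uniform locality of the algebra. -/
def UnifExponents (A : OPEAlg K V) (rr : V → V → ℕ)
    (hh : ∀ a b : V, Fin (rr a b) → Idx K) : Prop :=
  ∀ (r : ℕ) (f : Fin r → V) (pf : Fin r → ZMod 2),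
    (∀ i, memPar K A.ev A.od (f i) (pf i)) →
      ∃ c, IsMultOPE K V (fun i => A.Y (f i)) pf (fun i j => rr (f i) (f j))
          (fun i j => hh (f i) (f j)) c ∧
        ∀ α, IsPowN K V (evN K V (c α) A.one)

/-- Power series in three variable pairs. -/
def IsPow3 (p : Idx K → Idx K → Idx K → V) : Prop :=
  ∀ x y z, p x y z ≠ 0 → PNeg x ∧ PNeg y ∧ PNeg z

theorem pneg_neg_one_add {j : ℕ × ℕ} (h : PNeg (-1 + pcast K j)) : j = 0 := by
  obtain ⟨r, hr⟩ := pneg_iff.mp h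
  have : pcast K (j + r) = pcast K 0 := by
    rw [pcast_add, pcast_zero]; linear_combination hr
  have h2 := pcast_injective this
  exact (add_eq_zero.mp h2).1

variable {A : OPEAlg K V} {rr : V → V → ℕ} {hh : ∀ a b : V, Fin (rr a b) → Idx K}

theorem Y_neg_one_one (A : OPEAlg K V) (a : V) : A.Y a (-1) A.one = a := A.rid a

theorem UnifExponents.exists_pair (H : UnifExponents A rr hh) {e c : V} {pe pc : ZMod 2}
    (he : memPar K A.ev A.od e pe) (hc : memPar K A.ev A.od c pc) :
    (∀ i, Kbar K (hh e c i)) ∧ ∃ Q : Fin (rr e c) → Dist2 K V, (∀ i, IsPow2 K V (Q i)) ∧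
      (∀ n, A.Y e n c = ∑ i, Q i (n - hh e c i) (-1)) ∧
      ∀ n k, koszul K pe pc • A.Y c k (A.Y e n A.one) =
        ∑ i, zwPowW K V (-(hh e c i)) (Q i) n k := by
  obtain ⟨C, ⟨hK, -, hC⟩, hP⟩ := H 2 ![e, c] ![pe, pc] (by
    intro i; fin_cases i
    · exact he
    · exact hc)
  let eq : ((p : Pairs 2) → Fin (rr (![e, c] p.1.1) (![e, c] p.1.2))) ≃ Fin (rr e c) :=
    Equiv.piUnique _
  have hQ : ∀ i, IsPow2 K V fun n k => C (eq.symm i) ![n, k] A.one := fun i n k hne =>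
    ⟨hP _ _ hne 0, hP _ _ hne 1⟩
  refine ⟨hK 0 1, fun i n k => C (eq.symm i) ![n, k] A.one, hQ, fun n => ?_, fun n k => ?_⟩
  · have h1 := hC 1 A.one ![n, -1]
    rw [← Equiv.sum_comp eq.symm] at h1
    simp only [permMul_two_one] at h1
    have h2 : koszulPerm K ![pe, pc] 1 = 1 :=
      Finset.prod_eq_one fun p _ => if_neg fun h => not_lt_of_gt p.2 h.1
    have h3 : compSeq K V (fun i => A.Y (![e, c] i)) 1 ![n, -1] A.one =
        A.Y e n (A.Y c (-1) A.one) := by simp [compSeq]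
    rw [h2, h3, one_smul, Y_neg_one_one] at h1
    rw [h1]
    refine Finset.sum_congr rfl fun i _ => ?_
    rw [zwPow_apply, finsum_eq_single _ 0]
    · rw [psign_zero, pchoose_zero, pcast_zero, mul_one, one_smul, sub_zero, add_zero,
        ← sub_eq_add_neg]
      rfl
    · intro j hj
      have : evN K V (C (eq.symm i)) A.one ![![n, -1] 0 +
          -(hh (![e, c] (default : Pairs 2).1.1) (![e, c] (default : Pairs 2).1.2)
            (eq.symm i default)) - pcast K j, ![n, -1] 1 + pcast K j] = 0 := by
        by_contra hne
        exact hj (pneg_neg_one_add (hP _ _ hne 1))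
      exact (congrArg _ this).trans (smul_zero _)
  · have h1 := hC (Equiv.swap 0 1) A.one ![n, k]
    rw [← Equiv.sum_comp eq.symm] at h1
    simp only [permMul_two_swap] at h1
    have h2 : koszulPerm K ![pe, pc] (Equiv.swap 0 1) = koszul K pe pc := by
      simp [koszulPerm, default, koszul]
    have h3 : compSeq K V (fun i => A.Y (![e, c] i)) (Equiv.swap 0 1) ![n, k] A.one =
        A.Y c k (A.Y e n A.one) := by simp [compSeq]
    rw [h2, h3] at h1
    exact h1

theorem UnifExponents.exists_triple (H : UnifExponents A rr hh) {a b c : V} {pa pb pc : ZMod 2}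
    (ha : memPar K A.ev A.od a pa) (hb : memPar K A.ev A.od b pb)
    (hc : memPar K A.ev A.od c pc) :
    ∃ p : Fin (rr a b) → Fin (rr a c) → Fin (rr b c) → Idx K → Idx K → Idx K → V,
      (∀ i j k, IsPow3 (p i j k)) ∧
      (∀ m n, A.Y a m (A.Y b n c) = ∑ i, ∑ j, ∑ k, ∑ᶠ κ : ℕ × ℕ,
        (psign K κ * pchoose (-(hh a b i)) κ) •
          p i j k (m - hh a b i - hh a c j - pcast K κ) (n - hh b c k + pcast K κ) (-1)) ∧
      ∀ m n l, (koszul K pa pc * koszul K pb pc) • A.Y c l (A.Y a m (A.Y b n A.one)) =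
        ∑ i, ∑ j, ∑ k, ∑ᶠ κ : (ℕ × ℕ) × (ℕ × ℕ) × (ℕ × ℕ),
        (psign K κ.1 * pchoose (-(hh a b i)) κ.1 *
          (ksign (-(hh a c j)) * psign K κ.2.1 * pchoose (-(hh a c j)) κ.2.1) *
          (ksign (-(hh b c k)) * psign K κ.2.2 * pchoose (-(hh b c k)) κ.2.2)) •
        p i j k (m - hh a b i - pcast K κ.1 + pcast K κ.2.1)
          (n + pcast K κ.1 + pcast K κ.2.2)
          (l - hh a c j - hh b c k - pcast K κ.2.1 - pcast K κ.2.2) := by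
  obtain ⟨C, ⟨hK, -, hC⟩, hP⟩ := H 3 ![a, b, c] ![pa, pb, pc] (by
    intro i; fin_cases i
    · exact ha
    · exact hb
    · exact hc)
  let X : Pairs 3 → Type := fun p => Fin (rr (![a, b, c] p.1.1) (![a, b, c] p.1.2))
  have hsum : ∀ F : (∀ p, X p) → V, ∑ α, F α = ∑ i : Fin (rr a b), ∑ j : Fin (rr a c),
      ∑ k : Fin (rr b c), F (pairs3Equiv X (i, j, k)) := by
    intro F
    rw [← Equiv.sum_comp (pairs3Equiv X)]
    rw [Fintype.sum_prod_type]
    refine Finset.sum_congr rfl fun i _ => ?_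
    rw [Fintype.sum_prod_type]
    rfl
  refine ⟨fun i j k x y z => C (pairs3Equiv X (i, j, k)) ![x, y, z] A.one,
    fun i j k x y z hne => ⟨hP _ _ hne 0, hP _ _ hne 1, hP _ _ hne 2⟩, fun m n => ?_,
    fun m n l => ?_⟩
  · have h1 := hC 1 A.one ![m, n, -1]
    have h2 : koszulPerm K ![pa, pb, pc] 1 = 1 :=
      Finset.prod_eq_one fun p _ => if_neg fun h => not_lt_of_gt p.2 h.1
    have h3 : compSeq K V (fun i => A.Y (![a, b, c] i)) 1 ![m, n, -1] A.one =
        A.Y a m (A.Y b n (A.Y c (-1) A.one)) := by simp [compSeq]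
    rw [h2, h3, one_smul, Y_neg_one_one] at h1
    rw [h1]
    refine (hsum _).trans ?_
    refine Finset.sum_congr rfl fun i _ => Finset.sum_congr rfl fun j _ =>
      Finset.sum_congr rfl fun k _ => ?_
    rw [permMul_three_one]
    rw [finsum_eq_of_support_subset_range (e := fun κ : ℕ × ℕ =>
      ((κ, 0, 0) : (ℕ × ℕ) × (ℕ × ℕ) × (ℕ × ℕ)))]
    · refine finsum_congr fun κ => ?_
      simp only [psign_zero, pchoose_zero, pcast_zero, mul_one, sub_zero, add_zero]
      show _ • C _ _ _ = _ • C _ _ _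
      congr 2
      congr 1
      congr 1
      · show m + -hh a b i - pcast K κ + -hh a c j = _
        abel
      · congr 1
        show n + pcast K κ + -hh b c k = _
        abel
    · intro x y hxy
      exact congrArg Prod.fst hxy
    · rintro ⟨κ, κ', κ''⟩ hne
      have h0 := hP _ _ (fun h0 => hne ((congrArg _ h0).trans (smul_zero _))) 2
      have h4 : PNeg (-1 + pcast K (κ' + κ'')) := by
        rw [pcast_add, ← add_assoc]
        exact h0
      obtain ⟨h5, h6⟩ := add_eq_zero.mp (pneg_neg_one_add h4)
      exact ⟨κ, by rw [h5, h6]⟩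
  · have h1 := hC (finRotate 3).symm A.one ![m, n, l]
    have h2 : koszulPerm K ![pa, pb, pc] (finRotate 3).symm =
        koszul K pa pc * koszul K pb pc := by
      have hf1 : ¬ (finRotate 3).symm.symm (1 : Fin 3) < (finRotate 3).symm.symm 0 := by decide
      have hf2 : (finRotate 3).symm.symm (2 : Fin 3) < (finRotate 3).symm.symm 0 := by decide
      have hf3 : (finRotate 3).symm.symm (2 : Fin 3) < (finRotate 3).symm.symm 1 := by decide
      rw [koszulPerm, prod_pairs3]
      simp only [hf1, hf2, hf3, true_and, false_and, if_false, one_mul]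
      rfl
    have h3 : compSeq K V (fun i => A.Y (![a, b, c] i)) (finRotate 3).symm ![m, n, l] A.one =
        A.Y c l (A.Y a m (A.Y b n A.one)) := by
      have h4 : (List.ofFn fun j : Fin 3 => (finRotate 3).symm j) = [2, 0, 1] := by decide
      rw [compSeq, h4]
      rfl
    rw [h2, h3] at h1
    rw [h1]
    refine (hsum _).trans ?_
    refine Finset.sum_congr rfl fun i _ => Finset.sum_congr rfl fun j _ =>
      Finset.sum_congr rfl fun k _ => ?_
    rw [permMul_three_rotate]
    refine finsum_congr fun κ => ?_
    show _ • C _ _ _ = _ • C _ _ _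
    congr 2
    congr 1
    congr 1
    · show m + -hh a b i - pcast K κ.1 + pcast K κ.2.1 = _
      abel
    · congr 2
      show l + -hh a c j - pcast K κ.2.1 + -hh b c k - pcast K κ.2.2 = _
      abel

theorem koszul_add (p q s : ZMod 2) : koszul K (p + q) s = koszul K p s * koszul K q s := by
  have h : ∀ p q : ZMod 2, (p + q = 1 ↔ ¬ (p = 1 ↔ q = 1)) := by decide
  unfold koszul
  simp only [h p q]
  by_cases h1 : p = 1 <;> by_cases h2 : q = 1 <;> by_cases h3 : s = 1 <;> simp [h1, h2, h3]

theorem exists_par_decomp (A : OPEAlg K V) (v : V) :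
    ∃ x y, memPar K A.ev A.od x 0 ∧ memPar K A.ev A.od y 1 ∧ v = x + y := by
  obtain ⟨x, hx, y, hy, h⟩ := Submodule.mem_sup.mp
    (A.compl.sup_eq_top.symm ▸ Submodule.mem_top : v ∈ A.ev ⊔ A.od)
  exact ⟨x, y, Or.inl ⟨rfl, hx⟩, Or.inr ⟨rfl, hy⟩, h.symm⟩

theorem Y_endPar (A : OPEAlg K V) {a : V} {p : ZMod 2} (ha : memPar K A.ev A.od a p) (n : Idx K) :
    EndPar K A.ev A.od (A.Y a n) p := by
  have h : ∀ v q, memPar K A.ev A.od v q → memPar K A.ev A.od (A.Y a n v) (p + q) :=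
    fun v q hv => A.Y_par a p ha n v q hv
  have hp : p = 0 ∨ p = 1 := by
    rcases ha with h | h
    · exact Or.inl h.1
    · exact Or.inr h.1
  rcases hp with rfl | rfl
  · rw [EndPar, if_pos rfl]
    refine ⟨fun v hv => ?_, fun v hv => ?_⟩
    · simpa [memPar] using h v 0 (Or.inl ⟨rfl, hv⟩)
    · simpa [memPar] using h v 1 (Or.inr ⟨rfl, hv⟩)
  · rw [EndPar, if_neg one_ne_zero]
    have e : (1 : ZMod 2) + 1 = 0 := by decide
    refine ⟨fun v hv => ?_, fun v hv => ?_⟩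
    · simpa [memPar] using h v 0 (Or.inl ⟨rfl, hv⟩)
    · simpa [memPar, e] using h v 1 (Or.inr ⟨rfl, hv⟩)

theorem InLat1.add {x y : Dist1 K V} (hx : InLat1 K V x) (hy : InLat1 K V y) :
    InLat1 K V (x + y) := by
  obtain ⟨S, hS⟩ := hx
  obtain ⟨S', hS'⟩ := hy
  refine ⟨S ∪ S', fun n hn => ?_⟩
  by_cases h : x n = 0
  · have h' : y n ≠ 0 := fun h' => hn (by rw [Pi.add_apply, h, h', add_zero])
    obtain ⟨m, hm, h⟩ := hS' n h'
    exact ⟨m, Finset.mem_union_right _ hm, h⟩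
  · obtain ⟨m, hm, h⟩ := hS n h
    exact ⟨m, Finset.mem_union_left _ hm, h⟩

theorem UnifExponents.inLat1 (H : UnifExponents A rr hh) (a v : V) :
    InLat1 K V (ev1 K V (A.Y a) v) := by
  have key : ∀ {a v pa pv}, memPar K A.ev A.od a pa → memPar K A.ev A.od v pv →
      InLat1 K V (ev1 K V (A.Y a) v) := by
    intro a v pa pv ha hv
    obtain ⟨-, Q, hQ, hQ1, -⟩ := H.exists_pair ha hv
    refine ⟨Finset.univ.image (hh a v), fun n hn => ?_⟩
    rw [ev1, hQ1] at hn
    obtain ⟨i, -, hi⟩ := Finset.exists_ne_zero_of_sum_ne_zero hn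
    exact ⟨hh a v i, Finset.mem_image_of_mem _ (Finset.mem_univ i), (hQ i _ _ hi).1⟩
  obtain ⟨a0, a1, ha0, ha1, rfl⟩ := exists_par_decomp A a
  obtain ⟨v0, v1, hv0, hv1, rfl⟩ := exists_par_decomp A v
  have e : ev1 K V (A.Y (a0 + a1)) (v0 + v1) = (ev1 K V (A.Y a0) v0 + ev1 K V (A.Y a0) v1) +
      (ev1 K V (A.Y a1) v0 + ev1 K V (A.Y a1) v1) := by
    funext n
    simp [ev1]
  rw [e]
  exact ((key ha0 hv0).add (key ha0 hv1)).add ((key ha1 hv0).add (key ha1 hv1))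

theorem kbar_of_pneg_sub {n h : Idx K} (hh : Kbar K h) (hn : PNeg (n - h)) : Kbar K n := by
  obtain ⟨r, hr⟩ := pneg_iff.mp hn
  have e : n = h + -pcast K r + -1 := by linear_combination hr
  rw [e]
  exact kbar_add (kbar_add hh (kbar_neg (kbar_pcast r))) (kbar_neg ⟨0, by simp⟩)

theorem UnifExponents.bounded (H : UnifExponents A rr hh) (a : V) (n : Idx K) (hn : ¬ Kbar K n)
    (v : V) : A.Y a n v = 0 := by
  have key : ∀ {a v pa pv}, memPar K A.ev A.od a pa → memPar K A.ev A.od v pv →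
      A.Y a n v = 0 := by
    intro a v pa pv ha hv
    obtain ⟨hK, Q, hQ, hQ1, -⟩ := H.exists_pair ha hv
    rw [hQ1]
    refine Finset.sum_eq_zero fun i _ => ?_
    by_contra hne
    exact hn (kbar_of_pneg_sub (hK i) (hQ i _ _ hne).1)
  obtain ⟨a0, a1, ha0, ha1, rfl⟩ := exists_par_decomp A a
  obtain ⟨v0, v1, hv0, hv1, rfl⟩ := exists_par_decomp A v
  simp [key ha0 hv0, key ha0 hv1, key ha1 hv0, key ha1 hv1]

end Extraction

section Uniqueness

variable {K : Type*} [Field K] [CharZero K] {V : Type*} [AddCommGroup V] [Module K V]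

theorem finsum_smul_finsum_add (α β : ℕ × ℕ → K) (G : ℕ × ℕ → V)
    (hG : (Function.support G).Finite) :
    ∑ᶠ l, α l • ∑ᶠ j, β j • G (l + j) =
      ∑ᶠ s, (∑ p ∈ panti s, α p.1 * β p.2) • G s := by
  obtain ⟨h1, h2⟩ := finsum_push (fun p : (ℕ × ℕ) × (ℕ × ℕ) => p.1 + p.2)
    (fun p => α p.1 * β p.2) G panti (fun x y => mem_panti) hG
  rw [← h2, finsum_prod_eq (fun l j => (α l * β j) • G (l + j)) h1]
  refine finsum_congr fun l => ?_
  rw [smul_finsum]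
  exact finsum_congr fun j => smul_smul _ _ _

theorem ksign_ne_zero (x : Idx K) : ksign x ≠ 0 := by
  unfold ksign negOnePow
  split_ifs with h
  · exact zpow_ne_zero _ (neg_ne_zero.mpr one_ne_zero)
  · exact one_ne_zero

theorem psign_mul_pchoose_add (x y : Idx K) (s : ℕ × ℕ) :
    ∑ p ∈ panti s, psign K p.1 * pchoose x p.1 * (psign K p.2 * pchoose y p.2) =
      psign K s * pchoose (x + y) s := by
  rw [pchoose_add, Finset.mul_sum]
  refine Finset.sum_congr rfl fun p hp => ?_
  rw [← mem_panti.mp hp, psign_add]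
  ring

theorem isPow2_pneg {q : Dist2 K V} (hq : IsPow2 K V q) {n k : Idx K} (h : q n k ≠ 0) :
    PNeg n ∧ PNeg k := hq n k h

theorem pneg_of_pneg_add {x : Idx K} {j : ℕ × ℕ} (h : PNeg (x + pcast K j)) : PNeg x := by
  obtain ⟨r, hr⟩ := pneg_iff.mp h
  exact pneg_iff.mpr ⟨r + j, by rw [pcast_add]; linear_combination hr⟩

theorem pneg_of_zwPowW_ne_zero {q : Dist2 K V} (hq : IsPow2 K V q) {h n k : Idx K}
    (hne : zwPowW K V h q n k ≠ 0) : PNeg n := by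
  obtain ⟨j, hj⟩ : ∃ j : ℕ × ℕ, (ksign h * psign K j * pchoose h j) •
      q (n + pcast K j) (k + h - pcast K j) ≠ 0 := by
    by_contra! h0
    exact hne ((zwPowW_apply h q n k).trans ((finsum_congr h0).trans finsum_zero))
  exact pneg_of_pneg_add (isPow2_pneg hq (right_ne_zero_of_smul hj)).1

/-- The leading coefficients of a relation between power series multiplied by powers of
`(z - w)`, expanded in `w > z`, sum up to zero. -/
theorem sum_apply_neg_one_eq_zero {ι : Type*} [Fintype ι] (G : ι → Idx K) (q : ι → Dist2 K V)
    (hG : ∀ β, Kbar K (G β)) (hq : ∀ β, IsPow2 K V (q β))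
    (H : ∀ n k, ∑ β, zwPowW K V (-(G β)) (q β) n k = 0) (n : Idx K) :
    ∑ β, q β (n - G β) (-1) = 0 := by
  have hN : ∀ β, ∃ N₀ : ℕ × ℕ, (∃ N' d, n + pcast K N' - G β = pcast K d) →
      ∃ d, n + pcast K N₀ - G β = pcast K d := by
    intro β
    by_cases h : ∃ N' d, n + pcast K N' - G β = pcast K d
    · obtain ⟨N', h⟩ := h
      exact ⟨N', fun _ => h⟩
    · exact ⟨0, fun h' => absurd h' h⟩
  choose N₀ hN₀ using hN
  let N : ℕ × ℕ := ∑ β, N₀ β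
  have hNd : ∀ β, (∃ N' d, n + pcast K N' - G β = pcast K d) →
      ∃ d, n + pcast K N - G β = pcast K d := by
    intro β h
    obtain ⟨d, hd⟩ := hN₀ β h
    obtain ⟨e, he⟩ := le_iff_exists_add.mp
      (Finset.single_le_sum (f := N₀) (fun _ _ => zero_le) (Finset.mem_univ β))
    refine ⟨d + e, ?_⟩
    rw [show N = N₀ β + e from he, pcast_add, pcast_add, ← hd]
    abel
  set g : Idx K := n + pcast K N with hg
  have key : ∀ β, ∑ᶠ l, (psign K l * pchoose g l) •
      zwPowW K V (-(G β)) (q β) (n - g + pcast K l) (-1 + g - pcast K l) =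
      ksign g • q β (n - G β) (-1) := by
    intro β
    have hfin : (Function.support fun s : ℕ × ℕ =>
        q β (n - g + pcast K s) (-1 + g - G β - pcast K s)).Finite :=
      (finite_pneg_add (n - g)).subset fun s hs => (isPow2_pneg (hq β) hs).1
    have e1 : ∀ l, (psign K l * pchoose g l) •
        zwPowW K V (-(G β)) (q β) (n - g + pcast K l) (-1 + g - pcast K l) =
        (ksign (-(G β)) * (psign K l * pchoose g l)) •
          ∑ᶠ j, (psign K j * pchoose (-(G β)) j) •
          q β (n - g + pcast K (l + j)) (-1 + g - G β - pcast K (l + j)) := by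
      intro l
      simp only [zwPowW_apply, mul_comm (ksign _) (psign K l * _),
        mul_smul (psign K l * pchoose g l),
        smul_finsum (ksign _)]
      congr 1
      refine finsum_congr fun j => ?_
      rw [smul_smul, mul_assoc, pcast_add]
      congr 2 <;> abel
    rw [finsum_congr e1]
    rw [finsum_smul_finsum_add _ _ _ hfin]
    have e2 : ∀ s, (∑ p ∈ panti s, ksign (-(G β)) * (psign K p.1 * pchoose g p.1) *
        (psign K p.2 * pchoose (-(G β)) p.2)) =
        ksign (-(G β)) * psign K s * pchoose (g - G β) s := by
      intro s
      rw [mul_assoc, sub_eq_add_neg, ← psign_mul_pchoose_add, Finset.mul_sum]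
      exact Finset.sum_congr rfl fun p _ => by ring
    simp only [e2]
    by_cases hβ : ∃ N' d, n + pcast K N' - G β = pcast K d
    · obtain ⟨d, hd⟩ := hNd β hβ
      rw [finsum_eq_single _ d]
      · have hgd : g = G β + pcast K d := by rw [← hd]; abel
        rw [hd, pchoose_pcast_self, mul_one, ← ksign_pcast]
        have hsign : ksign (-(G β)) * ksign (pcast K d) = ksign g := by
          rw [hgd, ksign_add (hG β) (kbar_pcast d)]
          linear_combination ksign (pcast K d) * ksign_neg (hG β) * ksign (G β) -
            ksign (-(G β)) * ksign (pcast K d) * ksign_mul_self (hG β)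
        rw [hsign]
        congr 2
        · rw [hgd]; abel
        · rw [hgd]; abel
      · intro s hs
        by_contra hne
        by_cases hle : s ≤ d
        · obtain ⟨e, rfl⟩ := le_iff_exists_add.mp hle
          have h0 := (isPow2_pneg (hq β) fun h0 => hne ((congrArg _ h0).trans (smul_zero _))).2
          have e3 : -1 + g - G β - pcast K s = -1 + pcast K e := by
            rw [add_sub_assoc, hd, pcast_add]; abel
          rw [e3] at h0
          exact hs (by rw [pneg_neg_one_add h0, add_zero])
        · rw [hd, pchoose_pcast_of_not_le hle, mul_zero, zero_smul] at hne
          exact hne rfl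
    · have h0 : q β (n - G β) (-1) = 0 := by
        by_contra hne
        obtain ⟨r, hr⟩ := pneg_iff.mp (isPow2_pneg (hq β) hne).1
        refine hβ ⟨(1, 1) + r, 0, ?_⟩
        have e11 : pcast K (1, 1) = 1 := by simp [pcast, Prod.ext_iff]
        rw [pcast_add, e11, pcast_zero]
        linear_combination hr
      rw [h0, smul_zero]
      refine (finsum_congr fun s => ?_).trans finsum_zero
      by_contra hne
      obtain ⟨r, hr⟩ := pneg_iff.mp
        (isPow2_pneg (hq β) fun h0 => hne ((congrArg _ h0).trans (smul_zero _))).2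
      refine hβ ⟨N + r, s, ?_⟩
      rw [pcast_add]
      linear_combination hr
  have hsum : ∑ β, ksign g • q β (n - G β) (-1) = 0 := by
    rw [← Finset.sum_congr rfl fun β _ => key β, ← finsum_sum_comm]
    · refine (finsum_congr fun l => ?_).trans finsum_zero
      rw [← Finset.smul_sum, H, smul_zero]
    · intro β _
      exact (finite_pneg_add (n - g)).subset fun l hl =>
        pneg_of_zwPowW_ne_zero (hq β) (right_ne_zero_of_smul hl)
  rw [← Finset.smul_sum] at hsum
  exact (smul_eq_zero.mp hsum).resolve_left (ksign_ne_zero g)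

theorem zwPowW_neg (h : Idx K) (c : Dist2 K V) (n k : Idx K) :
    zwPowW K V h (-c) n k = -zwPowW K V h c n k := by
  rw [zwPowW_apply, zwPowW_apply, ← finsum_neg_distrib]
  exact finsum_congr fun j => smul_neg _ _

theorem UnifExponents.eq_of_commuted {A : OPEAlg K V} {rr : V → V → ℕ}
    {hh : ∀ a b : V, Fin (rr a b) → Idx K} (H : UnifExponents A rr hh)
    {e c : V} {pe pc : ZMod 2}
    (he : memPar K A.ev A.od e pe) (hc : memPar K A.ev A.od c pc)
    {ι : Type*} [Fintype ι] (G : ι → Idx K) (q : ι → Dist2 K V)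
    (hG : ∀ β, Kbar K (G β)) (hq : ∀ β, IsPow2 K V (q β))
    (hGq : ∀ n k, koszul K pe pc • A.Y c k (A.Y e n A.one) =
      ∑ β, zwPowW K V (-(G β)) (q β) n k) (n : Idx K) :
    A.Y e n c = ∑ β, q β (n - G β) (-1) := by
  obtain ⟨hK, Q, hQ, hQ1, hQ2⟩ := H.exists_pair he hc
  have h0 := sum_apply_neg_one_eq_zero (Sum.elim G (hh e c)) (Sum.elim q fun i => -(Q i))
    (by rintro (β | i); exacts [hG β, hK i])
    (by
      rintro (β | i)
      · exact hq β
      · exact fun n k hne => hQ i n k fun h0 => hne (neg_eq_zero.mpr h0))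
    (fun n k => by
      rw [Fintype.sum_sum_type]
      simp only [Sum.elim_inl, Sum.elim_inr, zwPowW_neg, Finset.sum_neg_distrib]
      rw [← hGq, ← hQ2, add_neg_cancel]) n
  rw [Fintype.sum_sum_type] at h0
  simp only [Sum.elim_inl, Sum.elim_inr, Pi.neg_apply, Finset.sum_neg_distrib] at h0
  rw [hQ1, ← sub_eq_zero, ← neg_eq_zero, neg_sub, sub_eq_add_neg]
  exact h0

end Uniqueness

section Translation

variable {K : Type*} [Field K] [CharZero K] {V : Type*} [AddCommGroup V] [Module K V]

/-- `l` is one of the two coordinates of `K²` and `δ` the unit vector in its direction. -/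
structure IsCoord (δ : ℕ × ℕ) (l : Idx K →ₗ[K] K) : Prop where
  apply_unit : l (pcast K δ) = 1
  apply_one : l 1 = 1
  psign_unit : psign K δ = -1
  apply_eq_zero : ∀ j, j ∉ Set.range (· + δ) → l (pcast K j) = 0
  mul_pchoose : ∀ x j, l (pcast K (j + δ)) * pchoose x (j + δ) =
    l x * pchoose (x - pcast K δ) j
  mul_pchoose' : ∀ x j, l (pcast K (j + δ)) * pchoose x (j + δ) =
    (l x - l (pcast K j)) * pchoose x j

theorem succ_mul_gchoose (x : K) (j : ℕ) :
    ((j : K) + 1) * gchoose K x (j + 1) = x * gchoose K (x - 1) j := by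
  have h := gchoose_mul_choose x 1 j
  rw [Nat.add_comm 1 j, Nat.choose_succ_self_right] at h
  rw [mul_comm]
  simpa [gchoose] using h

theorem isCoord_fst : IsCoord (K := K) (1, 0) (LinearMap.fst K K K) where
  apply_unit := by simp [pcast]
  apply_one := by simp
  psign_unit := by simp [psign]
  apply_eq_zero := by
    rintro ⟨_ | j, j'⟩ hj
    · simp [pcast]
    · exact absurd ⟨(j, j'), rfl⟩ hj
  mul_pchoose x j := by
    have h := succ_mul_gchoose x.1 j.1
    simp only [pchoose, pcast, LinearMap.fst_apply, Prod.fst_add, Prod.snd_add, Prod.fst_sub,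
      Prod.snd_sub, Nat.cast_add, Nat.cast_one, Nat.cast_zero, sub_zero, add_zero]
    rw [← mul_assoc, h, mul_assoc]
  mul_pchoose' x j := by
    have h := gchoose_mul_succ x.1 j.1
    simp only [pchoose, pcast, LinearMap.fst_apply, Prod.fst_add, Prod.snd_add,
      Nat.cast_add, Nat.cast_one, add_zero]
    linear_combination gchoose K x.2 j.2 * h

theorem isCoord_snd : IsCoord (K := K) (0, 1) (LinearMap.snd K K K) where
  apply_unit := by simp [pcast]
  apply_one := by simp
  psign_unit := by simp [psign]
  apply_eq_zero := by
    rintro ⟨j', _ | j⟩ hj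
    · simp [pcast]
    · exact absurd ⟨(j', j), rfl⟩ hj
  mul_pchoose x j := by
    have h := succ_mul_gchoose x.2 j.2
    simp only [pchoose, pcast, LinearMap.snd_apply, Prod.fst_add, Prod.snd_add, Prod.fst_sub,
      Prod.snd_sub, Nat.cast_add, Nat.cast_one, Nat.cast_zero, sub_zero, add_zero]
    linear_combination gchoose K x.1 j.1 * h
  mul_pchoose' x j := by
    have h := gchoose_mul_succ x.2 j.2
    simp only [pchoose, pcast, LinearMap.snd_apply, Prod.fst_add, Prod.snd_add,
      Nat.cast_add, Nat.cast_one, add_zero]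
    linear_combination gchoose K x.1 j.1 * h

theorem sub_pcast_fst (n : Idx K) : n - pcast K (1, 0) = (n.1 - 1, n.2) := by
  simp [pcast, Prod.ext_iff]

theorem sub_pcast_snd (n : Idx K) : n - pcast K (0, 1) = (n.1, n.2 - 1) := by
  simp [pcast, Prod.ext_iff]

/-- A family vanishing at `-1` which is covariant under two operators vanishes. -/
theorem eq_zero_of_translation {T Tb : Module.End K V} {F : Dist1 K V}
    (h0 : ∀ n, ¬ PNeg n → F n = 0) (h1 : F (-1) = 0)
    (hT : ∀ n, T (F n) = (-n.1) • F (n.1 - 1, n.2))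
    (hTb : ∀ n, Tb (F n) = (-n.2) • F (n.1, n.2 - 1)) : F = 0 := by
  have key : ∀ i j : ℕ, F (-1 - (i : K), -1 - (j : K)) = 0 := by
    intro i j
    induction i with
    | zero =>
      induction j with
      | zero => rw [← h1]; congr 1; simp [Prod.ext_iff]
      | succ j ih =>
        have h := hTb (-1 - ((0 : ℕ) : K), -1 - (j : K))
        rw [ih, map_zero] at h
        have hne : -(-1 - (j : K)) ≠ 0 := by
          have : ((j + 1 : ℕ) : K) ≠ 0 := Nat.cast_ne_zero.mpr j.succ_ne_zero
          push_cast at this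
          rwa [neg_sub, sub_neg_eq_add]
        have h2 := (smul_eq_zero.mp h.symm).resolve_left hne
        rw [← h2]; congr 2; push_cast; ring
    | succ i ih =>
      have h := hT (-1 - (i : K), -1 - (j : K))
      rw [ih, map_zero] at h
      have hne : -(-1 - (i : K)) ≠ 0 := by
        have : ((i + 1 : ℕ) : K) ≠ 0 := Nat.cast_ne_zero.mpr i.succ_ne_zero
        push_cast at this
        rwa [neg_sub, sub_neg_eq_add]
      have h2 := (smul_eq_zero.mp h.symm).resolve_left hne
      rw [← h2]; congr 2; push_cast; ring
  funext n
  by_cases hn : PNeg n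
  · obtain ⟨r, rfl⟩ := pneg_iff.mp hn
    exact key r.1 r.2
  · exact h0 n hn

theorem eq_of_translation {T Tb : Module.End K V} {F F' : Dist1 K V}
    (h0 : ∀ n, ¬ PNeg n → F n = 0) (h0' : ∀ n, ¬ PNeg n → F' n = 0) (h1 : F (-1) = F' (-1))
    (hT : ∀ n, T (F n) = (-n.1) • F (n.1 - 1, n.2))
    (hTb : ∀ n, Tb (F n) = (-n.2) • F (n.1, n.2 - 1))
    (hT' : ∀ n, T (F' n) = (-n.1) • F' (n.1 - 1, n.2))
    (hTb' : ∀ n, Tb (F' n) = (-n.2) • F' (n.1, n.2 - 1)) : F = F' := by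
  refine sub_eq_zero.mp (eq_zero_of_translation (T := T) (Tb := Tb) (fun n hn => ?_) ?_
    (fun n => ?_) fun n => ?_)
  · rw [Pi.sub_apply, h0 n hn, h0' n hn, sub_zero]
  · rw [Pi.sub_apply, h1, sub_self]
  · rw [Pi.sub_apply, Pi.sub_apply, map_sub, hT, hT', smul_sub]
  · rw [Pi.sub_apply, Pi.sub_apply, map_sub, hTb, hTb', smul_sub]

variable (A : OPEAlg K V)

theorem T_Y (a c : V) (n : Idx K) :
    A.T (A.Y a n c) = A.Y a n (A.T c) + (-n.1) • A.Y a (n.1 - 1, n.2) c := by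
  have h := LinearMap.congr_fun ((A.tcov a).1 n) c
  rw [← sub_eq_iff_eq_add']
  exact h

theorem Tb_Y (a c : V) (n : Idx K) :
    A.Tb (A.Y a n c) = A.Y a n (A.Tb c) + (-n.2) • A.Y a (n.1, n.2 - 1) c := by
  have h := LinearMap.congr_fun ((A.tcov a).2 n) c
  rw [← sub_eq_iff_eq_add']
  exact h

theorem T_Y_one (a : V) (n : Idx K) :
    A.T (A.Y a n A.one) = (-n.1) • A.Y a (n.1 - 1, n.2) A.one := by
  rw [T_Y, A.T_one, map_zero, zero_add]

theorem Tb_Y_one (a : V) (n : Idx K) :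
    A.Tb (A.Y a n A.one) = (-n.2) • A.Y a (n.1, n.2 - 1) A.one := by
  rw [Tb_Y, A.Tb_one, map_zero, zero_add]

theorem Y_one_eq_zero (a : V) {n : Idx K} (hn : ¬ PNeg n) : A.Y a n A.one = 0 := by
  by_contra h
  exact hn (A.wcre a n h)

theorem T_Tb (v : V) : A.T (A.Tb v) = A.Tb (A.T v) := LinearMap.congr_fun A.commTTb v

theorem Y_T_one (a : V) (n : Idx K) : A.Y (A.T a) n A.one = A.T (A.Y a n A.one) := by
  refine congrFun (eq_of_translation (T := A.T) (Tb := A.Tb)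
    (F := fun n => A.Y (A.T a) n A.one) (F' := fun n => A.T (A.Y a n A.one))
    (fun n hn => Y_one_eq_zero A _ hn) (fun n hn => ?_) ?_ (T_Y_one A _) (Tb_Y_one A _)
    (fun n => ?_) fun n => ?_) n
  · simp only [Y_one_eq_zero A a hn, map_zero]
  · simp only [Y_neg_one_one]
  · simp only [T_Y_one, map_smul]
  · simp only [← T_Tb, Tb_Y_one, map_smul]

theorem Y_Tb_one (a : V) (n : Idx K) : A.Y (A.Tb a) n A.one = A.Tb (A.Y a n A.one) := by
  refine congrFun (eq_of_translation (T := A.T) (Tb := A.Tb)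
    (F := fun n => A.Y (A.Tb a) n A.one) (F' := fun n => A.Tb (A.Y a n A.one))
    (fun n hn => Y_one_eq_zero A _ hn) (fun n hn => ?_) ?_ (T_Y_one A _) (Tb_Y_one A _)
    (fun n => ?_) fun n => ?_) n
  · simp only [Y_one_eq_zero A a hn, map_zero]
  · simp only [Y_neg_one_one]
  · simp only [T_Tb, T_Y_one, map_smul]
  · simp only [Tb_Y_one, map_smul]

variable {A} {rr : V → V → ℕ} {hh : ∀ a b : V, Fin (rr a b) → Idx K}

theorem coord_smul_zwPowW {δ : ℕ × ℕ} {l : Idx K →ₗ[K] K} (hl : IsCoord δ l) {h : Idx K}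
    (hh : Kbar K h) {Q : Dist2 K V} (hQ : IsPow2 K V Q) (n k : Idx K) :
    (-l n) • zwPowW K V (-h) Q (n - pcast K δ) k =
      zwPowW K V (-h) (fun n k => (-l n) • Q (n - pcast K δ) k) n k +
      zwPowW K V (-(h + pcast K δ)) (fun n k => (-l h) • Q n k) n k := by
  have hfin : ∀ (f : ℕ × ℕ → K), (Function.support fun j =>
      f j • Q (n - pcast K δ + pcast K j) (k + -h - pcast K j)).Finite := fun f =>
    (finite_pneg_add (n - pcast K δ)).subset fun j hj =>
      (isPow2_pneg hQ (right_ne_zero_of_smul hj)).1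
  simp only [zwPowW_apply]
  have e2 : ∑ᶠ j, (ksign (-(h + pcast K δ)) * psign K j * pchoose (-(h + pcast K δ)) j) •
      (-l h) • Q (n + pcast K j) (k + -(h + pcast K δ) - pcast K j) =
      ∑ᶠ j, (l (pcast K j) * (ksign (-h) * psign K j * pchoose (-h) j)) •
        Q (n - pcast K δ + pcast K j) (k + -h - pcast K j) := by
    rw [finsum_eq_of_support_subset_range (e := (· + δ)) (add_left_injective δ)
      (f := fun j => (l (pcast K j) * (ksign (-h) * psign K j * pchoose (-h) j)) •
        Q (n - pcast K δ + pcast K j) (k + -h - pcast K j))]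
    · refine finsum_congr fun j => ?_
      rw [smul_smul]
      have h1 := hl.mul_pchoose (-h) j
      have h2 : ksign (-(h + pcast K δ)) = -ksign (-h) := by
        have h3 := ksign_add (kbar_neg (kbar_add hh (kbar_pcast δ))) (kbar_pcast δ)
        rw [ksign_pcast, hl.psign_unit] at h3
        rw [show -h = -(h + pcast K δ) + pcast K δ by abel, h3]
        ring
      have h4 : -(h + pcast K δ) = -h - pcast K δ := by abel
      rw [map_neg] at h1
      congr 1
      · rw [h2, psign_add, hl.psign_unit, h4]
        linear_combination ksign (-h) * psign K j * h1
      · rw [pcast_add]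
        congr 1 <;> abel
    · intro j hj
      by_contra hne
      exact hj (by simp only [hl.apply_eq_zero j hne, zero_mul, zero_smul])
  have e1 : ∑ᶠ j, (ksign (-h) * psign K j * pchoose (-h) j) •
      (-l (n + pcast K j)) • Q (n + pcast K j - pcast K δ) (k + -h - pcast K j) =
      ∑ᶠ j, (-l (n + pcast K j) * (ksign (-h) * psign K j * pchoose (-h) j)) •
        Q (n - pcast K δ + pcast K j) (k + -h - pcast K j) := by
    refine finsum_congr fun j => ?_
    rw [smul_smul, mul_comm, add_sub_right_comm]
  rw [e1, e2, ← finsum_add_distrib (hfin _) (hfin _), smul_finsum]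
  refine finsum_congr fun j => ?_
  rw [smul_smul, ← add_smul, map_add]
  congr 1
  ring

theorem UnifExponents.translation (H : UnifExponents A rr hh) {δ : ℕ × ℕ} {l : Idx K →ₗ[K] K}
    (hl : IsCoord δ l) {a a' c : V} {pa pc : ZMod 2} (ha : memPar K A.ev A.od a pa)
    (ha' : memPar K A.ev A.od a' pa) (hc : memPar K A.ev A.od c pc)
    (h : ∀ n, A.Y a' n A.one = (-l n) • A.Y a (n - pcast K δ) A.one) (n : Idx K) :
    A.Y a' n c = (-l n) • A.Y a (n - pcast K δ) c := by
  obtain ⟨hK, Q, hQ, hQ1, hQ2⟩ := H.exists_pair ha hc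
  rw [H.eq_of_commuted ha' hc (Sum.elim (hh a c) fun i => hh a c i + pcast K δ)
    (Sum.elim (fun i n k => (-l n) • Q i (n - pcast K δ) k) fun i n k => (-l (hh a c i)) • Q i n k)
    ?_ ?_ ?_ n, Fintype.sum_sum_type, hQ1, Finset.smul_sum, ← Finset.sum_add_distrib]
  · refine Finset.sum_congr rfl fun i _ => ?_
    simp only [Sum.elim_inl, Sum.elim_inr]
    rw [show n - hh a c i - pcast K δ = n - pcast K δ - hh a c i by abel,
      show n - (hh a c i + pcast K δ) = n - pcast K δ - hh a c i by abel, ← add_smul, map_sub]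
    congr 1
    ring
  · rintro (i | i)
    · exact hK i
    · exact kbar_add (hK i) (kbar_pcast δ)
  · rintro (i | i)
    · intro n k hne
      obtain ⟨h1, h2⟩ := isPow2_pneg (hQ i) (right_ne_zero_of_smul hne)
      refine ⟨?_, h2⟩
      by_contra hn
      obtain ⟨r, hr⟩ := pneg_iff.mp h1
      by_cases hr0 : r ∈ Set.range (· + δ)
      · obtain ⟨s, rfl⟩ := hr0
        refine hn (pneg_iff.mpr ⟨s, ?_⟩)
        rw [pcast_add] at hr
        linear_combination hr
      · have hrl := hl.apply_eq_zero r hr0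
        have : n = -1 - pcast K r + pcast K δ := by rw [← hr]; abel
        refine left_ne_zero_of_smul hne ?_
        rw [this, map_add, map_sub, map_neg, hrl, hl.apply_unit, hl.apply_one]
        ring
    · intro n k hne
      exact hQ i n k (right_ne_zero_of_smul hne)
  · intro n k
    rw [h, map_smul, smul_comm, hQ2, Finset.smul_sum, Fintype.sum_sum_type,
      ← Finset.sum_add_distrib]
    refine Finset.sum_congr rfl fun i _ => ?_
    exact coord_smul_zwPowW hl (hK i) (hQ i) n k

theorem memPar_of_endPar {f : Module.End K V} (hf : EndPar K A.ev A.od f 0) {a : V} {p : ZMod 2}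
    (ha : memPar K A.ev A.od a p) : memPar K A.ev A.od (f a) p := by
  rw [EndPar, if_pos rfl] at hf
  rcases ha with ha | ha
  · exact Or.inl ⟨ha.1, hf.1 _ ha.2⟩
  · exact Or.inr ⟨ha.1, hf.2 _ ha.2⟩

theorem UnifExponents.transEnd (H : UnifExponents A rr hh) :
    TransEnd K V V (fun a => A.Y a) A.T A.Tb := by
  have ext : ∀ {f : Module.End K V} {δ : ℕ × ℕ} {l : Idx K →ₗ[K] K}, IsCoord δ l →
      EndPar K A.ev A.od f 0 →
      (∀ a n, A.Y (f a) n A.one = (-l n) • A.Y a (n - pcast K δ) A.one) →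
      ∀ a n, A.Y (f a) n = (-l n) • A.Y a (n - pcast K δ) := by
    intro f δ l hl hf h a n
    have key : ∀ {a c pa pc}, memPar K A.ev A.od a pa → memPar K A.ev A.od c pc →
        A.Y (f a) n c = (-l n) • A.Y a (n - pcast K δ) c := fun ha hc =>
      H.translation hl ha (memPar_of_endPar hf ha) hc (h _) n
    ext c
    obtain ⟨a0, a1, ha0, ha1, rfl⟩ := exists_par_decomp A a
    obtain ⟨c0, c1, hc0, hc1, rfl⟩ := exists_par_decomp A c
    have h00 := key ha0 hc0
    have h01 := key ha0 hc1
    have h10 := key ha1 hc0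
    have h11 := key ha1 hc1
    simp only [map_add, Pi.add_apply, LinearMap.add_apply, LinearMap.smul_apply, smul_add] at *
    rw [h00, h01, h10, h11]
  constructor
  · intro a n
    have h := ext isCoord_fst A.T_ev (fun a n => by
      rw [Y_T_one, T_Y_one, sub_pcast_fst]; rfl) a n
    rw [sub_pcast_fst] at h
    exact h
  · intro a n
    have h := ext isCoord_snd A.Tb_ev (fun a n => by
      rw [Y_Tb_one, Tb_Y_one, sub_pcast_snd]; rfl) a n
    rw [sub_pcast_snd] at h
    exact h

end Translation

section DualSeries

variable {K : Type*} [Field K] [CharZero K] {V : Type*} [AddCommGroup V] [Module K V]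

theorem dz_iterate (j : ℕ) (a : Dist1 K V) (n : Idx K) :
    ((dz K V)^[j] a) n = ((-1) ^ j * gchoose K n.1 j * j.factorial) • a (n.1 - j, n.2) := by
  have h : ∀ (j : ℕ) (a : Dist1 K V), (fun n (_ : Idx K) => ((dz K V)^[j] a) n) =
      (d1z K V)^[j] (fun n _ => a n) := by
    intro j
    induction j with
    | zero => intro a; rfl
    | succ j ih => intro a; exact ih (dz K V a)
  exact (congrFun (congrFun (h j a) n) 0).trans (d1z_iterate j (fun n _ => a n) n 0)

theorem dzb_iterate (j : ℕ) (a : Dist1 K V) (n : Idx K) :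
    ((dzb K V)^[j] a) n = ((-1) ^ j * gchoose K n.2 j * j.factorial) • a (n.1, n.2 - j) := by
  have h : ∀ (j : ℕ) (a : Dist1 K V), (fun n (_ : Idx K) => ((dzb K V)^[j] a) n) =
      (d1zb K V)^[j] (fun n _ => a n) := by
    intro j
    induction j with
    | zero => intro a; rfl
    | succ j ih => intro a; exact ih (dzb K V a)
  exact (congrFun (congrFun (h j a) n) 0).trans (d1zb_iterate j (fun n _ => a n) n 0)

theorem lhsXW_apply (YM : V → EDist1 K V) (a : V) (bw : Dist1 K V) (m k : Idx K) :
    lhsXW K V V YM a bw m k = ∑ᶠ i : ℕ × ℕ, (psign K i * pchoose m i) •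
      YM a (m - pcast K i) (bw (k + pcast K i)) := by
  refine finsum_congr fun i => ?_
  have h1 : (i.1.factorial : K) ≠ 0 := by exact_mod_cast i.1.factorial_ne_zero
  have h2 : (i.2.factorial : K) ≠ 0 := by exact_mod_cast i.2.factorial_ne_zero
  rw [dz_iterate, dzb_iterate, smul_smul, LinearMap.smul_apply, smul_smul]
  have e : psign K i * pchoose m i = ((i.1.factorial : K)⁻¹ * (i.2.factorial : K)⁻¹) *
      ((-1) ^ i.1 * gchoose K m.1 i.1 * i.1.factorial *
        ((-1) ^ i.2 * gchoose K m.2 i.2 * i.2.factorial)) := by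
    rw [psign, pchoose, pow_add]
    field_simp
  rw [e]
  rfl

variable (A : OPEAlg K V)

theorem finite_support_Y_one (b : V) (n : Idx K) :
    (Function.support fun i => A.Y b (n + pcast K i) A.one).Finite :=
  (finite_pneg_add n).subset fun _ hi => A.wcre b _ hi

/-- The coefficients of `Y(a)(z - w) Y(b)(w) 1`. -/
def shiftedProduct (a b : V) (m : Idx K) : Dist1 K V := fun n =>
  ∑ᶠ i : ℕ × ℕ, (psign K i * pchoose m i) •
    A.Y a (m - pcast K i) (A.Y b (n + pcast K i) A.one)

theorem finite_support_shiftedProduct (a b : V) (n : Idx K) (f : ℕ × ℕ → K)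
    (g : ℕ × ℕ → Idx K) :
    (Function.support fun i => f i •
      A.Y a (g i) (A.Y b (n + pcast K i) A.one)).Finite :=
  (finite_support_Y_one A b n).subset fun i hi h0 =>
    hi (by simp only [h0, map_zero, smul_zero])

theorem shiftedProduct_translation {D : Module.End K V} {δ : ℕ × ℕ} {l : Idx K →ₗ[K] K}
    (hl : IsCoord δ l)
    (hD : ∀ a n c, D (A.Y a n c) = A.Y a n (D c) + (-l n) • A.Y a (n - pcast K δ) c)
    (hD1 : D A.one = 0) (a b : V) (m n : Idx K) :
    D (shiftedProduct A a b m n) = (-l n) • shiftedProduct A a b m (n - pcast K δ) := by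
  unfold shiftedProduct
  rw [map_finsum_of_finite D (finite_support_shiftedProduct A a b n _ _), smul_finsum]
  let G : ℕ × ℕ → V := fun s =>
    A.Y a (m - pcast K s) (A.Y b (n - pcast K δ + pcast K s) A.one)
  have hG : ∀ f : ℕ × ℕ → K, (Function.support fun s => f s • G s).Finite := fun f =>
    finite_support_shiftedProduct A a b _ f _
  have e1 : ∀ i, D ((psign K i * pchoose m i) •
      A.Y a (m - pcast K i) (A.Y b (n + pcast K i) A.one)) =
      (psign K i * pchoose m i * -l (n + pcast K i)) • G i +
      (psign K i * pchoose m i * -l (m - pcast K i)) • G (i + δ) := by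
    intro i
    rw [map_smul, hD, hD, hD1, map_zero, zero_add, map_smul, smul_add, smul_smul, smul_smul]
    simp only [G]
    rw [add_sub_right_comm, pcast_add, sub_sub, add_comm (pcast K i) (pcast K δ),
      ← add_assoc, sub_add_cancel]
  have e2 : ∑ᶠ i, (psign K i * pchoose m i * -l (m - pcast K i)) • G (i + δ) =
      ∑ᶠ s, (l (pcast K s) * (psign K s * pchoose m s)) • G s := by
    rw [finsum_eq_of_support_subset_range (e := (· + δ)) (add_left_injective δ)
      (f := fun s => (l (pcast K s) * (psign K s * pchoose m s)) • G s)]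
    · refine finsum_congr fun i => ?_
      have h1 := hl.mul_pchoose' m i
      congr 1
      simp only [psign_add, hl.psign_unit, map_sub]
      linear_combination psign K i * h1
    · intro s hs
      by_contra hne
      exact hs (by simp only [hl.apply_eq_zero s hne, zero_mul, zero_smul])
  rw [finsum_congr e1, finsum_add_distrib (hG _), e2, ← finsum_add_distrib (hG _) (hG _)]
  · refine finsum_congr fun s => ?_
    rw [← add_smul, smul_smul, map_add]
    congr 1
    ring
  · refine (finite_support_shiftedProduct A a b n
      (fun i => psign K i * pchoose m i * -l (m - pcast K i))
      (fun i => m - pcast K (i + δ))).subset fun i hi => ?_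
    simp only [G, pcast_add, Function.mem_support] at hi ⊢
    convert hi using 4
    exact congrArg (A.Y b) (by abel)

/-- Products of states act on `1` by the series `Y(a)(z - w) Y(b)(w) 1`. -/
theorem Y_Y_one (a b : V) (m n : Idx K) :
    A.Y (A.Y a m b) n A.one = shiftedProduct A a b m n := by
  refine congrFun (eq_of_translation (T := A.T) (Tb := A.Tb)
    (F := fun n => A.Y (A.Y a m b) n A.one) (F' := shiftedProduct A a b m)
    (fun n hn => Y_one_eq_zero A _ hn) (fun n hn => ?_) ?_ (T_Y_one A _) (Tb_Y_one A _)
    (fun n => ?_) fun n => ?_) n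
  · refine (finsum_congr fun i => ?_).trans finsum_zero
    rw [Y_one_eq_zero A b fun h => hn (pneg_of_pneg_add h), map_zero, smul_zero]
  · rw [shiftedProduct, finsum_eq_single _ 0]
    · simp only [psign_zero, pchoose_zero, pcast_zero, sub_zero, add_zero, mul_one, one_smul,
        Y_neg_one_one]
    · intro i hi
      rw [Y_one_eq_zero A b fun h => hi (pneg_neg_one_add h), map_zero, smul_zero]
  · rw [shiftedProduct_translation A isCoord_fst (fun a n c => ?_) A.T_one, sub_pcast_fst]
    · rfl
    · rw [T_Y, sub_pcast_fst]; rfl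
  · rw [shiftedProduct_translation A isCoord_snd (fun a n c => ?_) A.Tb_one, sub_pcast_snd]
    · rfl
    · rw [Tb_Y, sub_pcast_snd]; rfl

end DualSeries

section Resummation

variable {K : Type*} [Field K] [CharZero K] {V : Type*} [AddCommGroup V] [Module K V]

theorem finsum_prod_prod_eq {α β γ : Type*} (G : α → β → γ → V)
    (hG : (Function.support fun p : α × β × γ => G p.1 p.2.1 p.2.2).Finite) :
    ∑ᶠ p : α × β × γ, G p.1 p.2.1 p.2.2 = ∑ᶠ a, ∑ᶠ b, ∑ᶠ c, G a b c := by
  rw [finsum_prod_eq (fun a (p : β × γ) => G a p.1 p.2) hG]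
  refine finsum_congr fun a => ?_
  refine finsum_prod_eq (G a) ?_
  exact (hG.preimage (Prod.mk_right_injective a).injOn).subset fun p hp => hp

theorem pneg_of_pneg_sub {m : Idx K} {i : ℕ × ℕ} (h : PNeg (m - pcast K i))
    (hne : pchoose m i ≠ 0) : PNeg m := by
  have key : ∀ (x : K) (j : ℕ), IsNegInt K (x - j) → gchoose K x j ≠ 0 → IsNegInt K x := by
    rintro x j ⟨z, hz, hx⟩ hne
    have hx' : x = ((z + j : ℤ) : K) := by push_cast; rw [hx]; ring
    refine ⟨z + j, ?_, hx'.symm⟩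
    by_contra! h0
    obtain ⟨r, hr⟩ := Int.eq_ofNat_of_zero_le h0
    rw [hx', hr, Int.cast_natCast] at hne
    exact hne (gchoose_nat_of_lt (by omega))
  exact ⟨key _ _ h.1 (left_ne_zero_of_mul hne), key _ _ h.2 (right_ne_zero_of_mul hne)⟩

/-- The power series `p(w + x, w, y)`, expanded in `w, x, y`. -/
def translateFirst (p : Idx K → Idx K → Idx K → V) (k m y : Idx K) : V :=
  ∑ᶠ i : ℕ × ℕ, (psign K i * pchoose m i) • p (m - pcast K i) (k + pcast K i) y

theorem IsPow3.translateFirst {p : Idx K → Idx K → Idx K → V} (hp : IsPow3 p) :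
    IsPow3 (translateFirst p) := by
  intro k m y hne
  obtain ⟨i, hi⟩ : ∃ i : ℕ × ℕ, (psign K i * pchoose m i) •
      p (m - pcast K i) (k + pcast K i) y ≠ 0 := by
    by_contra! h0
    exact hne ((finsum_congr h0).trans finsum_zero)
  obtain ⟨h1, h2, h3⟩ := hp _ _ _ (right_ne_zero_of_smul hi)
  exact ⟨pneg_of_pneg_add h2, pneg_of_pneg_sub h1 (right_ne_zero_of_mul
    (left_ne_zero_of_smul hi)), h3⟩

/-- A summand of the expansion of `c(y) a(z) b(w) 1` in the region `y > z > w`. -/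
def rotatedSeries (g h l : Idx K) (p : Idx K → Idx K → Idx K → V) (m n k : Idx K) : V :=
  ∑ᶠ κ : (ℕ × ℕ) × (ℕ × ℕ) × (ℕ × ℕ),
    (psign K κ.1 * pchoose (-g) κ.1 *
      (ksign (-h) * psign K κ.2.1 * pchoose (-h) κ.2.1) *
      (ksign (-l) * psign K κ.2.2 * pchoose (-l) κ.2.2)) •
    p (m - g - pcast K κ.1 + pcast K κ.2.1) (n + pcast K κ.1 + pcast K κ.2.2)
      (k - h - l - pcast K κ.2.1 - pcast K κ.2.2)

theorem pneg_of_rotatedSeries_ne_zero {p : Idx K → Idx K → Idx K → V} (hp : IsPow3 p)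
    {g h l m n k : Idx K} (hne : rotatedSeries g h l p m n k ≠ 0) : PNeg n := by
  by_contra hn
  refine hne ((finsum_congr fun κ => ?_).trans finsum_zero)
  by_contra h0
  exact hn (pneg_of_pneg_add (pneg_of_pneg_add (hp _ _ _ (right_ne_zero_of_smul h0)).2.1))

theorem finite_support_pow3 {p : Idx K → Idx K → Idx K → V} (hp : IsPow3 p) (x n k : Idx K) :
    (Function.support fun y : (ℕ × ℕ) × (ℕ × ℕ) × (ℕ × ℕ) =>
      p (x - pcast K y.2.2 + pcast K y.1) (n + pcast K y.2.2 + pcast K y.2.1)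
        (k - pcast K y.1 - pcast K y.2.1)).Finite := by
  refine ((finite_pneg_add n).biUnion fun u _ => (panti u).finite_toSet.biUnion fun q _ =>
    (finite_pneg_add (x - pcast K q.1)).image fun t => (t, q.2, q.1)).subset fun y hy => ?_
  obtain ⟨h1, h2, -⟩ := hp _ _ _ hy
  simp only [Set.mem_iUnion]
  refine ⟨y.2.2 + y.2.1, ?_, (y.2.2, y.2.1), mem_panti.mpr rfl, y.1, h1, rfl⟩
  simpa [pcast_add, add_assoc] using h2

theorem finsum_rotatedSeries {p : Idx K → Idx K → Idx K → V} (hp : IsPow3 p) {g h l : Idx K}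
    (hh : Kbar K h) (hl : Kbar K l) (μ n k : Idx K) :
    ∑ᶠ i : ℕ × ℕ, (psign K i * pchoose μ i) •
      rotatedSeries g h l p (μ - pcast K i) (n + pcast K i) k =
    ∑ᶠ t : ℕ × ℕ, zwPowW K V (-(h + l + pcast K t))
      (fun n k => pchoose (-h) t • translateFirst p n (μ - g + pcast K t) k) n k := by
  let Φ : (ℕ × ℕ) × (ℕ × ℕ) × (ℕ × ℕ) → V := fun y =>
    p (μ - g - pcast K y.2.2 + pcast K y.1) (n + pcast K y.2.2 + pcast K y.2.1)
      (k - h - l - pcast K y.1 - pcast K y.2.1)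
  have hΦ : (Function.support Φ).Finite := finite_support_pow3 hp _ _ _
  let aa : ℕ × ℕ → K := fun κ => ksign (-h) * psign K κ * pchoose (-h) κ
  let bb : ℕ × ℕ → K := fun κ => ksign (-l) * psign K κ * pchoose (-l) κ
  let ν : Idx K := g - 1 - μ
  -- the left hand side
  have hL : ∑ᶠ i : ℕ × ℕ, (psign K i * pchoose μ i) •
      rotatedSeries g h l p (μ - pcast K i) (n + pcast K i) k =
      ∑ᶠ y, (psign K y.2.2 * pchoose (μ - g) y.2.2 * aa y.1 * bb y.2.1) • Φ y := by
    obtain ⟨h1, h2⟩ := finsum_push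
      (fun x : (ℕ × ℕ) × ((ℕ × ℕ) × (ℕ × ℕ) × (ℕ × ℕ)) => (x.2.2.1, x.2.2.2, x.1 + x.2.1))
      (fun x => (psign K x.1 * pchoose μ x.1) *
        (psign K x.2.1 * pchoose (-g) x.2.1 * aa x.2.2.1 * bb x.2.2.2)) Φ
      (fun y => (panti y.2.2).image fun q => (q.1, q.2, y.1, y.2.1)) (by
        rintro ⟨i, κ1, κ2, κ3⟩ ⟨t, j, s⟩
        simp only [Finset.mem_image, mem_panti, Prod.mk.injEq]
        constructor
        · rintro ⟨q, h, rfl, rfl, rfl, rfl⟩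
          exact ⟨rfl, rfl, h⟩
        · rintro ⟨rfl, rfl, h⟩
          exact ⟨(i, κ1), h, rfl, rfl, rfl, rfl⟩) hΦ
    have e1 : ∀ y : (ℕ × ℕ) × (ℕ × ℕ) × (ℕ × ℕ),
        ∑ x ∈ (panti y.2.2).image fun q => (q.1, q.2, y.1, y.2.1),
          (psign K x.1 * pchoose μ x.1) *
            (psign K x.2.1 * pchoose (-g) x.2.1 * aa x.2.2.1 * bb x.2.2.2) =
        psign K y.2.2 * pchoose (μ - g) y.2.2 * aa y.1 * bb y.2.1 := by
      intro y
      rw [Finset.sum_image (fun q _ q' _ hq => Prod.ext (congrArg (fun x => x.1) hq)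
        (congrArg (fun x => x.2.1) hq)), sub_eq_add_neg, ← psign_mul_pchoose_add,
        Finset.sum_mul, Finset.sum_mul]
      exact Finset.sum_congr rfl fun q _ => by ring
    rw [finsum_congr fun y => congrArg (· • Φ y) (e1 y)] at h2
    rw [← h2, finsum_prod_eq (fun i (κ : (ℕ × ℕ) × (ℕ × ℕ) × (ℕ × ℕ)) =>
      ((psign K i * pchoose μ i) * (psign K κ.1 * pchoose (-g) κ.1 * aa κ.2.1 * bb κ.2.2)) •
        Φ (κ.2.1, κ.2.2, i + κ.1)) h1]
    refine finsum_congr fun i => ?_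
    rw [rotatedSeries, smul_finsum]
    refine finsum_congr fun κ => ?_
    rw [smul_smul]
    simp only [Φ, pcast_add]
    congr 2 <;> abel
  -- the right hand side
  have hR : ∑ᶠ t : ℕ × ℕ, zwPowW K V (-(h + l + pcast K t))
      (fun n k => pchoose (-h) t • translateFirst p n (μ - g + pcast K t) k) n k =
      ∑ᶠ y : (ℕ × ℕ) × (ℕ × ℕ) × (ℕ × ℕ), ((ksign (-h) * ksign (-l) * psign K y.1 *
        psign K y.2.1 * pchoose (-h - pcast K y.1 + -l) y.2.1) * pchoose (-h) y.1 *
        pchoose (ν - pcast K y.1 + pcast K y.2.2) y.2.2) • Φ y := by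
    rw [finsum_prod_prod_eq (fun t j s => ((ksign (-h) * ksign (-l) * psign K t *
        psign K j * pchoose (-h - pcast K t + -l) j) * pchoose (-h) t *
        pchoose (ν - pcast K t + pcast K s) s) • Φ (t, j, s))
        (hΦ.subset fun y hy => right_ne_zero_of_smul hy)]
    refine finsum_congr fun t => ?_
    rw [zwPowW_apply]
    refine finsum_congr fun j => ?_
    rw [translateFirst, smul_smul, smul_finsum]
    refine finsum_congr fun s => ?_
    rw [smul_smul]
    have e1 : ksign (-(h + l + pcast K t)) = ksign (-h) * ksign (-l) * psign K t := by
      have e2 := ksign_add (kbar_add (kbar_neg hh) (kbar_neg hl)) (kbar_neg (kbar_pcast t))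
      have e3 : ksign (-pcast K t) = psign K t := by
        have := ksign_neg (kbar_pcast (K := K) t)
        rw [ksign_pcast] at this
        linear_combination psign K t * this - ksign (-pcast K t) * psign_mul_self (K := K) t
      rw [ksign_add (kbar_neg hh) (kbar_neg hl), e3] at e2
      rw [← e2]
      congr 1
      abel
    have e4 : psign K s * pchoose (μ - g + pcast K t) s =
        pchoose (ν - pcast K t + pcast K s) s := by
      rw [pchoose_upper_neg]
      congr 1
      simp only [ν]
      abel
    have e5 : -(h + l + pcast K t) = -h - pcast K t + -l := by abel
    simp only [Φ]
    congr 1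
    · rw [e4, e1, e5]
    · congr 1 <;> abel
  -- the common refinement
  let W : (ℕ × ℕ) × (ℕ × ℕ) × (ℕ × ℕ) × (ℕ × ℕ) → K := fun x =>
    ksign (-h) * ksign (-l) * psign K (x.2.2.1 + x.2.1 + x.2.2.2) *
      pchoose (ν - pcast K x.2.2.1 + pcast K x.1) x.1 * pchoose (-h) x.2.2.1 *
      pchoose (-h - pcast K x.2.2.1) x.2.1 * pchoose (-l) x.2.2.2
  obtain ⟨-, h1⟩ := finsum_push
    (fun x : (ℕ × ℕ) × (ℕ × ℕ) × (ℕ × ℕ) × (ℕ × ℕ) =>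
      (x.2.2.1 + x.2.1, x.2.2.2, x.1 + x.2.1)) W Φ
    (fun y => ((panti y.2.2).filter fun q => q.2 ≤ y.1).image
      fun q => (q.1, q.2, y.1 - q.2, y.2.1)) (by
      rintro ⟨s, σ, t, j⟩ ⟨t', j', s'⟩
      simp only [Finset.mem_image, Finset.mem_filter, mem_panti, Prod.mk.injEq]
      constructor
      · rintro ⟨q, ⟨h, hle⟩, rfl, rfl, rfl, rfl⟩
        exact ⟨tsub_add_cancel_of_le hle, rfl, h⟩
      · rintro ⟨rfl, rfl, rfl⟩
        exact ⟨(s, σ), ⟨rfl, le_add_self⟩, rfl, rfl, add_tsub_cancel_right _ _, rfl⟩) hΦ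
  obtain ⟨-, h2⟩ := finsum_push
    (fun x : (ℕ × ℕ) × (ℕ × ℕ) × (ℕ × ℕ) × (ℕ × ℕ) => (x.2.2.1, x.2.1 + x.2.2.2, x.1)) W Φ
    (fun y => (panti y.2.1).image fun q => (y.2.2, q.1, y.1, q.2)) (by
      rintro ⟨s, σ, t, j⟩ ⟨t', j', s'⟩
      simp only [Finset.mem_image, mem_panti, Prod.mk.injEq]
      constructor
      · rintro ⟨q, h, rfl, rfl, rfl, rfl⟩
        exact ⟨rfl, h, rfl⟩
      · rintro ⟨rfl, h, rfl⟩
        exact ⟨(σ, j), h, rfl, rfl, rfl, rfl⟩) hΦ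
  have h3 : ∀ x : (ℕ × ℕ) × (ℕ × ℕ) × (ℕ × ℕ) × (ℕ × ℕ),
      W x • Φ (x.2.2.1 + x.2.1, x.2.2.2, x.1 + x.2.1) =
      W x • Φ (x.2.2.1, x.2.1 + x.2.2.2, x.1) := by
    intro x
    simp only [Φ, pcast_add]
    congr 2 <;> abel
  rw [hL, hR]
  refine Eq.trans ?_ ((h1.symm.trans (finsum_congr h3)).trans (h2.trans ?_))
  · refine finsum_congr fun y => ?_
    congr 1
    rw [Finset.sum_image (fun q _ q' _ hq => Prod.ext (congrArg (fun x => x.1) hq)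
      (congrArg (fun x => x.2.1) hq)), Finset.sum_filter]
    have e1 : psign K y.2.2 * pchoose (μ - g) y.2.2 =
        pchoose (ν - pcast K y.1 + pcast K y.2.2 + pcast K y.1) y.2.2 := by
      rw [pchoose_upper_neg]
      congr 1
      simp only [ν]
      abel
    rw [e1, pchoose_add, Finset.sum_mul, Finset.sum_mul]
    refine Finset.sum_congr rfl fun q hq => ?_
    split_ifs with hle
    · obtain ⟨t, ht⟩ := exists_add_of_le hle
      have ht' : y.1 - q.2 = t := by rw [ht, add_tsub_cancel_left]
      have e2 : ν - pcast K t + pcast K q.1 = ν - pcast K y.1 + pcast K y.2.2 := by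
        rw [← mem_panti.mp hq, ht, pcast_add, pcast_add]
        abel
      have e3 := pchoose_mul_pchoose (-h) t q.2
      simp only [W, ht', e2, aa, bb]
      rw [add_comm t q.2, ← ht] at e3
      rw [add_comm t q.2, ← ht, psign_add]
      linear_combination (ksign (-h) * ksign (-l) * psign K y.1 * psign K y.2.1 *
        pchoose (ν - pcast K y.1 + pcast K y.2.2) q.1 * pchoose (-l) y.2.1) * e3
    · rw [pchoose_pcast_of_not_le hle]
      ring
  · refine finsum_congr fun y => ?_
    congr 1
    rw [Finset.sum_image (fun q _ q' _ hq => Prod.ext (congrArg (fun x => x.2.1) hq)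
        (congrArg (fun x => x.2.2.2) hq)), pchoose_add, Finset.mul_sum, Finset.sum_mul,
        Finset.sum_mul]
    refine Finset.sum_congr rfl fun q hq => ?_
    simp only [W]
    rw [← mem_panti.mp hq, psign_add, psign_add, psign_add]
    ring

end Resummation

section Duality

variable {K : Type*} [Field K] [CharZero K] {V : Type*} [AddCommGroup V] [Module K V]

theorem tripleXW_apply (X W N : Idx K) (p : Dist2 K V) (m k : Idx K) :
    tripleXW K V X W N p m k = ∑ᶠ t : ℕ × ℕ, pchoose N t •
      p (k + W + pcast K t) (m + X + N - pcast K t) := rfl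

theorem tripleWX_apply (X W N : Idx K) (p : Dist2 K V) (m k : Idx K) :
    tripleWX K V X W N p m k = ∑ᶠ t : ℕ × ℕ, pchoose N t •
      p (k + W + N - pcast K t) (m + X + pcast K t) := rfl

variable {A : OPEAlg K V} {rr : V → V → ℕ} {hh : ∀ a b : V, Fin (rr a b) → Idx K}

theorem koszul_smul_shiftedProduct (a b c : V) (μ n k : Idx K) (κ : K) :
    κ • A.Y c k (A.Y (A.Y a μ b) n A.one) = ∑ᶠ i : ℕ × ℕ, (psign K i * pchoose μ i) •
      κ • A.Y c k (A.Y a (μ - pcast K i) (A.Y b (n + pcast K i) A.one)) := by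
  rw [Y_Y_one, shiftedProduct, map_finsum_of_finite _ (finite_support_shiftedProduct A a b n _ _),
    smul_finsum]
  exact finsum_congr fun i => by rw [map_smul, smul_comm]

theorem finsum_sum_comm_three {α ι κ σ : Type*} [Fintype ι] [Fintype κ] [Fintype σ]
    (f : α → ι → κ → σ → V)
    (hf : ∀ i j k, (Function.support fun x => f x i j k).Finite) :
    ∑ᶠ x, ∑ i, ∑ j, ∑ k, f x i j k = ∑ i, ∑ j, ∑ k, ∑ᶠ x, f x i j k := by
  have h : ∀ x, ∑ i, ∑ j, ∑ k, f x i j k = ∑ y : ι × κ × σ, f x y.1 y.2.1 y.2.2 := fun x => by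
    simp only [Fintype.sum_prod_type]
  rw [finsum_congr h, finsum_sum_comm Finset.univ (fun x (y : ι × κ × σ) => f x y.1 y.2.1 y.2.2)
    fun y _ => hf y.1 y.2.1 y.2.2]
  simp only [Fintype.sum_prod_type]

theorem UnifExponents.product_apply (H : UnifExponents A rr hh) {a b c : V} {pa pb pc : ZMod 2}
    (ha : memPar K A.ev A.od a pa) (hb : memPar K A.ev A.od b pb)
    (hc : memPar K A.ev A.od c pc)
    {p : Fin (rr a b) → Fin (rr a c) → Fin (rr b c) → Idx K → Idx K → Idx K → V}
    (hp : ∀ i j k, IsPow3 (p i j k))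
    (hcom : ∀ m n l, (koszul K pa pc * koszul K pb pc) • A.Y c l (A.Y a m (A.Y b n A.one)) =
      ∑ i, ∑ j, ∑ k, rotatedSeries (hh a b i) (hh a c j) (hh b c k) (p i j k) m n l)
    (μ n : Idx K) :
    A.Y (A.Y a μ b) n c = ∑ i, ∑ j, ∑ k, tripleWX K V (-(hh a b i)) (-(hh b c k))
      (-(hh a c j)) (fun w x => translateFirst (p i j k) w x (-1)) μ n := by
  have hac := (H.exists_pair ha hc).1
  have hbc := (H.exists_pair hb hc).1
  let S : Finset (ℕ × ℕ) := Finset.univ.biUnion fun i =>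
    (finite_pneg_add (μ - hh a b i)).toFinset
  have hS : ∀ i t, PNeg (μ - hh a b i + pcast K t) → t ∈ S := fun i t ht =>
    Finset.mem_biUnion.mpr ⟨i, Finset.mem_univ i, (Set.Finite.mem_toFinset _).mpr ht⟩
  let G : Fin (rr a b) × Fin (rr a c) × Fin (rr b c) × S → Idx K := fun β =>
    hh a c β.2.1 + hh b c β.2.2.1 + pcast K β.2.2.2.1
  let q : Fin (rr a b) × Fin (rr a c) × Fin (rr b c) × S → Dist2 K V := fun β n k =>
    pchoose (-(hh a c β.2.1)) β.2.2.2.1 • translateFirst (p β.1 β.2.1 β.2.2.1) n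
      (μ - hh a b β.1 + pcast K β.2.2.2.1) k
  have hq0 : ∀ i j k t n y, t ∉ S →
      translateFirst (p i j k) n (μ - hh a b i + pcast K t) y = 0 := fun i j k t n y ht => by
    by_contra hne
    exact ht (hS i t ((hp i j k).translateFirst _ _ _ hne).2.1)
  have h := H.eq_of_commuted (A.Y_par a pa ha μ b pb hb) hc G q
    (fun β => kbar_add (kbar_add (hac _) (hbc _)) (kbar_pcast _))
    (fun β n k hne => by
      obtain ⟨h1, -, h3⟩ := (hp β.1 β.2.1 β.2.2.1).translateFirst _ _ _ (right_ne_zero_of_smul hne)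
      exact ⟨h1, h3⟩)
    (fun n k => by
      rw [koszul_add, koszul_smul_shiftedProduct]
      simp only [hcom, Finset.smul_sum]
      rw [finsum_sum_comm_three]
      · simp only [finsum_rotatedSeries (hp _ _ _) (hac _) (hbc _), Fintype.sum_prod_type]
        refine Finset.sum_congr rfl fun i _ => Finset.sum_congr rfl fun j _ =>
          Finset.sum_congr rfl fun k' _ => ?_
        rw [finsum_eq_sum_of_support_subset (s := S), ← Finset.sum_coe_sort S]
        intro t ht
        by_contra h0
        refine ht ?_
        simp only [hq0 i j k' t _ _ h0, smul_zero]
        rw [zwPowW_apply]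
        simp
      · intro i j k'
        refine (finite_pneg_add n).subset fun i hi => ?_
        exact pneg_of_rotatedSeries_ne_zero (hp _ _ _) (right_ne_zero_of_smul hi)) n
  rw [h]
  simp only [Fintype.sum_prod_type]
  refine Finset.sum_congr rfl fun i _ => Finset.sum_congr rfl fun j _ =>
    Finset.sum_congr rfl fun k' _ => ?_
  rw [tripleWX_apply, finsum_eq_sum_of_support_subset (s := S), ← Finset.sum_coe_sort S]
  · refine Finset.sum_congr rfl fun t _ => ?_
    simp only [q, G]
    congr 2 <;> abel
  · intro t ht
    by_contra h0
    exact ht (by simp only [← sub_eq_add_neg, hq0 i j k' t _ _ h0, smul_zero])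

theorem finsum_direct {p : Idx K → Idx K → Idx K → V} (hp : IsPow3 p) (g h l m k : Idx K) :
    ∑ᶠ i : ℕ × ℕ, (psign K i * pchoose m i) • ∑ᶠ κ : ℕ × ℕ, (psign K κ * pchoose (-g) κ) •
      p (m - pcast K i - g - h - pcast K κ) (k + pcast K i - l + pcast K κ) (-1) =
    tripleXW K V (-g) (-l) (-h) (fun w x => translateFirst p w x (-1)) m k := by
  let Φ : ℕ × ℕ → V := fun s => p (m - g - h - pcast K s) (k - l + pcast K s) (-1)
  have hΦ : (Function.support Φ).Finite :=
    (finite_pneg_add (k - l)).subset fun s hs => (hp _ _ _ hs).2.1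
  have e1 : ∀ i κ : ℕ × ℕ, p (m - pcast K i - g - h - pcast K κ)
      (k + pcast K i - l + pcast K κ) (-1) = Φ (i + κ) := fun i κ => by
    simp only [Φ, pcast_add]
    congr 1 <;> abel
  simp only [e1]
  rw [finsum_smul_finsum_add _ _ _ hΦ, tripleXW_apply]
  obtain ⟨h1, h2⟩ := finsum_push (fun x : (ℕ × ℕ) × (ℕ × ℕ) => x.1 + x.2)
    (fun x => pchoose (-h) x.1 * (psign K x.2 * pchoose (m - g - h - pcast K x.1) x.2)) Φ panti
    (fun x y => mem_panti) hΦ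
  have e2 : ∀ t : ℕ × ℕ, pchoose (-h) t • translateFirst p (k + -l + pcast K t)
      (m + -g + -h - pcast K t) (-1) = ∑ᶠ i : ℕ × ℕ, (pchoose (-h) t *
        (psign K i * pchoose (m - g - h - pcast K t) i)) • Φ (t + i) := fun t => by
    rw [translateFirst, smul_finsum]
    refine finsum_congr fun i => ?_
    rw [smul_smul]
    simp only [Φ, pcast_add, ← sub_eq_add_neg]
    congr 2 <;> abel
  rw [finsum_congr e2, ← finsum_prod_eq _ h1, h2]
  refine finsum_congr fun s => ?_
  congr 1
  rw [psign_mul_pchoose_add, pchoose_upper_neg]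
  have e3 : pcast K s - 1 - (m + -g) = -h + (pcast K s - 1 - m + g + h) := by abel
  rw [e3, pchoose_add]
  refine Finset.sum_congr rfl fun q hq => ?_
  rw [pchoose_upper_neg, ← mem_panti.mp hq, pcast_add]
  congr 2
  abel

theorem lhsXW_eq_sum_tripleXW {a b c : V}
    {p : Fin (rr a b) → Fin (rr a c) → Fin (rr b c) → Idx K → Idx K → Idx K → V}
    (hp : ∀ i j k, IsPow3 (p i j k))
    (hcom : ∀ m n, A.Y a m (A.Y b n c) = ∑ i, ∑ j, ∑ k, ∑ᶠ κ : ℕ × ℕ,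
      (psign K κ * pchoose (-(hh a b i)) κ) •
        p i j k (m - hh a b i - hh a c j - pcast K κ) (n - hh b c k + pcast K κ) (-1))
    (m k : Idx K) :
    lhsXW K V V (fun a => A.Y a) a (fun k => A.Y b k c) m k =
      ∑ i, ∑ j, ∑ k', tripleXW K V (-(hh a b i)) (-(hh b c k')) (-(hh a c j))
        (fun w x => translateFirst (p i j k') w x (-1)) m k := by
  rw [lhsXW_apply]
  simp only [hcom, Finset.smul_sum]
  rw [finsum_sum_comm_three]
  · simp only [finsum_direct (hp _ _ _)]
  · intro i j k'
    refine (finite_pneg_add (k - hh b c k')).subset fun x hx => ?_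
    obtain ⟨κ, hκ⟩ : ∃ κ : ℕ × ℕ, (psign K κ * pchoose (-(hh a b i)) κ) •
        p i j k' (m - pcast K x - hh a b i - hh a c j - pcast K κ)
          (k + pcast K x - hh b c k' + pcast K κ) (-1) ≠ 0 := by
      by_contra! h0
      refine hx ?_
      simp only [h0, finsum_zero, smul_zero]
    have h1 := pneg_of_pneg_add (hp _ _ _ _ _ _ (right_ne_zero_of_smul hκ)).2.1
    rwa [add_sub_right_comm] at h1

end Duality

section Products

variable {K : Type*} [Field K] [CharZero K] {V : Type*} [AddCommGroup V] [Module K V]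

theorem pchoose_pcast_symm (r i : ℕ × ℕ) :
    pchoose (pcast K (r + i)) i = pchoose (pcast K (r + i)) r := by
  rw [pchoose_pcast, pchoose_pcast, Prod.fst_add, Prod.snd_add, Nat.choose_symm_add,
    Nat.choose_symm_add]

theorem diag_ddPow2_eq_tripleWX {p : Idx K → Idx K → Idx K → V} (hp : IsPow3 p)
    (g h l n m : Idx K) :
    diag K V (ddPow2 K V (g.1 - 1 - n.1, g.2 - 1 - n.2)
      (fun x y => p (x - h) (y - l) (-1))) m =
    tripleWX K V (-g) (-l) (-h) (fun w x => translateFirst p w x (-1)) n m := by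
  rw [diag_ddPow2, tripleWX_apply]
  by_cases hE : ∃ E, g - 1 - n = pcast K E
  · obtain ⟨E, hE⟩ := hE
    have hE1 : g.1 - 1 - n.1 = (E.1 : K) := congrArg Prod.fst hE
    have hE2 : g.2 - 1 - n.2 = (E.2 : K) := congrArg Prod.snd hE
    simp only [hE1, hE2]
    let Φ : ℕ × ℕ → V := fun s => p (-1 - pcast K s) (m - l - h - pcast K E + pcast K s) (-1)
    have hΦ : (Function.support Φ).Finite :=
      (finite_pneg_add (m - l - h - pcast K E)).subset fun s hs => (hp _ _ _ hs).2.1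
    have hn : n + -g = -1 - pcast K E := by rw [← hE]; abel
    have hL : ∑ᶠ v : Idx K, (gchooseExt (-1 - v.1) (E.1 : K) * gchooseExt (-1 - v.2) (E.2 : K)) •
        p (v - h) (m - ((E.1 : K), (E.2 : K)) - 1 - v - l) (-1) =
        ∑ᶠ s : ℕ × ℕ, pchoose (-h + pcast K s) E • Φ s := by
      have hinj : Function.Injective fun s : ℕ × ℕ => h - 1 - pcast K s := fun s s' hs =>
        pcast_injective (sub_right_injective hs)
      rw [finsum_eq_of_support_subset_range hinj]
      · refine finsum_congr fun s => ?_
        have e1 : -1 - (h - 1 - pcast K s) = -h + pcast K s := by abel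
        have e2 : h - 1 - pcast K s - h = -1 - pcast K s := by abel
        have e3 : m - ((E.1 : K), (E.2 : K)) - 1 - (h - 1 - pcast K s) - l =
          m - l - h - pcast K E + pcast K s := by
          simp only [pcast]
          abel
        rw [e2, e3, gchooseExt_nat, gchooseExt_nat]
        rw [← e1]
        rfl
      · intro v hv
        obtain ⟨s, hs⟩ := pneg_iff.mp (hp _ _ _ (right_ne_zero_of_smul hv)).1
        exact ⟨s, by linear_combination -hs⟩
    have hR : ∀ q ∈ panti E, pchoose (-h) q.1 • translateFirst p (m + -l + -h - pcast K q.1)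
        (n + -g + pcast K q.1) (-1) =
        ∑ᶠ s : ℕ × ℕ, (pchoose (-h) q.1 * pchoose (pcast K s) q.2) • Φ s := by
      intro q hq
      have hinj : Function.Injective fun i : ℕ × ℕ => q.2 + i := add_right_injective q.2
      symm
      rw [translateFirst, smul_finsum, finsum_eq_of_support_subset_range hinj]
      · refine finsum_congr fun i => ?_
        have hE3 : pcast K E = pcast K q.1 + pcast K q.2 := by rw [← mem_panti.mp hq, pcast_add]
        have e1 : pcast K i - 1 - (n + -g + pcast K q.1) = pcast K (q.2 + i) := by
          rw [hn, hE3, pcast_add]; abel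
        rw [smul_smul (pchoose (-h) q.1), pchoose_upper_neg, e1, pchoose_pcast_symm]
        simp only [Φ]
        rw [hn, hE3, pcast_add]
        congr 2 <;> abel
      · intro s hs
        by_contra h0
        refine hs ?_
        have hle : ¬ q.2 ≤ s := fun hle => h0 <| by
          obtain ⟨i, hi⟩ := exists_add_of_le hle
          exact ⟨i, hi.symm⟩
        simp only [pchoose_pcast_of_not_le hle, mul_zero, zero_smul]
    rw [hL]
    symm
    rw [finsum_eq_sum_of_support_subset (s := (panti E).image Prod.fst),
      Finset.sum_image, Finset.sum_congr rfl hR, ← finsum_sum_comm]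
    · refine finsum_congr fun s => ?_
      rw [pchoose_add, Finset.sum_smul]
    · exact fun q _ => hΦ.subset fun s hs => right_ne_zero_of_smul hs
    · intro q hq q' hq' h0
      have h1 := mem_panti.mp hq
      rw [← mem_panti.mp hq', h0] at h1
      exact Prod.ext h0 (add_left_cancel h1)
    · intro t ht
      have h1 := (hp.translateFirst _ _ _ (right_ne_zero_of_smul ht)).2.1
      rw [hn] at h1
      obtain ⟨r, hr⟩ := pneg_iff.mp h1
      have h2 : t + r = E := pcast_injective (K := K) (by rw [pcast_add]; linear_combination hr)
      rw [Finset.coe_image]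
      exact ⟨(t, r), mem_panti.mpr h2, rfl⟩
  · have h1 : ∀ v : Idx K, (gchooseExt (-1 - v.1) (g.1 - 1 - n.1) *
        gchooseExt (-1 - v.2) (g.2 - 1 - n.2)) = 0 := by
      intro v
      by_cases h1 : ∃ j : ℕ, (j : K) = g.1 - 1 - n.1
      · rw [gchooseExt_of_not (-1 - v.2), mul_zero]
        rintro ⟨j', hj'⟩
        obtain ⟨j, hj⟩ := h1
        exact hE ⟨(j, j'), Prod.ext hj.symm hj'.symm⟩
      · rw [gchooseExt_of_not _ h1, zero_mul]
    simp only [h1, zero_smul, finsum_zero]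
    symm
    refine (finsum_congr fun t => ?_).trans finsum_zero
    by_contra h0
    obtain ⟨r, hr⟩ := pneg_iff.mp (hp.translateFirst _ _ _ (right_ne_zero_of_smul h0)).2.1
    exact hE ⟨t + r, by rw [pcast_add]; linear_combination -hr⟩

theorem InLat2.sum {ι : Type*} (s : Finset ι) {c : ι → Dist2 K V} (hc : ∀ i, InLat2 K V (c i)) :
    InLat2 K V (fun n k => ∑ i ∈ s, c i n k) := by
  choose S hS using hc
  refine ⟨s.biUnion S, fun n k hne => ?_⟩
  obtain ⟨i, hi, hne⟩ := Finset.exists_ne_zero_of_sum_ne_zero hne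
  obtain ⟨m, hm, h⟩ := hS i n k hne
  exact ⟨m, Finset.mem_biUnion.mpr ⟨i, hi, hm⟩, h⟩

theorem InLat2.neg {c : Dist2 K V} (hc : InLat2 K V c) : InLat2 K V (-c) := by
  obtain ⟨S, hS⟩ := hc
  exact ⟨S, fun n k hne => hS n k fun h0 => hne (neg_eq_zero.mpr h0)⟩

theorem IsPow3.inLat2_shift {p : Idx K → Idx K → Idx K → V} (hp : IsPow3 p) (h l : Idx K) :
    InLat2 K V (fun x y => p (x - h) (y - l) (-1)) :=
  ⟨{(h, l)}, fun _ _ hne => ⟨_, Finset.mem_singleton_self _, (hp _ _ _ hne).1, (hp _ _ _ hne).2.1⟩⟩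

theorem zwPow_neg (h : Idx K) (c : Dist2 K V) (n k : Idx K) :
    zwPow K V h (-c) n k = -zwPow K V h c n k := by
  rw [zwPow_apply, zwPow_apply, ← finsum_neg_distrib]
  exact finsum_congr fun j => smul_neg _ _

theorem diag_ddPow2_neg (e : Idx K) (c : Dist2 K V) (m : Idx K) :
    diag K V (ddPow2 K V e (-c)) m = -diag K V (ddPow2 K V e c) m := by
  rw [diag_ddPow2, diag_ddPow2, ← finsum_neg_distrib]
  exact finsum_congr fun j => smul_neg _ _

theorem finite_support_diag_ddPow2 {c : Dist2 K V} (hc : InLat2 K V c) (e : Idx K) (m : Idx K)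
    (f : Idx K → K) : (Function.support fun v => f v • c v (m - e - 1 - v)).Finite :=
  (hc.finite_support_line (m - e - 1)).subset fun _ hv => right_ne_zero_of_smul hv

theorem diag_ddPow2_sum {ι : Type*} (s : Finset ι) {c : ι → Dist2 K V}
    (hc : ∀ i, InLat2 K V (c i)) (e m : Idx K) :
    diag K V (ddPow2 K V e fun n k => ∑ i ∈ s, c i n k) m =
      ∑ i ∈ s, diag K V (ddPow2 K V e (c i)) m := by
  simp only [diag_ddPow2]
  rw [← finsum_sum_comm _ _ fun i _ => finite_support_diag_ddPow2 (hc i) e m _]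
  exact finsum_congr fun v => Finset.smul_sum

theorem diag_ddPow2_add {c c' : Dist2 K V} (hc : InLat2 K V c) (hc' : InLat2 K V c')
    (e m : Idx K) :
    diag K V (ddPow2 K V e fun n k => c n k + c' n k) m =
      diag K V (ddPow2 K V e c) m + diag K V (ddPow2 K V e c') m := by
  have h := diag_ddPow2_sum Finset.univ (c := Bool.rec c' c)
    (by rintro (_ | _); exacts [hc', hc]) e m
  simpa only [Fintype.sum_bool] using h

theorem prodAt_add {r : ℕ} {c : Fin r → EDist2 K V} (hc : ∀ i, IsField2D K V (c i))
    (h : Fin r → Idx K) (n : Idx K) (v w : V) (m : Idx K) :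
    prodAt K V c h n (v + w) m = prodAt K V c h n v m + prodAt K V c h n w m := by
  unfold prodAt
  rw [← Finset.sum_add_distrib]
  refine Finset.sum_congr rfl fun i _ => ?_
  rw [← diag_ddPow2_add (hc i v) (hc i w)]
  congr 2
  funext n k
  exact map_add _ _ _

variable {A : OPEAlg K V} {rr : V → V → ℕ} {hh : ∀ a b : V, Fin (rr a b) → Idx K}

theorem prodAt_eq_sum_tripleWX {a b v : V} {r : ℕ} {c : Fin r → EDist2 K V} {h : Fin r → Idx K}
    (hc : ∀ i, IsField2D K V (c i))
    (hOPE : ∀ m k, A.Y a m (A.Y b k v) = ∑ i, zwPow K V (-(h i)) (ev2 K V (c i) v) m k)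
    {p : Fin (rr a b) → Fin (rr a v) → Fin (rr b v) → Idx K → Idx K → Idx K → V}
    (hp : ∀ i j k, IsPow3 (p i j k))
    (hprod : ∀ m n, A.Y a m (A.Y b n v) = ∑ i, ∑ j, ∑ k, ∑ᶠ κ : ℕ × ℕ,
      (psign K κ * pchoose (-(hh a b i)) κ) •
        p i j k (m - hh a b i - hh a v j - pcast K κ) (n - hh b v k + pcast K κ) (-1))
    (n m : Idx K) :
    prodAt K V c h n v m = ∑ i, ∑ j, ∑ k, tripleWX K V (-(hh a b i)) (-(hh b v k))
      (-(hh a v j)) (fun w x => translateFirst (p i j k) w x (-1)) n m := by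
  let D : Fin (rr a b) → Dist2 K V := fun i x y =>
    ∑ q : Fin (rr a v) × Fin (rr b v), p i q.1 q.2 (x - hh a v q.1) (y - hh b v q.2) (-1)
  have hD : ∀ i, InLat2 K V (D i) := fun i =>
    InLat2.sum _ fun q => (hp i q.1 q.2).inLat2_shift _ _
  have hDz : ∀ i m k, zwPow K V (-(hh a b i)) (D i) m k = ∑ j, ∑ k', ∑ᶠ κ : ℕ × ℕ,
      (psign K κ * pchoose (-(hh a b i)) κ) •
        p i j k' (m - hh a b i - hh a v j - pcast K κ) (k - hh b v k' + pcast K κ) (-1) := by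
    intro i m k
    rw [zwPow_apply]
    simp only [D, Finset.smul_sum]
    rw [finsum_sum_comm]
    · rw [Fintype.sum_prod_type]
      refine Finset.sum_congr rfl fun j _ => Finset.sum_congr rfl fun k' _ =>
        finsum_congr fun κ => ?_
      congr 2 <;> abel
    · intro q _
      refine (finite_pneg_add (k - hh b v q.2)).subset fun κ hκ => ?_
      have h1 := (hp _ _ _ _ _ _ (right_ne_zero_of_smul hκ)).2.1
      rwa [add_sub_right_comm] at h1
  have key := sum_diag_ddPow2_eq_zero (Sum.elim h (hh a b))
    (Sum.elim (fun i => ev2 K V (c i) v) fun i => -D i)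
    (by rintro (i | i); exacts [hc i v, (hD i).neg])
    (fun m k => by
      rw [Fintype.sum_sum_type]
      simp only [Sum.elim_inl, Sum.elim_inr, zwPow_neg, Finset.sum_neg_distrib, hDz]
      rw [← hOPE, ← hprod, add_neg_cancel]) n m
  rw [Fintype.sum_sum_type] at key
  simp only [Sum.elim_inl, Sum.elim_inr, diag_ddPow2_neg, Finset.sum_neg_distrib] at key
  rw [prodAt, ← sub_eq_zero, sub_eq_add_neg, ← key]
  congr 2
  refine Finset.sum_congr rfl fun i _ => ?_
  refine Eq.trans ?_ (diag_ddPow2_sum Finset.univ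
    (fun q : Fin (rr a v) × Fin (rr b v) => (hp i q.1 q.2).inLat2_shift (hh a v q.1) (hh b v q.2))
    _ m).symm
  rw [Fintype.sum_prod_type]
  exact Finset.sum_congr rfl fun j _ => Finset.sum_congr rfl fun k _ =>
    (diag_ddPow2_eq_tripleWX (hp i j k) _ _ _ _ _).symm

end Products

section SelfModule

variable {K : Type*} [Field K] [CharZero K] {V : Type*} [AddCommGroup V] [Module K V]
variable {A : OPEAlg K V} {rr : V → V → ℕ} {hh : ∀ a b : V, Fin (rr a b) → Idx K}

theorem UnifExponents.product_eq_prodAt (H : UnifExponents A rr hh) {a b : V} {pa pb : ZMod 2}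
    (ha : memPar K A.ev A.od a pa) (hb : memPar K A.ev A.od b pb)
    {r : ℕ} {c : Fin r → EDist2 K V} {h : Fin r → Idx K}
    (hc : IsOPE K V pa pb (A.Y a) (A.Y b) c h) (n : Idx K) (v : V) (m : Idx K) :
    A.Y (A.Y a n b) m v = prodAt K V c h n v m := by
  have key : ∀ {v pv}, memPar K A.ev A.od v pv →
      A.Y (A.Y a n b) m v = prodAt K V c h n v m := by
    intro v pv hv
    obtain ⟨p, hp, hprod, hcom⟩ := H.exists_triple ha hb hv
    rw [H.product_apply ha hb hv hp hcom,
      prodAt_eq_sum_tripleWX hc.2.1 (hc.2.2.1 v) hp hprod]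
  obtain ⟨v0, v1, hv0, hv1, rfl⟩ := exists_par_decomp A v
  rw [map_add, prodAt_add hc.2.1, key hv0, key hv1]

theorem UnifExponents.lhsXW_add (H : UnifExponents A rr hh) (a b c c' : V) (m k : Idx K) :
    lhsXW K V V (fun a => A.Y a) a (fun k => A.Y b k (c + c')) m k =
      lhsXW K V V (fun a => A.Y a) a (fun k => A.Y b k c) m k +
      lhsXW K V V (fun a => A.Y a) a (fun k => A.Y b k c') m k := by
  have hfin : ∀ c, (Function.support fun i : ℕ × ℕ => (psign K i * pchoose m i) •
      A.Y a (m - pcast K i) (A.Y b (k + pcast K i) c)).Finite := by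
    intro c
    obtain ⟨S, hS⟩ := H.inLat1 b c
    refine (S.finite_toSet.biUnion fun x _ => finite_pneg_add (k - x)).subset fun i hi => ?_
    obtain ⟨x, hx, h⟩ := hS (k + pcast K i) fun h0 => hi (by
      have h0' : A.Y b (k + pcast K i) c = 0 := h0
      simp only [h0', map_zero, smul_zero])
    simp only [Set.mem_iUnion]
    refine ⟨x, hx, ?_⟩
    have e : k - x + pcast K i = k + pcast K i - x := by abel
    rw [Set.mem_ofPred_eq, e]
    exact h
  simp only [lhsXW_apply]
  rw [← finsum_add_distrib (hfin c) (hfin c')]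
  exact finsum_congr fun i => by rw [map_add, map_add, smul_add]

theorem UnifExponents.exists_dual (H : UnifExponents A rr hh) {a b c : V} {pa pb pc : ZMod 2}
    (ha : memPar K A.ev A.od a pa) (hb : memPar K A.ev A.od b pb)
    (hc : memPar K A.ev A.od c pc) :
    ∃ p : Fin (rr a b) → Fin (rr a c) → Fin (rr b c) → Dist2 K V,
      (∀ i j k, IsPow2 K V (p i j k)) ∧
      (∀ m k, lhsXW K V V (fun a => A.Y a) a (fun k' => A.Y b k' c) m k =
        ∑ i, ∑ j, ∑ kk, tripleXW K V (-(hh a b i)) (-(hh b c kk)) (-(hh a c j)) (p i j kk) m k) ∧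
      ∀ m k, A.Y (A.Y a m b) k c =
        ∑ i, ∑ j, ∑ kk, tripleWX K V (-(hh a b i)) (-(hh b c kk)) (-(hh a c j)) (p i j kk) m k := by
  obtain ⟨p, hp, hprod, hcom⟩ := H.exists_triple ha hb hc
  refine ⟨fun i j k w x => translateFirst (p i j k) w x (-1), fun i j k w x hne => ?_,
    lhsXW_eq_sum_tripleXW hp hprod, H.product_apply ha hb hc hp hcom⟩
  obtain ⟨h1, h2, -⟩ := (hp i j k).translateFirst _ _ _ hne
  exact ⟨h1, h2⟩

theorem tripleXW_zero (X W N m k : Idx K) : tripleXW K V X W N 0 m k = 0 := by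
  simp [tripleXW_apply]

theorem tripleWX_zero (X W N m k : Idx K) : tripleWX K V X W N 0 m k = 0 := by
  simp [tripleWX_apply]

/-- An exponent, replaced by zero if it does not lie in `Kbar`. -/
def kbarPart (h : Idx K) : Idx K := if Kbar K h then h else 0

theorem kbar_kbarPart (h : Idx K) : Kbar K (kbarPart h) := by
  unfold kbarPart
  split_ifs with hK
  · exact hK
  · exact kbar_zero

theorem UnifExponents.kbarPart_eq (H : UnifExponents A rr hh) {a b : V} {pa pb : ZMod 2}
    (ha : memPar K A.ev A.od a pa) (hb : memPar K A.ev A.od b pb) (i : Fin (rr a b)) :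
    kbarPart (hh a b i) = hh a b i :=
  if_pos ((H.exists_pair ha hb).1 i)

theorem UnifExponents.isDualMod (H : UnifExponents A rr hh) :
    IsDualMod K V V A.ev A.od (fun a => A.Y a) (fun a => A.Y a) := by
  choose x y hx hy hxy using exists_par_decomp A
  refine ⟨rr, fun a b i => kbarPart (hh a b i), fun a c => rr a (x c) + rr a (y c),
    fun a c => Fin.append (fun j => kbarPart (hh a (x c) j)) fun j => kbarPart (hh a (y c) j),
    fun a b i => kbar_kbarPart _, fun a c => ?_, fun a b pa pb ha hb c => ?_⟩
  · refine Fin.addCases (fun j => ?_) fun j => ?_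
    · simp only [Fin.append_left]
      exact kbar_kbarPart _
    · simp only [Fin.append_right]
      exact kbar_kbarPart _
  · obtain ⟨p, hp, hpl, hpr⟩ := H.exists_dual ha hb (hx c)
    obtain ⟨q, hq, hql, hqr⟩ := H.exists_dual ha hb (hy c)
    have h0 : IsPow2 K V (0 : Dist2 K V) := fun _ _ hne => absurd rfl hne
    refine ⟨fun i => Fin.addCases (fun j => Fin.addCases (fun k => p i j k) fun k => 0)
      fun j => Fin.addCases (fun k => 0) fun k => q i j k, fun i => ?_, fun m k => ?_,
      fun m k => ?_⟩
    · refine Fin.addCases (fun j => Fin.addCases (fun k => ?_) fun k => ?_)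
        fun j => Fin.addCases (fun k => ?_) fun k => ?_ <;>
        simp only [Fin.addCases_left, Fin.addCases_right]
      exacts [hp i j k, h0, h0, hq i j k]
    · conv_lhs => rw [hxy c]
      rw [H.lhsXW_add, hpl, hql]
      simp only [Fin.sum_univ_add, Fin.append_left, Fin.append_right, Fin.addCases_left,
        Fin.addCases_right, tripleXW_zero, Finset.sum_const_zero, add_zero, zero_add,
        Finset.sum_add_distrib, H.kbarPart_eq ha hb, H.kbarPart_eq ha (hx c),
        H.kbarPart_eq ha (hy c), H.kbarPart_eq hb (hx c), H.kbarPart_eq hb (hy c)]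
    · conv_lhs => rw [hxy c]
      show A.Y (A.Y a m b) k (x c + y c) = _
      rw [map_add, hpr, hqr]
      simp only [Fin.sum_univ_add, Fin.append_left, Fin.append_right, Fin.addCases_left,
        Fin.addCases_right, tripleWX_zero, Finset.sum_const_zero, add_zero, zero_add,
        Finset.sum_add_distrib, H.kbarPart_eq ha hb, H.kbarPart_eq ha (hx c),
        H.kbarPart_eq ha (hy c), H.kbarPart_eq hb (hx c), H.kbarPart_eq hb (hy c)]

end SelfModule

/-- a uniformly local OPE-algebra V, with Y_M := Y, is a module
over itself: V is a bounded 𝕂̄-fold V-module, 𝐓 is a translation endomorphism,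
V is dual, and Y is a morphism of K²-fold algebras. -/
theorem stmt_17 (K : Type*) [Field K] [CharZero K]
    (V : Type*) [AddCommGroup V] [Module K V]
    (A : OPEAlg K V) (hu : UnifLocalAlg K V A) :
    (∀ (a v : V), InLat1 K V (ev1 K V (A.Y a) v)) ∧
    (∀ (a : V) (n : Idx K), ¬ Kbar K n → ∀ b : V, A.Y a n b = 0) ∧
    (∀ (a : V) (p : ZMod 2), memPar K A.ev A.od a p →
      ∀ n : Idx K, EndPar K A.ev A.od (A.Y a n) p) ∧
    TransEnd K V V (fun a => A.Y a) A.T A.Tb ∧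
    IsDualMod K V V A.ev A.od (fun a => A.Y a) (fun a => A.Y a) ∧
    (∀ (a b : V) (pa pb : ZMod 2), memPar K A.ev A.od a pa → memPar K A.ev A.od b pb →
      ∀ {r : ℕ} (c : Fin r → EDist2 K V) (h : Fin r → Idx K),
        IsOPE K V pa pb (A.Y a) (A.Y b) c h →
        ∀ (n : Idx K) (v : V) (m : Idx K),
          A.Y (A.Y a n b) m v = prodAt K V c h n v m) := by
  obtain ⟨rr, hh, hu⟩ := hu
  have H : UnifExponents A rr hh := hu
  exact ⟨H.inLat1, fun a n hn b => H.bounded a n hn b, fun a p ha n => Y_endPar A ha n,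
    H.transEnd, H.isDualMod,
    fun a b pa pb ha hb _ c h hc n v m => H.product_eq_prodAt ha hb hc n v m⟩

end OPEA
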